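/- arXiv:2302.01638 — 2 statements merged into one kernel-verified Lean document; each statement's English description precedes it below -/
import Mathlib

section
/- Let G be a connected chordless graph with maximum degree Δ. If G is not a cycle, then a'(G) = Δ; if G is a cycle, then a'(G) = Δ + 1 = 3. -/
open SimpleGraph

noncomputable def edeg {V : Type*} (G : SimpleGraph V) (v : V) : ℕ :=
  {u | G.Adj v u}.ncard

def IsProperEdgeColoring {V : Type*} (G : SimpleGraph V) (c : Sym2 V → ℕ) : Prop :=
  ∀ e₁ ∈ G.edgeSet, ∀ e₂ ∈ G.edgeSet, e₁ ≠ e₂ → (∃ v, v ∈ e₁ ∧ v ∈ e₂) → c e₁ ≠ c e₂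

def IsAcyclicEdgeColoring {V : Type*} (G : SimpleGraph V) (c : Sym2 V → ℕ) : Prop :=
  IsProperEdgeColoring G c ∧
  ∀ (v : V) (w : G.Walk v v), w.IsCycle →
    ¬ ∃ α β : ℕ, ∀ e ∈ w.edges, c e = α ∨ c e = β

noncomputable def acyclicChromaticIndex {V : Type*} (G : SimpleGraph V) : ℕ :=
  sInf {n | ∃ c : Sym2 V → ℕ, IsAcyclicEdgeColoring G c ∧ ∀ e ∈ G.edgeSet, c e < n}

def Chordless {V : Type*} (G : SimpleGraph V) : Prop :=
  ∀ u v : V, G.Adj u v →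
    ¬ ∃ (x : V) (w : (G.deleteEdges {s(u, v)}).Walk x x),
        w.IsCycle ∧ u ∈ w.support ∧ v ∈ w.support

namespace ChL
universe u
variable {V : Type u} {K : Type}

/-- two-coloured subgraph -/
def CG (G : SimpleGraph V) (c : Sym2 V → K) (α β : K) : SimpleGraph V where
  Adj x y := G.Adj x y ∧ (c s(x, y) = α ∨ c s(x, y) = β)
  symm := ⟨fun x y h => ⟨h.1.symm, by rw [Sym2.eq_swap]; exact h.2⟩⟩
  loopless := ⟨fun x h => G.loopless.irrefl x h.1⟩

def AEC (G : SimpleGraph V) (c : Sym2 V → K) : Prop :=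
  (∀ x y z, G.Adj x y → G.Adj x z → y ≠ z → c s(x, y) ≠ c s(x, z)) ∧
  ∀ α β, (CG G c α β).IsAcyclic

/-- delete all edges at a vertex -/
def del (G : SimpleGraph V) (w : V) : SimpleGraph V where
  Adj x y := G.Adj x y ∧ x ≠ w ∧ y ≠ w
  symm := ⟨fun _ _ h => ⟨h.1.symm, h.2.2, h.2.1⟩⟩
  loopless := ⟨fun x h => G.loopless.irrefl x h.1⟩

theorem del_le (G : SimpleGraph V) (w : V) : del G w ≤ G := fun _ _ h => h.1

theorem AEC.mono {G G' : SimpleGraph V} {c : Sym2 V → K} (h : AEC G c) (hle : G' ≤ G) :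
    AEC G' c :=
  ⟨fun x y z h1 h2 h3 => h.1 x y z (hle h1) (hle h2) h3,
   fun α β => IsAcyclic.anti (G' := CG G c α β) (fun _ _ h => ⟨hle h.1, h.2⟩) (h.2 α β)⟩

theorem CG_comm (G : SimpleGraph V) (c : Sym2 V → K) (α β : K) : CG G c α β = CG G c β α := by
  ext x y; simp only [CG]; tauto

theorem reach_map {H H' : SimpleGraph V} (f : V → V)
    (hf : ∀ a b, H.Adj a b → f a = f b ∨ H'.Adj (f a) (f b)) {a b : V} (h : H.Reachable a b) :
    H'.Reachable (f a) (f b) := by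
  obtain ⟨p⟩ := h
  induction p with
  | nil => exact Reachable.refl _
  | cons hadj p ih =>
    rcases hf _ _ hadj with h | h
    · rw [h]; exact ih
    · exact h.reachable.trans ih

theorem reach_closed {H : SimpleGraph V} (S : Set V)
    (hf : ∀ a b, a ∈ S → H.Adj a b → b ∈ S) {a b : V} (h : H.Reachable a b) (ha : a ∈ S) :
    b ∈ S := by
  obtain ⟨p⟩ := h
  induction p with
  | nil => exact ha
  | cons hadj p ih => exact ih (hf _ _ ha hadj)

theorem acyc_ext {H0 H : SimpleGraph V} (w : V) (h0 : H0.IsAcyclic)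
    (hw : ∀ v, ¬ H0.Adj w v) (a b : V) (haw : a ≠ w) (hbw : b ≠ w)
    (hab : a ≠ b → ¬ H0.Reachable a b)
    (hH : ∀ x y, H.Adj x y → H0.Adj x y ∨ s(x, y) = s(w, a) ∨ s(x, y) = s(w, b)) :
    H.IsAcyclic := by
  have hiso : ∀ v, v ≠ w → ¬ H0.Reachable w v := by
    intro v hv h
    have := reach_closed {w} (fun x y hx hxy => by
      simp only [Set.mem_singleton_iff] at hx; subst hx; exact absurd hxy (hw _)) h rfl
    exact hv this
  have h1 : (H0 ⊔ edge w a).IsAcyclic := IsAcyclic.sup_edge_of_not_reachable (hiso a haw) h0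
  by_cases e : a = b
  · subst e
    refine h1.anti fun x y h => ?_
    rcases hH x y h with h' | h' | h'
    · exact Or.inl h'
    all_goals
      right; rw [edge_adj]; simp at h'; have := h.ne; grind
  · have h2 : (H0 ⊔ edge w a ⊔ edge w b).IsAcyclic := by
      refine IsAcyclic.sup_edge_of_not_reachable ?_ h1
      intro hr
      classical
      have := reach_map (H' := H0) (fun x => if x = w then a else x) (by
        intro x y hxy
        rcases hxy with h | h
        · have hx : x ≠ w := by rintro rfl; exact hw _ h
          have hy : y ≠ w := by rintro rfl; exact hw _ h.symm
          right; simp only [hx, hy, if_false]; exact h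
        · rw [edge_adj] at h
          left; rcases h.1 with ⟨rfl, rfl⟩ | ⟨rfl, rfl⟩ <;> simp [haw]) hr
      simp only [if_true, hbw, if_false] at this
      exact hab e this
    refine h2.anti fun x y h => ?_
    rcases hH x y h with h' | h' | h'
    · exact Or.inl (Or.inl h')
    · left; right; rw [edge_adj]; simp at h'; have := h.ne; grind
    · right; rw [edge_adj]; simp at h'; have := h.ne; grind

theorem ext_col (G : SimpleGraph V) (w : V) (c : Sym2 V → K) (hc : AEC (del G w) c) (d : V → K)
    (hinj : ∀ v v', G.Adj w v → G.Adj w v' → d v = d v' → v = v')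
    (hd : ∀ v x, G.Adj w v → G.Adj v x → x ≠ w → c s(v, x) ≠ d v)
    (hr : ∀ v v', G.Adj w v → G.Adj w v' → v ≠ v' →
      ¬ (CG (del G w) c (d v) (d v')).Reachable v v') :
    ∃ c' : Sym2 V → K, AEC G c' ∧ (∀ v, c' s(w, v) = d v) ∧
      ∀ x y, x ≠ w → y ≠ w → c' s(x, y) = c s(x, y) := by
  classical
  let c' : Sym2 V → K := fun e => if h : w ∈ e then d (Sym2.Mem.other h) else c e
  have e1 : ∀ v, c' s(w, v) = d v := by
    intro v
    have h : w ∈ s(w, v) := Sym2.mem_mk_left _ _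
    have : Sym2.Mem.other h = v := Sym2.congr_right.mp (Sym2.other_spec h)
    simp only [c', h, dif_pos, this]
  have e1' : ∀ v, c' s(v, w) = d v := by intro v; rw [Sym2.eq_swap]; exact e1 v
  have e2 : ∀ x y, x ≠ w → y ≠ w → c' s(x, y) = c s(x, y) := by
    intro x y hx hy
    have : ¬ w ∈ s(x, y) := by simp [hx.symm, hy.symm]
    simp only [c', this, dif_neg, not_false_eq_true]
  refine ⟨c', ⟨?_, ?_⟩, e1, e2⟩
  · intro x y z hxy hxz hyz
    by_cases hx : x = w
    · subst hx; rw [e1, e1]; exact fun h => hyz (hinj _ _ hxy hxz h)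
    · by_cases hy : y = w
      · subst hy
        rw [e1', e2 x z hx (Ne.symm hyz)]
        exact (hd x z hxy.symm hxz (Ne.symm hyz)).symm
      · by_cases hz : z = w
        · subst hz
          rw [e1', e2 x y hx hy]
          exact (hd x y hxz.symm hxy hy)
        · rw [e2 _ _ hx hy, e2 _ _ hx hz]
          exact hc.1 x y z ⟨hxy, hx, hy⟩ ⟨hxz, hx, hz⟩ hyz
  · intro α β
    have h0 := hc.2 α β
    have hw : ∀ v, ¬ (CG (del G w) c α β).Adj w v := fun v h => h.1.2.1 rfl
    have key : ∀ x y, (CG G c' α β).Adj x y → (CG (del G w) c α β).Adj x y ∨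
        ∃ v, G.Adj w v ∧ (d v = α ∨ d v = β) ∧ s(x, y) = s(w, v) := by
      intro x y h
      by_cases hx : x = w
      · subst hx
        right; refine ⟨y, h.1, ?_, rfl⟩
        have := h.2; rwa [e1] at this
      · by_cases hy : y = w
        · subst hy
          right; refine ⟨x, h.1.symm, ?_, Sym2.eq_swap⟩
          have := h.2; rwa [e1'] at this
        · left; refine ⟨⟨h.1, hx, hy⟩, ?_⟩
          have := h.2; rwa [e2 _ _ hx hy] at this
    by_cases ha : ∃ a, G.Adj w a ∧ d a = α
    · obtain ⟨a, ha, ha'⟩ := ha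
      by_cases hb : ∃ b, G.Adj w b ∧ d b = β
      · obtain ⟨b, hb, hb'⟩ := hb
        refine acyc_ext w h0 hw a b ha.ne' hb.ne' (fun hne => ?_) ?_
        · have := hr a b ha hb hne; rwa [ha', hb'] at this
        · intro x y h
          rcases key x y h with h | ⟨v, h1, h2, h3⟩
          · exact Or.inl h
          · right; rcases h2 with h2 | h2
            · left; rw [h3, hinj v a h1 ha (h2.trans ha'.symm)]
            · right; rw [h3, hinj v b h1 hb (h2.trans hb'.symm)]
      · refine acyc_ext w h0 hw a a ha.ne' ha.ne' (fun hne => absurd rfl hne) ?_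
        intro x y h
        rcases key x y h with h | ⟨v, h1, h2, h3⟩
        · exact Or.inl h
        · right; rcases h2 with h2 | h2
          · left; rw [h3, hinj v a h1 ha (h2.trans ha'.symm)]
          · exact absurd ⟨v, h1, h2⟩ hb
    · by_cases hb : ∃ b, G.Adj w b ∧ d b = β
      · obtain ⟨b, hb, hb'⟩ := hb
        refine acyc_ext w h0 hw b b hb.ne' hb.ne' (fun hne => absurd rfl hne) ?_
        intro x y h
        rcases key x y h with h | ⟨v, h1, h2, h3⟩
        · exact Or.inl h
        · right; rcases h2 with h2 | h2
          · exact absurd ⟨v, h1, h2⟩ ha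
          · left; rw [h3, hinj v b h1 hb (h2.trans hb'.symm)]
      · refine h0.anti fun x y h => ?_
        rcases key x y h with h | ⟨v, h1, h2, h3⟩
        · exact h
        · rcases h2 with h2 | h2
          · exact absurd ⟨v, h1, h2⟩ ha
          · exact absurd ⟨v, h1, h2⟩ hb

end ChL
namespace ChL
universe u
variable {V : Type u} {K : Type}

def G1 (G : SimpleGraph V) (S : Set V) : SimpleGraph V where
  Adj x y := G.Adj x y ∧ (x ∈ S ∨ y ∈ S)
  symm := ⟨fun _ _ h => ⟨h.1.symm, h.2.symm⟩⟩
  loopless := ⟨fun x h => G.loopless.irrefl x h.1⟩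

def G2 (G : SimpleGraph V) (S : Set V) : SimpleGraph V where
  Adj x y := G.Adj x y ∧ x ∉ S ∧ y ∉ S
  symm := ⟨fun _ _ h => ⟨h.1.symm, h.2.symm⟩⟩
  loopless := ⟨fun x h => G.loopless.irrefl x h.1⟩

theorem exists_perm_disj {k : ℕ} (A B : Finset (Fin k)) (h : A.card + B.card ≤ k) :
    ∃ π : Equiv.Perm (Fin k), ∀ b ∈ B, π b ∉ A := by
  classical
  have : B.card ≤ (Aᶜ).card := by rw [Finset.card_compl, Fintype.card_fin]; omega
  obtain ⟨T, hT, hc⟩ := Finset.exists_subset_card_eq this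
  have e : {x // x ∈ B} ≃ {x // x ∈ T} := Finset.equivOfCardEq hc.symm
  refine ⟨e.extendSubtype, fun b hb hA => ?_⟩
  have h1 := Equiv.extendSubtype_mem e b hb
  have := hT h1
  simp at this
  exact this hA

theorem glue_col [Finite V] {k : ℕ} (G : SimpleGraph V) (S : Set V) (t : V) (ht : t ∉ S)
    (hS : ∀ x ∈ S, ∀ y, G.Adj x y → y ∈ S ∨ y = t) (hdeg : edeg G t ≤ k)
    (c₁ c₂ : Sym2 V → Fin k) (h1 : AEC (G1 G S) c₁) (h2 : AEC (G2 G S) c₂) :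
    ∃ c : Sym2 V → Fin k, AEC G c := by
  classical
  have : Fintype V := Fintype.ofFinite V
  let N1 : Finset V := Finset.univ.filter fun y => G.Adj t y ∧ y ∈ S
  let N2 : Finset V := Finset.univ.filter fun y => G.Adj t y ∧ y ∉ S
  have hN : N1.card + N2.card ≤ k := by
    rw [← Finset.card_union_of_disjoint]
    · refine le_trans (le_of_eq ?_) hdeg
      rw [edeg, Set.ncard_eq_toFinset_card']
      congr 1; ext y; simp [N1, N2]; tauto
    · rw [Finset.disjoint_left]; intro y; simp [N1, N2]; tauto
  obtain ⟨π, hπ⟩ := exists_perm_disj (N1.image fun y => c₁ s(t, y)) (N2.image fun y => c₂ s(t, y))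
    (le_trans (add_le_add Finset.card_image_le Finset.card_image_le) hN)
  have hπ' : ∀ y z, G.Adj t y → y ∈ S → G.Adj t z → z ∉ S → c₁ s(t, y) ≠ π (c₂ s(t, z)) := by
    intro y z h1 h2 h3 h4 h5
    refine hπ (c₂ s(t, z)) (Finset.mem_image.2 ⟨z, by simp [N2, h3, h4], rfl⟩) ?_
    rw [← h5]
    exact Finset.mem_image.2 ⟨y, by simp [N1, h1, h2], rfl⟩
  let c : Sym2 V → Fin k := fun e => if ∃ x ∈ S, x ∈ e then c₁ e else π (c₂ e)
  have e1 : ∀ x y, (x ∈ S ∨ y ∈ S) → c s(x, y) = c₁ s(x, y) := by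
    intro x y h
    have : ∃ z ∈ S, z ∈ s(x, y) := by
      rcases h with h | h
      · exact ⟨x, h, by simp⟩
      · exact ⟨y, h, by simp⟩
    simp only [c, this, if_true]
  have e2 : ∀ x y, x ∉ S → y ∉ S → c s(x, y) = π (c₂ s(x, y)) := by
    intro x y hx hy
    have : ¬ ∃ z ∈ S, z ∈ s(x, y) := by
      rintro ⟨z, hz, hz'⟩
      simp at hz'
      rcases hz' with rfl | rfl <;> contradiction
    simp only [c, this, if_false]
  refine ⟨c, ?_, ?_⟩
  · intro x y z hxy hxz hyz
    by_cases hx : x ∈ S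
    · rw [e1 x y (Or.inl hx), e1 x z (Or.inl hx)]
      exact h1.1 x y z ⟨hxy, Or.inl hx⟩ ⟨hxz, Or.inl hx⟩ hyz
    · by_cases hy : y ∈ S
      · have hxt : x = t := by
          rcases hS y hy x hxy.symm with h | h
          · contradiction
          · exact h
        subst hxt
        by_cases hz : z ∈ S
        · rw [e1 x y (Or.inr hy), e1 x z (Or.inr hz)]
          exact h1.1 x y z ⟨hxy, Or.inr hy⟩ ⟨hxz, Or.inr hz⟩ hyz
        · rw [e1 x y (Or.inr hy), e2 x z hx hz]
          exact hπ' y z hxy hy hxz hz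
      · by_cases hz : z ∈ S
        · have hxt : x = t := by
            rcases hS z hz x hxz.symm with h | h
            · contradiction
            · exact h
          subst hxt
          rw [e1 x z (Or.inr hz), e2 x y hx hy]
          exact (hπ' z y hxz hz hxy hy).symm
        · rw [e2 x z hx hz, e2 x y hx hy]
          exact fun h => h2.1 x y z ⟨hxy, hx, hy⟩ ⟨hxz, hx, hz⟩ hyz (π.injective h)
  · intro α β
    rw [isAcyclic_iff_forall_adj_isBridge]
    intro x y hxy
    rw [isBridge_iff]
    intro hr
    by_cases hS' : x ∈ S ∨ y ∈ S
    · have hb := (isAcyclic_iff_forall_adj_isBridge.1 (h1.2 α β)) (v := x) (w := y)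
        ⟨⟨hxy.1, hS'⟩, by have := hxy.2; rwa [e1 x y hS'] at this⟩
      rw [isBridge_iff] at hb
      apply hb
      have hx : x ∈ S ∨ x = t := by
        rcases hS' with h | h
        · exact Or.inl h
        · exact hS y h x hxy.1.symm
      have hy : y ∈ S ∨ y = t := by
        rcases hS' with h | h
        · exact hS x h y hxy.1
        · exact Or.inl h
      have := reach_map (H' := (CG (G1 G S) c₁ α β).deleteEdges {s(x, y)})
        (fun v => if v ∈ S then v else t) (by
        intro a b hab
        rw [deleteEdges_adj] at hab
        obtain ⟨⟨hab, hcol⟩, hne⟩ := hab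
        by_cases h : a ∈ S ∨ b ∈ S
        · right
          have ha : (if a ∈ S then a else t) = a := by
            rcases h with h | h
            · simp [h]
            · rcases hS b h a hab.symm with h | h <;> simp [h]
          have hb : (if b ∈ S then b else t) = b := by
            rcases h with h | h
            · rcases hS a h b hab with h | h <;> simp [h]
            · simp [h]
          simp only [ha, hb]
          rw [deleteEdges_adj]
          refine ⟨⟨⟨hab, h⟩, ?_⟩, hne⟩
          rwa [e1 a b h] at hcol
        · left; push Not at h; simp [h.1, h.2]) hr
      have hx' : (if x ∈ S then x else t) = x := by rcases hx with h | h <;> simp [h]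
      have hy' : (if y ∈ S then y else t) = y := by rcases hy with h | h <;> simp [h]
      simpa only [hx', hy'] using this
    · push Not at hS'
      have hb := (isAcyclic_iff_forall_adj_isBridge.1 (h2.2 (π.symm α) (π.symm β))) (v := x) (w := y)
        ⟨⟨hxy.1, hS'⟩, by
          have := hxy.2; rw [e2 x y hS'.1 hS'.2] at this
          simpa only [Equiv.eq_symm_apply] using this⟩
      rw [isBridge_iff] at hb
      apply hb
      have := reach_map (H' := (CG (G2 G S) c₂ (π.symm α) (π.symm β)).deleteEdges {s(x, y)})
        (fun v => if v ∈ S then t else v) (by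
        intro a b hab
        rw [deleteEdges_adj] at hab
        obtain ⟨⟨hab, hcol⟩, hne⟩ := hab
        by_cases h : a ∈ S ∨ b ∈ S
        · left
          rcases h with h | h
          · rcases hS a h b hab with h' | h'
            · simp [h, h']
            · simp [h, h']
          · rcases hS b h a hab.symm with h' | h'
            · simp [h, h']
            · simp [h, h']
        · right; push Not at h; simp only [h.1, h.2, if_false]
          rw [deleteEdges_adj]
          refine ⟨⟨⟨hab, h⟩, ?_⟩, hne⟩
          rw [e2 a b h.1 h.2] at hcol
          simpa only [Equiv.eq_symm_apply] using hcol) hr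
      simpa only [hS'.1, hS'.2, if_false] using this

end ChL
namespace ChL
universe u
variable {V : Type u} {K : Type}

def Side (G : SimpleGraph V) (w z : V) (S : Set V) (t : V) : Prop :=
  w ∈ S ∧ z ∉ S ∧ t ∉ S ∧ t ≠ z ∧
    ∀ x ∈ S, ∀ y, G.Adj x y → y ∈ S ∨ y = t ∨ (x = w ∧ y = z)


def NonSep (G : SimpleGraph V) : Prop :=
  ∀ (S : Set V) (t : V), t ∉ S → (∀ x ∈ S, ∀ y, G.Adj x y → y ∈ S ∨ y = t) →
    (∀ x y, G.Adj x y → x ∉ S) ∨ (∀ x y, G.Adj x y → x ∈ S ∨ y ∈ S)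

def Big (G : SimpleGraph V) (v : V) : Prop := ∀ a b, ∃ y, G.Adj v y ∧ y ≠ a ∧ y ≠ b

def CL (G : SimpleGraph V) : Prop :=
  ∀ w z, G.Adj w z → Big G w → Big G z → ∃ S t, Side G w z S t

theorem Big.mono {G G' : SimpleGraph V} {v : V} (hle : G' ≤ G) (h : Big G' v) : Big G v := by
  intro a b
  obtain ⟨y, hy, h⟩ := h a b
  exact ⟨y, hle hy, h⟩

theorem CL.mono {G G' : SimpleGraph V} (h : CL G) (hle : G' ≤ G) : CL G' := by
  intro w z hwz hw hz
  obtain ⟨S, t, h1, h2, h3, h4, h5⟩ := h w z (hle hwz) (hw.mono hle) (hz.mono hle)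
  exact ⟨S, t, h1, h2, h3, h4, fun x hx y hxy => h5 x hx y (hle hxy)⟩

theorem Side.flip {G : SimpleGraph V} {w z : V} {S : Set V} {t : V} (h : Side G w z S t) :
    Side G z w {x | x ∉ S ∧ x ≠ t} t := by
  obtain ⟨h1, h2, h3, h4, h5⟩ := h
  refine ⟨⟨h2, h4.symm⟩, fun h => h.1 h1, fun h => h.2 rfl, by rintro rfl; exact h3 h1, ?_⟩
  intro x hx y hxy
  by_cases hy : y ∈ S
  · rcases h5 y hy x hxy.symm with h | h | h
    · exact absurd h hx.1
    · exact absurd h hx.2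
    · exact Or.inr (Or.inr ⟨h.2, h.1⟩)
  · by_cases hyt : y = t
    · exact Or.inr (Or.inl hyt)
    · exact Or.inl ⟨hy, hyt⟩

theorem min_side {G : SimpleGraph V} (hns : NonSep G) {w z : V} {S : Set V}
    {t : V} (hwz : G.Adj w z) (hbw : Big G w) (hbz : Big G z) (hs : Side G w z S t)
    (hmin : ∀ w' z' S' t', G.Adj w' z' → Big G w' → Big G z' → Side G w' z' S' t' → ¬ S' ⊂ S)
    {w' z' : V} {S' : Set V} {t' : V} (hadj : G.Adj w' z') (hb : Big G w') (hb' : Big G z')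
    (hs' : Side G w' z' S' t') (htouch : w' ∈ S ∨ z' ∈ S) (hne : ¬ (w' = w ∧ z' = z))
    (hne' : ¬ (w' = z ∧ z' = w)) (hw : w ∉ S') (hz : z ∉ S') : False := by
  obtain ⟨hwS, hzS, htS, htz, hcl⟩ := hs
  have hfl := hs'.flip
  obtain ⟨hw'S, hz'S, ht'S, ht'z, hcl'⟩ := hs'
  have hw'SS : w' ∈ S ∨ w' = t := by
    rcases htouch with h | h
    · exact Or.inl h
    · rcases hcl z' h w' hadj.symm with h | h | h
      · exact Or.inl h
      · exact Or.inr h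
      · exact absurd ⟨h.2, h.1⟩ hne'
  have hz'SS : z' ∈ S ∨ z' = t := by
    rcases htouch with h | h
    · rcases hcl w' h z' hadj with h | h | h
      · exact Or.inl h
      · exact Or.inr h
      · exact absurd h hne
    · exact Or.inl h
  -- nothing of z other than w is adjacent to S
  have hzadj : ∀ y, G.Adj z y → y ∈ S → y = w := by
    intro y hy hyS
    rcases hcl y hyS z hy.symm with h | h | h
    · exact absurd h hzS
    · exact absurd h.symm htz
    · exact h.1
  -- closed sets leading to z
  have hcz : ∀ Z : Set V, w ∈ Z → z ∉ Z → (∀ y ∈ Z, G.Adj z y → y = w) →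
      (∀ x ∈ Z, ∀ y, G.Adj x y → y ∈ Z ∨ y = z) → False := by
    intro Z hwZ hzZ hZz hZ
    rcases hns Z z hzZ hZ with h | h
    · exact h w z hwz hwZ
    · obtain ⟨y, hy, hyw, _⟩ := hbz w w
      rcases h z y hy with h | h
      · exact hzZ h
      · exact hyw (hZz y h hy)
  by_cases htS' : t ∈ S'
  · have htt' : t ≠ t' := by rintro rfl; exact ht'S htS'
    by_cases ht'inS : t' ∈ S
    · -- Y has boundary only t
      have hY := hns {x | x ∈ S' ∧ x ∉ S ∧ x ≠ t} t (fun h => h.2.2 rfl) (by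
        rintro x ⟨hx1, hx2, hx3⟩ y hxy
        rcases hcl' x hx1 y hxy with h | h | h
        · by_cases hyt : y = t
          · exact Or.inr hyt
          · left; refine ⟨h, fun hyS => ?_, hyt⟩
            rcases hcl y hyS x hxy.symm with h | h | h
            · exact hx2 h
            · exact hx3 h
            · rw [h.2] at hx1; exact hz hx1
        · subst h
          rcases hcl y ht'inS x hxy.symm with h | h | h
          · exact absurd h hx2
          · exact absurd h hx3
          · rw [h.2] at hx1; exact absurd hx1 hz
        · rw [h.1] at hx2 hx3
          rcases hw'SS with h | h
          · exact absurd h hx2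
          · exact absurd h hx3)
      have hY' : ∀ x y, G.Adj x y → ¬ (x ∈ S' ∧ x ∉ S ∧ x ≠ t) := by
        rcases hY with h | h
        · exact h
        · rcases h w z hwz with h | h
          · exact absurd h.1 hw
          · exact absurd h.1 hz
      have htn : ∀ y, G.Adj t y → y ∈ S := by
        intro y hy
        rcases hcl' t htS' y hy with h | h | h
        · by_contra hyS
          exact hY' y t hy.symm ⟨h, hyS, hy.ne'⟩
        · rw [h]; exact ht'inS
        · rcases hz'SS with h' | h'
          · rw [h.2]; exact h'
          · exfalso; rw [← h.1] at hadj; rw [h'] at hadj; exact hadj.ne rfl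
      refine hcz (insert t S) (Or.inr hwS) ?_ ?_ ?_
      · rintro (h | h)
        · exact htz h.symm
        · exact hzS h
      · rintro y (h | h) hy
        · rw [h] at hy; exact absurd (htn z hy.symm) hzS
        · exact hzadj y hy h
      · rintro x (h | h) y hxy
        · rw [h] at hxy; exact Or.inl (Or.inr (htn y hxy))
        · rcases hcl x h y hxy with h | h | h
          · exact Or.inl (Or.inr h)
          · exact Or.inl (Or.inl h)
          · exact Or.inr h.2
    · have hwt' : w ≠ t' := by rintro rfl; exact ht'inS hwS
      let Z : Set V := {x | x ∈ S ∧ x ∉ S' ∧ x ≠ t'}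
      have hZ : ∀ x ∈ Z, ∀ y, G.Adj x y → y ∈ Z ∨ (x = z' ∧ y = w') ∨ (x = w ∧ y = z) := by
        rintro x ⟨hx1, hx2, hx3⟩ y hxy
        rcases hcl x hx1 y hxy with h | h | h
        · rcases hfl.2.2.2.2 x ⟨hx2, hx3⟩ y hxy with h' | h' | h'
          · exact Or.inl ⟨h, h'⟩
          · rw [h'] at h; exact absurd h ht'inS
          · exact Or.inr (Or.inl h')
        · subst h
          rcases hfl.2.2.2.2 x ⟨hx2, hx3⟩ y hxy with h' | h' | h'
          · exact absurd htS' h'.1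
          · exact absurd h' htt'
          · exact Or.inr (Or.inl h')
        · exact Or.inr (Or.inr h)
      have hwZ : w ∈ Z := ⟨hwS, hw, hwt'⟩
      have hzZ : z ∉ Z := fun h => hzS h.1
      by_cases hz'Z : z' ∈ Z
      · by_cases hz'w : z' = w
        · subst hz'w
          rcases hns {x | x ∈ Z ∧ x ≠ z'} z' (fun h => h.2 rfl) (by
            rintro x ⟨hx, hx'⟩ y hxy
            rcases hZ x hx y hxy with h | h | h
            · by_cases e : y = z'
              · exact Or.inr e
              · exact Or.inl ⟨h, e⟩
            · exact absurd h.1 hx'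
            · exact absurd h.1 hx') with h | h
          · obtain ⟨y, hy, hyz, hyw'⟩ := hbw z w'
            rcases hZ z' hz'Z y hy with h' | h' | h'
            · exact h y z' hy.symm ⟨h', hy.ne'⟩
            · exact hyw' h'.2
            · exact hyz h'.2
          · rcases h z' z hwz with h | h
            · exact h.2 rfl
            · exact hzZ h.1
        · refine hmin w z {x | x ∈ Z ∧ x ≠ z'} z' hwz hbw hbz ⟨⟨hwZ, fun h => hz'w h.symm⟩,
            fun h => hzZ h.1, fun h => h.2 rfl, ?_, ?_⟩ ?_
          · rintro rfl; exact hzZ hz'Z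
          · rintro x ⟨hx, hx'⟩ y hxy
            rcases hZ x hx y hxy with h | h | h
            · by_cases e : y = z'
              · exact Or.inr (Or.inl e)
              · exact Or.inl ⟨h, e⟩
            · exact absurd h.1 hx'
            · exact Or.inr (Or.inr h)
          · refine ⟨fun x hx => hx.1.1, fun h => ?_⟩
            exact (h hz'Z.1).2 rfl
      · refine hcz Z hwZ hzZ (fun y hy hzy => hzadj y hzy hy.1) ?_
        intro x hx y hxy
        rcases hZ x hx y hxy with h | h | h
        · exact Or.inl h
        · rw [h.1] at hx; exact absurd hx hz'Z
        · exact Or.inr h.2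
  · have hw'S2 : w' ∈ S := by
      rcases hw'SS with h | h
      · exact h
      · rw [h] at hw'S; exact absurd hw'S htS'
    refine hmin w' z' (S' ∩ S) t' hadj hb hb' ⟨⟨hw'S, hw'S2⟩, fun h => hz'S h.1, fun h => ht'S h.1,
      ht'z, ?_⟩ ⟨Set.inter_subset_right, fun h => hw (h hwS).1⟩
    rintro x ⟨hx, hx'⟩ y hxy
    rcases hcl' x hx y hxy with h | h | h
    · rcases hcl x hx' y hxy with h' | h' | h'
      · exact Or.inl ⟨h, h'⟩
      · rw [h'] at h; exact absurd h htS'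
      · rw [h'.2] at h; exact absurd h hz
    · exact Or.inr (Or.inl h)
    · exact Or.inr (Or.inr h)

theorem not_big {G : SimpleGraph V} {v : V} (h : ¬ Big G v) :
    ∃ a b, ∀ y, G.Adj v y → y = a ∨ y = b := by
  unfold Big at h
  push Not at h
  obtain ⟨a, b, h⟩ := h
  exact ⟨a, b, fun y hy => by by_contra hc; push Not at hc; exact hc.2 (h y hy hc.1)⟩

/-- a small non-leaf vertex: second neighbour -/
theorem small_nbr {G : SimpleGraph V} (hleaf : ∀ v a, G.Adj v a → ∃ b, G.Adj v b ∧ b ≠ a)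
    {v x : V} (h : ¬ Big G v) (hx : G.Adj v x) :
    ∃ y, G.Adj v y ∧ y ≠ x ∧ ∀ a, G.Adj v a → a = x ∨ a = y := by
  obtain ⟨a, b, h⟩ := not_big h
  obtain ⟨y, hy, hyx⟩ := hleaf v x hx
  refine ⟨y, hy, hyx, fun c hc => ?_⟩
  have := h c hc; have := h x hx; have := h y hy
  grind

theorem structure_thm [Finite V] {G : SimpleGraph V} (hcl : CL G) (hns : NonSep G)
    (hleaf : ∀ v a, G.Adj v a → ∃ b, G.Adj v b ∧ b ≠ a) (hne : ∃ x y, G.Adj x y) :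
    (∃ w v, G.Adj w v ∧ ¬ Big G w ∧ ¬ Big G v) ∨
    (∃ w, Big G w ∧ ∀ v, G.Adj w v → ¬ Big G v) ∨
    (∃ w z t, G.Adj w z ∧ Big G w ∧ t ≠ z ∧ t ≠ w ∧
      ∀ v, G.Adj w v → v ≠ z → G.Adj v t ∧ ∀ y, G.Adj v y → y = w ∨ y = t) := by
  by_contra hcon
  push Not at hcon
  obtain ⟨ha', ha, hb⟩ := hcon
  -- exists a big-big edge
  have hbb : ∃ w z, G.Adj w z ∧ Big G w ∧ Big G z := by
    obtain ⟨x, y, hxy⟩ := hne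
    by_cases hx : Big G x
    · obtain ⟨v, hv⟩ := ha x hx
      exact ⟨x, v, hv.1, hx, hv.2⟩
    · have hy := ha' x y hxy hx
      obtain ⟨v, hv⟩ := ha y hy
      exact ⟨y, v, hv.1, hy, hv.2⟩
  let P : Set V → Prop := fun S => ∃ w z t, G.Adj w z ∧ Big G w ∧ Big G z ∧ Side G w z S t
  have hP : ∃ S, P S := by
    obtain ⟨w, z, h1, h2, h3⟩ := hbb
    obtain ⟨S, t, hs⟩ := hcl w z h1 h2 h3
    exact ⟨S, w, z, t, h1, h2, h3, hs⟩
  obtain ⟨S, hS⟩ := Set.Finite.exists_minimal (Set.toFinite {S | P S}) hP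
  obtain ⟨w, z, t, hwz, hbw, hbz, hs⟩ := hS.prop
  have hmin : ∀ w' z' S' t', G.Adj w' z' → Big G w' → Big G z' → Side G w' z' S' t' → ¬ S' ⊂ S := by
    intro w' z' S' t' h1 h2 h3 h4 h5
    exact h5.2 (hS.le_of_le ⟨w', z', t', h1, h2, h3, h4⟩ h5.1)
  have hnobb : ∀ x y, G.Adj x y → Big G x → Big G y → x ∈ S → x = w ∧ y = z := by
    intro x y hxy hx hy hxS
    by_contra hne
    have hne' : ¬ (x = z ∧ y = w) := by rintro ⟨rfl, rfl⟩; exact hs.2.1 hxS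
    obtain ⟨S', t', hs'⟩ := hcl x y hxy hx hy
    by_cases h : w ∉ S' ∧ z ∉ S'
    · exact min_side hns hwz hbw hbz hs hmin hxy hx hy hs' (Or.inl hxS) hne hne' h.1 h.2
    · have hf := hs'.flip
      refine min_side hns hwz hbw hbz hs hmin hxy.symm hy hx hf (Or.inr hxS)
        (fun h => hne' ⟨h.2, h.1⟩) (fun h => hne ⟨h.2, h.1⟩) ?_ ?_
      · rintro ⟨h1, h2⟩
        have hz : z ∈ S' := by by_contra hz; exact h ⟨h1, hz⟩
        rcases hs'.2.2.2.2 z hz w hwz.symm with h | h | h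
        · exact h1 h
        · exact h2 h
        · exact hne' ⟨h.1.symm, h.2.symm⟩
      · rintro ⟨h1, h2⟩
        have hw : w ∈ S' := by by_contra hw; exact h ⟨hw, h1⟩
        rcases hs'.2.2.2.2 w hw z hwz with h | h | h
        · exact h1 h
        · exact h2 h
        · exact hne ⟨h.1.symm, h.2.symm⟩
  have hsmall : ∀ y ∈ S, y ≠ w → ¬ Big G y := by
    intro y hy hyw hbig
    obtain ⟨v, hv, hv'⟩ := ha y hbig
    exact hyw (hnobb y v hv hbig hv' hy).1
  obtain ⟨hwS, hzS, htS, htz, hclS⟩ := hs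
  have htw : t ≠ w := by rintro rfl; exact htS hwS
  have hzadj : ∀ y, G.Adj z y → y ∈ S → y = w := by
    intro y hy hyS
    rcases hclS y hyS z hy.symm with h | h | h
    · exact absurd h hzS
    · exact absurd h.symm htz
    · exact h.1
  -- t not adjacent to w
  have hwt : ∀ v, G.Adj w v → v ≠ z → v ∈ S := by
    intro v hv hvz
    rcases hclS w hwS v hv with h | h | h
    · exact h
    · exfalso
      subst h
      have hvs : ¬ Big G v := fun h => hvz (hnobb w v hv hbw h hwS).2
      obtain ⟨y, hy, hyw, hall⟩ := small_nbr hleaf hvs hv.symm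
      by_cases hyS : y ∈ S
      · rcases hns (insert v S) z (by
          rintro (h | h)
          · exact hvz h.symm
          · exact hzS h) (by
          rintro a (h | h) b hab
          · rw [h] at hab
            rcases hall b hab with h | h
            · rw [h]; exact Or.inl (Or.inr hwS)
            · rw [h]; exact Or.inl (Or.inr hyS)
          · rcases hclS a h b hab with h | h | h
            · exact Or.inl (Or.inr h)
            · exact Or.inl (Or.inl h)
            · exact Or.inr h.2) with h | h
        · exact h w z hwz (Or.inr hwS)
        · obtain ⟨b, hb1, hbw1, _⟩ := hbz w w
          rcases h z b hb1 with (h | h) | (h | h)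
          · exact hvz h.symm
          · exact hzS h
          · rw [h] at hb1
            rcases hall z hb1.symm with h | h
            · exact hwz.ne h.symm
            · rw [h] at hzS; exact hzS hyS
          · exact hbw1 (hzadj b hb1 h)
      · rcases hns {x | x ∈ S ∧ x ≠ w} w (fun h => h.2 rfl) (by
          rintro a ⟨h1, h2⟩ b hab
          by_cases hbw' : b = w
          · exact Or.inr hbw'
          rcases hclS a h1 b hab with h | h | h
          · exact Or.inl ⟨h, hbw'⟩
          · rw [h] at hab
            rcases hall a hab.symm with h | h
            · exact absurd h h2
            · rw [h] at h1; exact absurd h1 hyS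
          · exact absurd h.1 h2) with h | h
        · obtain ⟨b, hb1, hbv, hbz'⟩ := hbw v z
          rcases hclS w hwS b hb1 with h' | h' | h'
          · exact h b w hb1.symm ⟨h', hb1.ne'⟩
          · exact hbv h'
          · exact hbz' h'.2
        · rcases h w z hwz with h | h
          · exact h.2 rfl
          · exact hzS h.1
    · exact absurd h.2 hvz
  obtain ⟨v, hv, hvz, hvv⟩ := hb w z t hwz hbw htz htw
  have hvS := hwt v hv hvz
  have hvs := hsmall v hvS hv.ne'
  obtain ⟨y, hy, hyw, hall⟩ := small_nbr hleaf hvs hv.symm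
  have hyt : y = t := by
    rcases hclS v hvS y hy with h | h | h
    · exact absurd (hsmall y h hyw) (fun hn => hn (ha' v y hy hvs))
    · exact h
    · exact absurd h.1 hv.ne'
  subst hyt
  obtain ⟨x, hx, hx1, hx2⟩ := hvv hy
  rcases hall x hx with h | h
  · exact hx1 h
  · exact hx2 h

end ChL
namespace ChL
universe u
variable {V : Type u} {K : Type}

def Rch (H : SimpleGraph V) (s : V) (A : Set V) : Set V :=
  {v | ∃ a ∈ A, ∃ q : H.Walk a v, s ∉ q.support}

theorem Rch_start {H : SimpleGraph V} {s : V} {A : Set V} {a : V} (ha : a ∈ A) (h : a ≠ s) :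
    a ∈ Rch H s A := ⟨a, ha, Walk.nil, by simpa using h.symm⟩

theorem Rch_ne {H : SimpleGraph V} {s : V} {A : Set V} {a : V} (ha : a ∈ Rch H s A) : a ≠ s := by
  rintro rfl
  obtain ⟨a, _, q, hq⟩ := ha
  exact hq q.end_mem_support

theorem Rch_step {H : SimpleGraph V} {s : V} {A : Set V} {v x : V} (hv : v ∈ Rch H s A)
    (h : H.Adj v x) (hx : x ≠ s) : x ∈ Rch H s A := by
  obtain ⟨a, ha, q, hq⟩ := hv
  refine ⟨a, ha, q.concat h, ?_⟩
  rw [Walk.support_concat]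
  simp [hq, hx.symm]

theorem Rch_closed {H : SimpleGraph V} {s : V} {A P : Set V} (h0 : ∀ a ∈ A, a ≠ s → a ∈ P)
    (h1 : ∀ v x, v ∈ P → H.Adj v x → x ≠ s → x ∈ P) {v : V} (hv : v ∈ Rch H s A) : v ∈ P := by
  obtain ⟨a, ha, q, hq⟩ := hv
  have key : ∀ a v (q : H.Walk a v), s ∉ q.support → a ∈ P → v ∈ P := by
    intro a v q
    induction q with
    | nil => intro _ h; exact h
    | cons hadj q ih =>
      intro hs hP
      rw [Walk.support_cons] at hs
      simp only [List.mem_cons, not_or] at hs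
      refine ih hs.2 (h1 _ _ hP hadj ?_)
      rintro rfl
      exact hs.2 q.start_mem_support
  refine key a v q hq (h0 a ha ?_)
  rintro rfl
  exact hq q.start_mem_support

theorem Rch_supp {H : SimpleGraph V} {s : V} {A : Set V} {a v : V} (ha : a ∈ A) (q : H.Walk a v)
    (hq : s ∉ q.support) {x : V} (hx : x ∈ q.support) : x ∈ Rch H s A := by
  classical
  exact ⟨a, ha, q.takeUntil x hx, fun h => hq (q.support_takeUntil_subset_support hx h)⟩

theorem Rch_symm {H : SimpleGraph V} {s : V} {A B : Set V} {v : V} (hA : v ∈ Rch H s A)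
    (hB : v ∈ Rch H s B) : ∃ b ∈ B, b ∈ Rch H s A := by
  obtain ⟨a, ha, q, hq⟩ := hA
  obtain ⟨b, hb, r, hr⟩ := hB
  refine ⟨b, hb, a, ha, q.append r.reverse, ?_⟩
  rw [Walk.mem_support_append_iff]
  simp [hq, hr]

/-- two disjoint paths from A to B -/
def TwoP (H : SimpleGraph V) (A B : Set V) : Prop :=
  ∃ a1 ∈ A, ∃ a2 ∈ A, ∃ b1 ∈ B, ∃ b2 ∈ B, ∃ (p1 : H.Walk a1 b1) (p2 : H.Walk a2 b2),
    p1.IsPath ∧ p2.IsPath ∧ ∀ x, x ∈ p1.support → x ∉ p2.support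

theorem side_claim {H H' : SimpleGraph V} {s x y : V} {A B : Set V}
    (hE : ∀ u v, H.Adj u v → H'.Adj u v ∨ (u = x ∧ v = y) ∨ (u = y ∧ v = x))
    (hx : x ∈ Rch H' s A) (hy : y ∉ Rch H' s A)
    (hB : ∀ b ∈ B, b ∉ Rch H' s A)
    (hyp : ∀ s', ∃ b ∈ B, b ∈ Rch H s' A) (s' : V) :
    ∃ b ∈ ({s, x} : Set V), b ∈ Rch H' s' A := by
  by_contra hcon
  push Not at hcon
  have hs := hcon s (by simp)
  have hx' := hcon x (by simp)
  have hsub : ∀ v, v ∈ Rch H' s' A → v ∈ Rch H' s A ∩ Rch H' s' A := by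
    intro v hv
    refine Rch_closed ?_ ?_ hv
    · intro a ha has
      have h1 := Rch_start (H := H') ha has
      refine ⟨Rch_start ha ?_, h1⟩
      rintro rfl; exact hs h1
    · intro v u hv hvu hu
      have h1 := Rch_step hv.2 hvu hu
      refine ⟨Rch_step hv.1 hvu ?_, h1⟩
      rintro rfl; exact hs h1
  obtain ⟨b, hb, hbR⟩ := hyp s'
  refine hB b hb (hsub b ?_).1
  refine Rch_closed ?_ ?_ hbR
  · intro a ha has; exact Rch_start ha has
  · intro v u hv hvu hu
    rcases hE v u hvu with h | ⟨rfl, rfl⟩ | ⟨rfl, rfl⟩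
    · exact Rch_step hv h hu
    · exact absurd hv hx'
    · exact absurd (hsub _ hv).1 hy

theorem side_paths {H' : SimpleGraph V} {s x : V} {A : Set V}
    (h : TwoP H' A {s, x}) : ∃ a1 ∈ A, ∃ a2 ∈ A, ∃ (p1 : H'.Walk a1 s) (p2 : H'.Walk a2 x),
      (∀ u, u ∈ p1.support → u ∉ p2.support) ∧
      (∀ u ∈ p1.support, u = s ∨ u ∈ Rch H' s A) ∧ (∀ u ∈ p2.support, u ∈ Rch H' s A) := by
  classical
  have key : ∀ a1 ∈ A, ∀ a2 ∈ A, ∀ (p1 : H'.Walk a1 s) (p2 : H'.Walk a2 x), p1.IsPath →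
      (∀ u, u ∈ p1.support → u ∉ p2.support) → ∃ a1 ∈ A, ∃ a2 ∈ A,
      ∃ (p1 : H'.Walk a1 s) (p2 : H'.Walk a2 x),
      (∀ u, u ∈ p1.support → u ∉ p2.support) ∧
      (∀ u ∈ p1.support, u = s ∨ u ∈ Rch H' s A) ∧ (∀ u ∈ p2.support, u ∈ Rch H' s A) := by
    intro a1 ha1 a2 ha2 p1 p2 hp1 hd
    refine ⟨a1, ha1, a2, ha2, p1, p2, hd, ?_, ?_⟩
    · intro u hu
      by_cases hus : u = s
      · exact Or.inl hus
      · right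
        exact ⟨a1, ha1, p1.takeUntil u hu, Walk.endpoint_notMem_support_takeUntil hp1 hu (Ne.symm hus)⟩
    · intro u hu
      exact Rch_supp ha2 p2 (hd s p1.end_mem_support) hu
  obtain ⟨a1, ha1, a2, ha2, b1, hb1, b2, hb2, p1, p2, hp1, hp2, hd⟩ := h
  have hne : b1 ≠ b2 := by
    rintro rfl; exact hd _ p1.end_mem_support p2.end_mem_support
  simp only [Set.mem_insert_iff, Set.mem_singleton_iff] at hb1 hb2
  rcases hb1 with rfl | rfl <;> rcases hb2 with rfl | rfl
  · exact absurd rfl hne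
  · exact key a1 ha1 a2 ha2 p1 p2 hp1 hd
  · exact key a2 ha2 a1 ha1 p2 p1 hp2 (fun u h1 h2 => hd u h2 h1)
  · exact absurd rfl hne

theorem menger_step {H H' : SimpleGraph V} {s x y : V} {A B : Set V} (hle : H' ≤ H)
    (hxy : H.Adj x y)
    (hA : TwoP H' A {s, x}) (hB : TwoP H' B {s, y})
    (hdis : ∀ v, v ∈ Rch H' s A → v ∉ Rch H' s B) : TwoP H A B := by
  classical
  obtain ⟨a1, ha1, a2, ha2, p1, p2, hp, hp1, hp2⟩ := side_paths hA
  obtain ⟨b1, hb1, b2, hb2, q1, q2, hq, hq1, hq2⟩ := side_paths hB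
  let P1 := (p1.append q1.reverse).mapLe hle
  let P2 := (p2.mapLe hle).append (Walk.cons hxy (q2.reverse.mapLe hle))
  have h1 : ∀ u, u ∈ P1.support → u ∈ p1.support ∨ u ∈ q1.support := by
    intro u hu
    simpa [P1, Walk.mem_support_append_iff] using hu
  have h2 : ∀ u, u ∈ P2.support → u ∈ p2.support ∨ u ∈ q2.support := by
    intro u hu
    simp only [P2, Walk.mem_support_append_iff, Walk.support_cons, List.mem_cons,
      Walk.support_mapLe_eq_support, Walk.support_reverse, List.mem_reverse] at hu
    rcases hu with h | rfl | h
    · exact Or.inl h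
    · exact Or.inl p2.end_mem_support
    · exact Or.inr h
  refine ⟨a1, ha1, a2, ha2, b1, hb1, b2, hb2, P1.bypass, P2.bypass, P1.bypass_isPath,
    P2.bypass_isPath, ?_⟩
  intro u hu1 hu2
  have hs1 := hq s q1.end_mem_support
  have hs2 := hp s p1.end_mem_support
  rcases h1 u (P1.support_bypass_subset_support hu1) with hu1 | hu1 <;>
    rcases h2 u (P2.support_bypass_subset_support hu2) with hu2 | hu2
  · exact hp u hu1 hu2
  · rcases hp1 u hu1 with rfl | h
    · exact hs1 hu2
    · exact hdis u h (hq2 u hu2)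
  · rcases hq1 u hu1 with rfl | h
    · exact hs2 hu2
    · exact hdis u (hp2 u hu2) h
  · exact hq u hu1 hu2

theorem TwoP.mono {H H' : SimpleGraph V} {A B : Set V} (hle : H' ≤ H) (h : TwoP H' A B) :
    TwoP H A B := by
  obtain ⟨a1, ha1, a2, ha2, b1, hb1, b2, hb2, p1, p2, hp1, hp2, hd⟩ := h
  refine ⟨a1, ha1, a2, ha2, b1, hb1, b2, hb2, p1.mapLe hle, p2.mapLe hle,
    (Walk.isPath_mapLe hle).2 hp1, (Walk.isPath_mapLe hle).2 hp2, ?_⟩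
  simpa using hd

theorem menger [Finite V] [hV : Nonempty V] (n : ℕ) : ∀ (H : SimpleGraph V) (A B : Set V), H.edgeSet.ncard = n →
    (∀ s, ∃ b ∈ B, b ∈ Rch H s A) → TwoP H A B := by
  induction n using Nat.strong_induction_on with
  | _ n ih =>
  intro H A B hn hyp
  by_cases hne : ∃ x y, H.Adj x y
  swap
  · push Not at hne
    have h0 : ∀ s b, b ∈ Rch H s A → b ∈ A := by
      intro s b hb
      exact Rch_closed (fun a ha _ => ha) (fun v x _ h => absurd h (hne v x)) hb
    obtain ⟨s0⟩ := hV
    obtain ⟨b1, hb1, hr1⟩ := hyp s0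
    obtain ⟨b2, hb2, hr2⟩ := hyp b1
    refine ⟨b1, h0 _ _ hr1, b2, h0 _ _ hr2, b1, hb1, b2, hb2, Walk.nil, Walk.nil, by simp, by simp,
      ?_⟩
    have := Rch_ne hr2
    simpa using this.symm
  obtain ⟨x, y, hxy⟩ := hne
  let H' := H.deleteEdges {s(x, y)}
  have hle : H' ≤ H := deleteEdges_le _
  have hlt : H'.edgeSet.ncard < n := by
    rw [← hn]
    refine Set.ncard_lt_ncard ?_ (Set.toFinite _)
    rw [Set.ssubset_iff_of_subset (edgeSet_mono hle)]
    refine ⟨s(x, y), hxy, ?_⟩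
    simp [H']
  by_cases hyp' : ∀ s, ∃ b ∈ B, b ∈ Rch H' s A
  · exact (ih _ hlt H' A B rfl hyp').mono hle
  push Not at hyp'
  obtain ⟨s, hs⟩ := hyp'
  have hdis : ∀ v, v ∈ Rch H' s A → v ∉ Rch H' s B := by
    intro v hA hB
    obtain ⟨b, hb, h⟩ := Rch_symm hA hB
    exact hs b hb h
  have hE : ∀ u v, H.Adj u v → H'.Adj u v ∨ (u = x ∧ v = y) ∨ (u = y ∧ v = x) := by
    intro u v h
    by_cases he : s(u, v) = s(x, y)
    · right; simpa using he
    · left; simp only [H', deleteEdges_adj]; exact ⟨h, by simpa using he⟩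
  obtain ⟨b, hb, hbR⟩ := hyp s
  have hsymm : ∀ s, ∃ a ∈ A, a ∈ Rch H s B := by
    intro s
    obtain ⟨b, hb, hbR⟩ := hyp s
    exact Rch_symm (Rch_start hb (Rch_ne hbR)) hbR
  have main : ∀ x y, H.Adj x y →
      (∀ u v, H.Adj u v → H'.Adj u v ∨ (u = x ∧ v = y) ∨ (u = y ∧ v = x)) →
      x ∈ Rch H' s A → y ∉ Rch H' s A → TwoP H A B := by
    intro x y hxy hE hx hy
    have hy2 : y ∈ Rch H' s B := by
      by_contra hy2
      obtain ⟨a, ha, haR⟩ := hsymm s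
      have : a ∈ Rch H' s B := by
        refine Rch_closed (fun a ha h => Rch_start ha h) ?_ haR
        intro v u hv hvu hu
        rcases hE v u hvu with h | ⟨rfl, rfl⟩ | ⟨rfl, rfl⟩
        · exact Rch_step hv h hu
        · exact absurd hv (hdis _ hx)
        · exact absurd hv hy2
      exact hdis a (Rch_start ha (Rch_ne haR)) this
    have hx2 := hdis x hx
    refine menger_step (s := s) hle hxy (ih _ hlt H' _ _ rfl ?_) (ih _ hlt H' _ _ rfl ?_) hdis
    · exact side_claim hE hx hy hs hyp
    · refine side_claim (B := A) (fun u v h => ?_) hy2 hx2 ?_ hsymm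
      · rcases hE u v h with h | h | h <;> tauto
      · intro a ha h
        exact hdis a (Rch_start ha (Rch_ne h)) h
  by_cases h1 : x ∈ Rch H' s A
  · by_cases h2 : y ∈ Rch H' s A
    · exfalso
      refine hs b hb (Rch_closed (fun a ha h => Rch_start ha h) ?_ hbR)
      intro v u hv hvu hu
      rcases hE v u hvu with h | ⟨rfl, rfl⟩ | ⟨rfl, rfl⟩
      · exact Rch_step hv h hu
      · exact h2
      · exact h1
    · exact main x y hxy hE h1 h2
  · by_cases h2 : y ∈ Rch H' s A
    · exact main y x hxy.symm (fun u v h => by rcases hE u v h with h | h | h <;> tauto) h2 h1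
    · exfalso
      refine hs b hb (Rch_closed (fun a ha h => Rch_start ha h) ?_ hbR)
      intro v u hv hvu hu
      rcases hE v u hvu with h | ⟨rfl, rfl⟩ | ⟨rfl, rfl⟩
      · exact Rch_step hv h hu
      · exact absurd hv h1
      · exact absurd hv h2


theorem avoid_of_isolated {H : SimpleGraph V} {w : V} (hw : ∀ x, ¬ H.Adj x w) {a b : V}
    (q : H.Walk a b) (ha : a ≠ w) : w ∉ q.support := by
  induction q with
  | nil => simpa using ha.symm
  | cons hadj q ih =>
    rw [Walk.support_cons, List.mem_cons, not_or]
    exact ⟨ha.symm, ih (by rintro rfl; exact hw _ hadj)⟩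

theorem CL_of_chordless [Finite V] {G : SimpleGraph V} (hch : Chordless G) : CL G := by
  classical
  intro w z hwz hbw hbz
  have hne : w ≠ z := hwz.ne
  haveI : Nonempty V := ⟨w⟩
  let H := G.deleteEdges {s(w, z)}
  let Kg := del (del H w) z
  have hKH : Kg ≤ H := (del_le _ _).trans (del_le _ _)
  have hHadj : ∀ x y, H.Adj x y ↔ G.Adj x y ∧ s(x, y) ≠ s(w, z) := by
    intro x y; simp [H, deleteEdges_adj]
  have hKw : ∀ x, ¬ Kg.Adj x w := fun x h => h.1.2.2 rfl
  have hKz : ∀ x, ¬ Kg.Adj x z := fun x h => h.2.2 rfl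
  let A : Set V := {a | H.Adj w a}
  let B : Set V := {b | H.Adj z b}
  have hAw : ∀ a ∈ A, a ≠ w := fun a ha => (H.ne_of_adj ha).symm
  have hAz : ∀ a ∈ A, a ≠ z := by
    rintro a ha rfl; exact ((hHadj _ _).1 ha).2 rfl
  have hBz : ∀ a ∈ B, a ≠ z := fun a ha => (H.ne_of_adj ha).symm
  have hBw : ∀ a ∈ B, a ≠ w := by
    rintro a ha rfl; exact ((hHadj _ _).1 ha).2 Sym2.eq_swap
  by_cases hm : ∀ s, ∃ b ∈ B, b ∈ Rch Kg s A
  · exfalso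
    obtain ⟨a1, ha1, a2, ha2, b1, hb1, b2, hb2, p1, p2, hp1, hp2, hd⟩ :=
      menger _ Kg A B rfl hm
    refine hch w z hwz ?_
    let r1 : H.Walk a1 b1 := p1.mapLe hKH
    let r2 : H.Walk a2 b2 := p2.mapLe hKH
    have hr1 : r1.support = p1.support := Walk.support_mapLe_eq_support _ _
    have hr2 : r2.support = p2.support := Walk.support_mapLe_eq_support _ _
    have e1 : H.Adj b1 z := H.symm.symm _ _ hb1
    let T : H.Walk a1 a2 := r1.append (Walk.cons e1 (Walk.cons hb2 r2.reverse))
    have hTs : T.support = p1.support ++ (z :: p2.support.reverse) := by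
      simp [T, Walk.support_append, hr1, hr2]
    have w1 := avoid_of_isolated hKw p1 (hAw a1 ha1)
    have w2 := avoid_of_isolated hKw p2 (hAw a2 ha2)
    have z1 := avoid_of_isolated hKz p1 (hAz a1 ha1)
    have z2 := avoid_of_isolated hKz p2 (hAz a2 ha2)
    have hTw : w ∉ T.support := by
      rw [hTs]; simp [w1, w2, hne]
    have hTp : T.IsPath := by
      rw [Walk.isPath_def, hTs, List.nodup_append]
      refine ⟨hp1.support_nodup, ?_, ?_⟩
      · simp [z2, hp2.support_nodup]
      · intro a ha b hb hab
        subst hab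
        simp only [List.mem_cons, List.mem_reverse] at hb
        rcases hb with rfl | hb
        · exact z1 ha
        · exact hd _ ha hb
    have hwa1 : H.Adj w a1 := ha1
    have ha2w : H.Adj a2 w := H.symm.symm _ _ ha2
    refine ⟨a2, Walk.cons ha2w (Walk.cons hwa1 T), ?_, ?_, ?_⟩
    · rw [Walk.cons_isCycle_iff]
      refine ⟨(Walk.cons_isPath_iff _ _).2 ⟨hTp, hTw⟩, ?_⟩
      rw [Walk.edges_cons, List.mem_cons, not_or]
      constructor
      · intro he
        have : a1 ≠ a2 := by
          rintro rfl; exact hd _ p1.start_mem_support p2.start_mem_support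
        simp only [Sym2.eq_iff] at he
        rcases he with ⟨h, _⟩ | ⟨h, _⟩
        · exact hAw _ ha2 h
        · exact this h.symm
      · intro he
        exact hTw (Walk.snd_mem_support_of_mem_edges _ he)
    · simp
    · simp [hTs]
  · push Not at hm
    obtain ⟨s0, hs0⟩ := hm
    have : ∃ s, s ≠ w ∧ s ≠ z ∧ ∀ b ∈ B, b ∉ Rch Kg s A := by
      by_cases hsw : s0 = w ∨ s0 = z
      · have hfull : ∀ a v (q : Kg.Walk a v), a ∈ A → s0 ∉ q.support := by
          intro a v q ha
          rcases hsw with rfl | rfl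
          · exact avoid_of_isolated hKw q (hAw a ha)
          · exact avoid_of_isolated hKz q (hAz a ha)
        obtain ⟨a, ha, haz, _⟩ := hbw z z
        have haA : a ∈ A := by
          refine (hHadj _ _).2 ⟨ha, ?_⟩
          simp only [ne_eq, Sym2.eq_iff]
          rintro (⟨_, h⟩ | ⟨h, _⟩)
          · exact haz h
          · exact hne h
        refine ⟨a, hAw a haA, hAz a haA, ?_⟩
        rintro b hb ⟨a', ha', q, _⟩
        exact hs0 b hb ⟨a', ha', q, hfull _ _ q ha'⟩
      · push Not at hsw
        exact ⟨s0, hsw.1, hsw.2, hs0⟩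
    obtain ⟨s, hsw, hsz, hs⟩ := this
    have hRw : ∀ v ∈ Rch Kg s A, v ≠ w := by
      rintro v ⟨a, ha, q, _⟩ rfl
      exact avoid_of_isolated hKw q (hAw a ha) q.end_mem_support
    have hRz : ∀ v ∈ Rch Kg s A, v ≠ z := by
      rintro v ⟨a, ha, q, _⟩ rfl
      exact avoid_of_isolated hKz q (hAz a ha) q.end_mem_support
    refine ⟨insert w (Rch Kg s A), s, Set.mem_insert _ _, ?_, ?_, hsz, ?_⟩
    · rintro (h | h)
      · exact hne h.symm
      · exact hRz _ h rfl
    · rintro (h | h)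
      · exact hsw h
      · exact Rch_ne h rfl
    · rintro x hx y hxy
      by_cases hys : y = s
      · exact Or.inr (Or.inl hys)
      by_cases hyw : y = w
      · left; rw [hyw]; exact Set.mem_insert _ _
      rcases hx with rfl | hx
      · by_cases hyz : y = z
        · exact Or.inr (Or.inr ⟨rfl, hyz⟩)
        · left; right
          refine Rch_start ?_ hys
          refine (hHadj _ _).2 ⟨hxy, ?_⟩
          simp only [ne_eq, Sym2.eq_iff]
          rintro (⟨_, h⟩ | ⟨h, _⟩)
          · exact hyz h
          · exact hne h
      · have hxw := hRw x hx
        have hxz := hRz x hx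
        have hH : H.Adj x y := by
          refine (hHadj _ _).2 ⟨hxy, ?_⟩
          simp only [ne_eq, Sym2.eq_iff]
          rintro (⟨h, _⟩ | ⟨h, _⟩)
          · exact hxw h
          · exact hxz h
        have hyz : y ≠ z := by
          rintro rfl
          exact hs x (H.symm.symm _ _ hH) hx
        left; right
        exact Rch_step hx ⟨⟨hH, hxw, hyw⟩, hxz, hyz⟩ hys

end ChL
namespace ChL
universe u
variable {V : Type u} {K : Type}

def Good (k : ℕ) (G : SimpleGraph V) : Prop := CL G ∧ ∀ v, edeg G v ≤ k

def Col (k : ℕ) (G : SimpleGraph V) : Prop := ∃ c : Sym2 V → Fin k, AEC G c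

def IHyp (k : ℕ) (G : SimpleGraph V) : Prop :=
  ∀ H : SimpleGraph V, H.edgeSet.ncard < G.edgeSet.ncard → Good k H → Col k H

theorem Good.mono [Finite V] {k : ℕ} {G G' : SimpleGraph V} (h : Good k G) (hle : G' ≤ G) :
    Good k G' :=
  ⟨h.1.mono hle, fun v => le_trans
    (Set.ncard_le_ncard (fun _ hx => hle hx) (Set.toFinite _)) (h.2 v)⟩

theorem card_lt [Finite V] {G G' : SimpleGraph V} (hle : G' ≤ G) {x y : V} (h : G.Adj x y)
    (h' : ¬ G'.Adj x y) : G'.edgeSet.ncard < G.edgeSet.ncard := by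
  refine Set.ncard_lt_ncard ?_ (Set.toFinite _)
  rw [Set.ssubset_iff_of_subset (edgeSet_mono hle)]
  exact ⟨s(x, y), h, h'⟩

theorem card_le [Finite V] {G G' : SimpleGraph V} (hle : G' ≤ G) :
    G'.edgeSet.ncard ≤ G.edgeSet.ncard :=
  Set.ncard_le_ncard (edgeSet_mono hle) (Set.toFinite _)

/-- suppress `w`, joining `z` and `v` -/
def supp (G : SimpleGraph V) (w z v : V) : SimpleGraph V where
  Adj x y := (del G w).Adj x y ∨ (x ≠ y ∧ ((x = z ∧ y = v) ∨ (x = v ∧ y = z)))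
  symm := ⟨fun x y h => by
    rcases h with h | ⟨h1, h2⟩
    · exact Or.inl ((del G w).symm.symm _ _ h)
    · exact Or.inr ⟨h1.symm, by tauto⟩⟩
  loopless := ⟨fun x h => by
    rcases h with h | h
    · exact (del G w).loopless.irrefl _ h
    · exact h.1 rfl⟩

theorem del_le_supp (G : SimpleGraph V) (w z v : V) : del G w ≤ supp G w z v :=
  fun _ _ h => Or.inl h

theorem supp_new (G : SimpleGraph V) (w : V) {z v : V} (h : z ≠ v) : (supp G w z v).Adj z v :=
  Or.inr ⟨h, Or.inl ⟨rfl, rfl⟩⟩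

structure SuppHyp (G : SimpleGraph V) (w z v u : V) : Prop where
  hz : G.Adj w z
  hv : G.Adj w v
  hzv : z ≠ v
  hw : ∀ y, G.Adj w y → y = z ∨ y = v
  hsm : ∀ y, G.Adj v y → y = w ∨ y = u

theorem supp_CL {G : SimpleGraph V} {w z v u : V} (h : SuppHyp G w z v u) (hcl : CL G) :
    CL (supp G w z v) := by
  classical
  have hwz := h.hz.ne
  have hwv := h.hv.ne
  have hvsm : ¬ Big (supp G w z v) v := by
    intro hb
    obtain ⟨y, hy, h1, h2⟩ := hb u z
    rcases hy with hy | ⟨_, hy | hy⟩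
    · rcases h.hsm y hy.1 with rfl | rfl
      · exact hy.2.2 rfl
      · exact h1 rfl
    · exact h.hzv hy.1.symm
    · exact h2 hy.2
  have hbig : ∀ x, Big (supp G w z v) x → Big G x ∧ x ≠ v ∧ x ≠ w := by
    intro x hx
    have hxv : x ≠ v := by rintro rfl; exact hvsm hx
    refine ⟨?_, hxv, ?_⟩
    · intro a b
      obtain ⟨y, hy, h1, h2⟩ := hx (if a = w then v else a) (if b = w then v else b)
      rcases hy with hy | ⟨_, hy | hy⟩
      · refine ⟨y, hy.1, ?_, ?_⟩
        · rintro rfl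
          rw [if_neg hy.2.2] at h1
          exact h1 rfl
        · rintro rfl
          rw [if_neg hy.2.2] at h2
          exact h2 rfl
      · obtain ⟨rfl, rfl⟩ := hy
        refine ⟨w, h.hz.symm, ?_, ?_⟩
        · rintro rfl; simp at h1
        · rintro rfl; simp at h2
      · exact absurd hy.1 hxv
    · rintro rfl
      obtain ⟨y, hy, _⟩ := hx x x
      rcases hy with hy | ⟨_, hy | hy⟩
      · exact hy.2.1 rfl
      · exact hwz hy.1
      · exact hwv hy.1
  intro x y hxy hbx hby
  obtain ⟨bx, hxv, hxw⟩ := hbig x hbx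
  obtain ⟨by', hyv, hyw⟩ := hbig y hby
  have hG : G.Adj x y := by
    rcases hxy with hy | ⟨_, hy | hy⟩
    · exact hy.1
    · exact absurd hy.2 hyv
    · exact absurd hy.1 hxv
  obtain ⟨S, t, hxS, hyS, htS, hty, hcS⟩ := hcl x y hG bx by'
  by_cases hwt : w = t
  · subst hwt
    refine ⟨S \ {v}, v, ⟨hxS, hxv⟩, fun h => hyS h.1, fun h => h.2 rfl, hyv.symm, ?_⟩
    rintro a ⟨haS, hav⟩ b hab
    by_cases hbv : b = v
    · exact Or.inr (Or.inl hbv)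
    rcases hab with hab | ⟨_, hab | hab⟩
    · rcases hcS a haS b hab.1 with h | h | h
      · exact Or.inl ⟨h, hbv⟩
      · exact absurd h hab.2.2
      · exact Or.inr (Or.inr h)
    · exact absurd hab.2 hbv
    · exact absurd hab.1 hav
  · refine ⟨S, t, hxS, hyS, htS, hty, ?_⟩
    intro a haS b hab
    have aux : ∀ p q, p ∈ S → G.Adj p w → G.Adj w q → q ∈ S ∨ q = t := by
      intro p q hp hpw hwq
      rcases hcS p hp w hpw with h | h | h
      · rcases hcS w h q hwq with h | h | h
        · exact Or.inl h
        · exact Or.inr h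
        · exact absurd h.1.symm hxw
      · exact absurd h hwt
      · exact absurd h.2.symm hyw
    rcases hab with hab | ⟨_, ⟨rfl, rfl⟩ | ⟨rfl, rfl⟩⟩
    · exact hcS a haS b hab.1
    · rcases aux _ _ haS h.hz.symm h.hv with h | h <;> tauto
    · rcases aux _ _ haS h.hv.symm h.hz with h | h <;> tauto

theorem supp_deg [Finite V] {G : SimpleGraph V} {w z v u : V} (h : SuppHyp G w z v u) (x : V) :
    edeg (supp G w z v) x ≤ edeg G x := by
  classical
  have key : ∀ p q, G.Adj p w → ({y | y = q ∨ (G.Adj p y ∧ y ≠ w)} : Set V).ncard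
      ≤ {y | G.Adj p y}.ncard := by
    intro p q hpw
    have h1 : ({y | y = q ∨ (G.Adj p y ∧ y ≠ w)} : Set V) = insert q ({y | G.Adj p y} \ {w}) := by
      ext y; simp
    rw [h1]
    have h2 := Set.ncard_insert_le q ({y | G.Adj p y} \ {w})
    have h3 := Set.ncard_sdiff_singleton_add_one (s := {y | G.Adj p y}) (a := w) hpw (Set.toFinite _)
    omega
  unfold edeg
  by_cases hxz : x = z
  · subst hxz
    refine le_trans (Set.ncard_le_ncard ?_ (Set.toFinite _)) (key x v h.hz.symm)
    rintro y (hy | ⟨_, hy | hy⟩)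
    · exact Or.inr ⟨hy.1, hy.2.2⟩
    · exact Or.inl hy.2
    · exact absurd hy.1 h.hzv
  by_cases hxv : x = v
  · subst hxv
    refine le_trans (Set.ncard_le_ncard ?_ (Set.toFinite _)) (key x z h.hv.symm)
    rintro y (hy | ⟨_, hy | hy⟩)
    · exact Or.inr ⟨hy.1, hy.2.2⟩
    · exact absurd hy.1 hxz
    · exact Or.inl hy.2
  refine Set.ncard_le_ncard ?_ (Set.toFinite _)
  rintro y (hy | ⟨_, hy | hy⟩)
  · exact hy.1
  · exact absurd hy.1 hxz
  · exact absurd hy.1 hxv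

theorem supp_card [Finite V] {G : SimpleGraph V} {w z v u : V} (h : SuppHyp G w z v u) :
    (supp G w z v).edgeSet.ncard < G.edgeSet.ncard := by
  have h1 : (supp G w z v).edgeSet ⊆ insert s(z, v) ((G.edgeSet \ {s(w, z)}) \ {s(w, v)}) := by
    intro e
    induction e using Sym2.ind with
    | _ x y =>
    rintro (hy | ⟨_, ⟨rfl, rfl⟩ | ⟨rfl, rfl⟩⟩)
    · right
      refine ⟨⟨hy.1, ?_⟩, ?_⟩
      · simp only [Set.mem_singleton_iff, Sym2.eq_iff]
        rintro (⟨h, _⟩ | ⟨_, h⟩)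
        · exact hy.2.1 h
        · exact hy.2.2 h
      · simp only [Set.mem_singleton_iff, Sym2.eq_iff]
        rintro (⟨h, _⟩ | ⟨_, h⟩)
        · exact hy.2.1 h
        · exact hy.2.2 h
    · exact Or.inl rfl
    · exact Or.inl Sym2.eq_swap
  have h2 := Set.ncard_le_ncard h1 (Set.toFinite _)
  have h3 := Set.ncard_insert_le s(z, v) ((G.edgeSet \ {s(w, z)}) \ {s(w, v)})
  have h4 := Set.ncard_sdiff_singleton_add_one (s := G.edgeSet) (a := s(w, z)) h.hz (Set.toFinite _)
  have h5 := Set.ncard_sdiff_singleton_add_one (s := G.edgeSet \ {s(w, z)}) (a := s(w, v))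
    ⟨h.hv, by
      simp only [Set.mem_singleton_iff, Sym2.eq_iff]
      rintro (⟨_, e⟩ | ⟨e, _⟩)
      · exact h.hzv e.symm
      · exact h.hz.ne e⟩ (Set.toFinite _)
  omega

theorem supp_good [Finite V] {k : ℕ} {G : SimpleGraph V} {w z v u : V} (h : SuppHyp G w z v u)
    (hG : Good k G) : Good k (supp G w z v) :=
  ⟨supp_CL h hG.1, fun x => (supp_deg h x).trans (hG.2 x)⟩

/-- a colour of `Fin k` outside a small set -/
theorem avoid_two {k : ℕ} (hk : 3 ≤ k) (a b : Fin k) : ∃ t, t ≠ a ∧ t ≠ b := by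
  classical
  have : ({a, b} : Finset (Fin k)).card < (Finset.univ : Finset (Fin k)).card := by
    have := Finset.card_le_two (a := a) (b := b)
    simp; omega
  obtain ⟨t, _, ht⟩ := Finset.exists_mem_notMem_of_card_lt_card this
  simp at ht
  exact ⟨t, ht.1, ht.2⟩

theorem iso_not_reach {H : SimpleGraph V} {v x : V} (hv : ∀ y, ¬ H.Adj v y) (hne : v ≠ x) :
    ¬ H.Reachable v x := by
  intro h
  have := reach_closed {v} (fun a b ha hab => by
    rw [Set.mem_singleton_iff] at ha; subst ha; exact absurd hab (hv b)) h rfl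
  exact hne this.symm

/-- leaf case -/
theorem leaf_ext [Finite V] {k : ℕ} {G : SimpleGraph V} (hdeg : ∀ v, edeg G v ≤ k)
    {w x : V} (hwx : G.Adj w x) (hw : ∀ y, G.Adj w y → y = x) (ih : Col k (del G w)) :
    Col k G := by
  classical
  obtain ⟨c, hc⟩ := ih
  have : ∃ d : Fin k, ∀ y, G.Adj x y → y ≠ w → c s(x, y) ≠ d := by
    by_contra hcon
    push Not at hcon
    choose f hf using hcon
    have hinj : Set.InjOn f Set.univ := by
      intro a _ b _ hab
      rw [← (hf a).2.2, ← (hf b).2.2, hab]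
    have h1 : k ≤ ({y | G.Adj x y} \ {w}).ncard := by
      have := Set.ncard_le_ncard (s := f '' Set.univ) (t := {y | G.Adj x y} \ {w}) (by
        rintro _ ⟨a, _, rfl⟩; exact ⟨(hf a).1, (hf a).2.1⟩) (Set.toFinite _)
      rw [Set.InjOn.ncard_image hinj] at this
      simpa [Set.ncard_univ] using this
    have h2 := Set.ncard_sdiff_singleton_add_one (s := {y | G.Adj x y}) (a := w) hwx.symm
      (Set.toFinite _)
    have h3 := hdeg x
    unfold edeg at h3
    omega
  obtain ⟨d, hd⟩ := this
  obtain ⟨c', hc', _⟩ := ext_col G w c hc (fun _ => d) (fun v v' h h' _ => by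
      rw [hw v h, hw v' h'])
    (fun v y h hy hyw => by obtain rfl := hw v h; exact hd y hy hyw)
    (fun v v' h h' hne => absurd ((hw v h).trans (hw v' h').symm) hne)
  exact ⟨c', hc'⟩

theorem case_leaf [Finite V] {k : ℕ} {G : SimpleGraph V} (hG : Good k G) (ih : IHyp k G)
    {w x : V} (hwx : G.Adj w x) (hw : ∀ y, G.Adj w y → y = x) : Col k G :=
  leaf_ext hG.2 hwx hw (ih (del G w) (card_lt (del_le G w) hwx (fun h => h.2.1 rfl))
    (hG.mono (del_le G w)))

theorem fin_small {k : ℕ} (hk : 3 ≤ k) {G : SimpleGraph V} {w z v u : V} (h : SuppHyp G w z v u)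
    (huw : u ≠ w) (c : Sym2 V → Fin k) (hc : AEC (del G w) c) (ζ : Fin k)
    (h1 : ∀ x, G.Adj z x → x ≠ w → c s(z, x) ≠ ζ) (h2 : c s(v, u) ≠ ζ) : Col k G := by
  classical
  obtain ⟨τ, ht1, ht2⟩ := avoid_two hk ζ (c s(v, u))
  have hiso : ∀ y, ¬ (CG (del G w) c ζ τ).Adj v y := by
    rintro y ⟨hy, hcy⟩
    rcases h.hsm y hy.1 with rfl | rfl
    · exact hy.2.2 rfl
    · rcases hcy with e | e
      · exact h2 e
      · exact ht2 e.symm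
  suffices hh : ∃ c', AEC G c' ∧ (∀ x, c' s(w, x) = (if x = v then τ else ζ)) ∧
      ∀ x y, x ≠ w → y ≠ w → c' s(x, y) = c s(x, y) from ⟨hh.choose, hh.choose_spec.1⟩
  refine ext_col G w c hc (fun x => if x = v then τ else ζ) ?_ ?_ ?_
  · intro a b ha hb hab
    rcases h.hw a ha with rfl | rfl <;> rcases h.hw b hb with rfl | rfl
    · rfl
    · simp [h.hzv] at hab; exact absurd hab.symm ht1
    · simp [h.hzv] at hab; exact absurd hab ht1
    · rfl
  · intro a x ha hax hx
    rcases h.hw a ha with rfl | rfl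
    · simp only [h.hzv, if_false]; exact h1 x hax hx
    · simp only [if_true]
      rcases h.hsm x hax with rfl | rfl
      · exact absurd rfl hx
      · exact ht2.symm
  · intro a b ha hb hab
    rcases h.hw a ha with rfl | rfl <;> rcases h.hw b hb with rfl | rfl
    · exact absurd rfl hab
    · simp only [h.hzv, if_false, if_true]
      intro hr
      exact iso_not_reach hiso hab.symm hr.symm
    · simp only [h.hzv, if_false, if_true]
      intro hr
      rw [CG_comm] at hr
      exact iso_not_reach hiso hab hr
    · exact absurd rfl hab

/-- two adjacent small vertices -/
theorem case_small [Finite V] {k : ℕ} (hk : 3 ≤ k) {G : SimpleGraph V} (hG : Good k G)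
    (ih : IHyp k G)
    (hleaf : ∀ v a, G.Adj v a → ∃ b, G.Adj v b ∧ b ≠ a)
    {w v : V} (hwv : G.Adj w v) (hw : ¬ Big G w) (hv : ¬ Big G v) : Col k G := by
  classical
  obtain ⟨z, hwz, hzv, hwN⟩ := small_nbr hleaf hw hwv
  obtain ⟨u, hvu, huw, hvN⟩ := small_nbr hleaf hv hwv.symm
  have h : SuppHyp G w z v u := ⟨hwz, hwv, hzv, fun y hy => (hwN y hy).symm, hvN⟩
  by_cases hzu : z = u
  · subst hzu
    let H := G.deleteEdges {s(w, v)}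
    have hle : H ≤ G := deleteEdges_le _
    obtain ⟨c, hc⟩ := ih H (card_lt hle hwv (by simp [H])) (hG.mono hle)
    have hHad : ∀ x y, G.Adj x y → ¬ (x = w ∧ y = v) → ¬ (x = v ∧ y = w) → H.Adj x y := by
      intro x y h h1 h2
      simp only [H, deleteEdges_adj, Set.mem_singleton_iff, Sym2.eq_iff]
      tauto
    refine fin_small hk h huw c (hc.mono ?_) (c s(z, w)) ?_ ?_
    · intro x y hxy
      exact hHad x y hxy.1 (fun e => hxy.2.1 e.1) (fun e => hxy.2.2 e.2)
    · intro x hx hxw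
      refine hc.1 z x w (hHad _ _ hx (fun e => huw e.1) (fun e => hzv e.1))
        (hHad _ _ hwz.symm (fun e => huw e.1) (fun e => hzv e.1)) hxw
    · rw [Sym2.eq_swap]
      refine hc.1 z v w (hHad _ _ hvu.symm (fun e => huw e.1) (fun e => hzv e.1))
        (hHad _ _ hwz.symm (fun e => huw e.1) (fun e => hzv e.1)) hwv.ne.symm
  · obtain ⟨c, hc⟩ := ih (supp G w z v) (supp_card h) (supp_good h hG)
    have hnew := supp_new G w hzv
    refine fin_small hk h huw c (hc.mono (del_le_supp G w z v)) (c s(z, v)) ?_ ?_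
    · intro x hx hxw
      refine hc.1 z x v (Or.inl ⟨hx, hwz.ne.symm, hxw⟩) hnew ?_
      rintro rfl
      rcases hvN z hx.symm with e | e
      · exact hwz.ne e.symm
      · exact hzu e
    · rw [Sym2.eq_swap (a := z)]
      exact hc.1 v u z (Or.inl ⟨hvu, hwv.ne.symm, huw⟩) hnew.symm (Ne.symm hzu)

/-- cut case -/
theorem case_cut [Finite V] {k : ℕ} {G : SimpleGraph V} (hG : Good k G) (ih : IHyp k G)
    (hns : ¬ NonSep G) : Col k G := by
  unfold NonSep at hns
  push Not at hns
  obtain ⟨S, t, ht, hS, ⟨x, y, hxy, hx⟩, ⟨a, b, hab, ha, hb⟩⟩ := hns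
  have h1 : G1 G S ≤ G := fun _ _ h => h.1
  have h2 : G2 G S ≤ G := fun _ _ h => h.1
  obtain ⟨c₁, hc₁⟩ := ih (G1 G S) (card_lt h1 hab (fun h => by
    rcases h.2 with h | h
    · exact ha h
    · exact hb h)) (hG.mono h1)
  obtain ⟨c₂, hc₂⟩ := ih (G2 G S) (card_lt h2 hxy (fun h => h.2.1 hx)) (hG.mono h2)
  exact glue_col G S t ht hS (hG.2 t) c₁ c₂ hc₁ hc₂

end ChL
namespace ChL
universe u
variable {V : Type u} {K : Type}

theorem path_nbrs {H : SimpleGraph V} {a b : V} (p : H.Walk a b) (hp : p.IsPath) :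
    ∀ x ∈ p.support, x ≠ a → ∃ y ∈ p.support, H.Adj x y ∧
      (x = b ∨ ∃ y' ∈ p.support, y' ≠ y ∧ H.Adj x y') := by
  induction p with
  | nil => intro x hx hxa; simp at hx; exact absurd hx hxa
  | @cons a a1 b h p ih =>
    intro x hx hxa
    rw [Walk.cons_isPath_iff] at hp
    have hx' : x ∈ p.support := by
      rw [Walk.support_cons, List.mem_cons] at hx
      exact hx.resolve_left hxa
    by_cases hx1 : x = a1
    · subst hx1
      refine ⟨a, by simp, h.symm, ?_⟩
      cases p with
      | nil => exact Or.inl rfl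
      | @cons _ a2 _ h' q =>
        right
        have h2 : a2 ∈ (Walk.cons h' q).support := by simp
        refine ⟨a2, by simp, ?_, h'⟩
        rintro rfl
        exact hp.2 h2
    · obtain ⟨y, hy, hxy, h3⟩ := ih hp.1 x hx' hx1
      refine ⟨y, by simp [hy], hxy, ?_⟩
      rcases h3 with h3 | ⟨y', hy', h4, h5⟩
      · exact Or.inl h3
      · exact Or.inr ⟨y', by simp [hy'], h4, h5⟩

theorem three_leaves {H : SimpleGraph V}
    (h2 : ∀ x y1 y2 y3, H.Adj x y1 → H.Adj x y2 → H.Adj x y3 → y1 ≠ y2 → y3 = y1 ∨ y3 = y2)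
    {a b c : V} (hab : a ≠ b) (hac : a ≠ c) (hbc : b ≠ c)
    (hl : ∀ x, x = a ∨ x = b ∨ x = c → ∀ y y', H.Adj x y → H.Adj x y' → y = y')
    (r1 : H.Reachable a b) (r2 : H.Reachable a c) : False := by
  obtain ⟨p, hp⟩ := r1.exists_isPath
  have hn := path_nbrs p hp
  have hclosed : ∀ x y, x ∈ {x | x ∈ p.support} → H.Adj x y → y ∈ {x | x ∈ p.support} := by
    intro x y hx hxy
    simp only [Set.mem_ofPred_eq] at hx ⊢
    by_cases hxa : x = a
    · subst hxa
      cases p with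
      | nil => exact absurd rfl hab
      | @cons _ a2 _ h' q =>
        have := hl x (Or.inl rfl) y a2 hxy h'
        subst this
        simp
    · obtain ⟨z, hz, hxz, h3⟩ := hn x hx hxa
      rcases h3 with h3 | ⟨z', hz', h4, h5⟩
      · have := hl x (Or.inr (Or.inl h3)) y z hxy hxz
        rw [this]; exact hz
      · rcases h2 x z' z y h5 hxz hxy h4 with rfl | rfl
        · exact hz'
        · exact hz
  have hc : c ∈ p.support := reach_closed {x | x ∈ p.support} hclosed r2 p.start_mem_support
  obtain ⟨z, hz, hxz, h3⟩ := hn c hc hac.symm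
  rcases h3 with h3 | ⟨z', hz', h4, h5⟩
  · exact hbc h3.symm
  · exact h4 (hl c (by simp) _ _ h5 hxz)

theorem cyc_perm {α : Type*} [DecidableEq α] [Fintype α] (C : Finset α) (hC : 2 ≤ C.card) :
    ∃ f : Equiv.Perm α, (∀ x, x ∈ C → f x ∈ C) ∧ (∀ x, x ∉ C → f x = x) ∧
      (∀ x ∈ C, f x ≠ x) ∧ (3 ≤ C.card → ∀ x ∈ C, f (f x) ≠ x) := by
  obtain ⟨f, hf, hs⟩ := C.exists_cycleOn
  refine ⟨f, ?_, ?_, ?_, ?_⟩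
  · intro x hx; exact hf.1.mapsTo hx
  · intro x hx
    by_contra h
    exact hx (hs (by simpa using h))
  · intro x hx
    exact hf.apply_ne (by
      obtain ⟨a, ha, b, hb, hab⟩ := Finset.one_lt_card.1 (show 1 < C.card by omega)
      exact ⟨a, ha, b, hb, hab⟩) hx
  · intro h3 x hx h
    have := (hf.pow_apply_eq hx (n := 2)).1 (by simpa [pow_two] using h)
    have := Nat.le_of_dvd (by norm_num) this
    omega

theorem CG_deg2 {G : SimpleGraph V} {c : Sym2 V → K} (hc : AEC G c) (α β : K)
    (x y1 y2 y3 : V) (h1 : (CG G c α β).Adj x y1) (h2 : (CG G c α β).Adj x y2)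
    (h3 : (CG G c α β).Adj x y3) (h12 : y1 ≠ y2) : y3 = y1 ∨ y3 = y2 := by
  by_contra hcon
  push Not at hcon
  have e1 := hc.1 x y1 y2 h1.1 h2.1 h12
  have e2 := hc.1 x y3 y1 h3.1 h1.1 hcon.1
  have e3 := hc.1 x y3 y2 h3.1 h2.1 hcon.2
  rcases h1.2 with a | a <;> rcases h2.2 with b | b <;> rcases h3.2 with d | d <;>
    rw [a, b] at e1 <;> rw [d, a] at e2 <;> rw [d, b] at e3 <;> simp_all

/-- all neighbours of `w` have degree 2 -/
structure NbSmall (G : SimpleGraph V) (w : V) (u : V → V) : Prop where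
  h1 : ∀ v, G.Adj w v → G.Adj v (u v)
  h2 : ∀ v, G.Adj w v → u v ≠ w
  h3 : ∀ v, G.Adj w v → ∀ y, G.Adj v y → y = w ∨ y = u v

theorem NbSmall.leaf {G : SimpleGraph V} {w : V} {u : V → V} (h : NbSmall G w u) {v y : V}
    (hv : G.Adj w v) (hy : (del G w).Adj v y) : y = u v := by
  rcases h.h3 v hv y hy.1 with rfl | rfl
  · exact absurd rfl hy.2.2
  · rfl

/-- extending with a `d` without bad pairs -/
theorem nb_ext {k : ℕ} {G : SimpleGraph V} {w : V} {u : V → V} (h : NbSmall G w u)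
    (c : Sym2 V → Fin k) (hc : AEC (del G w) c) (d : V → Fin k)
    (hinj : ∀ v v', G.Adj w v → G.Adj w v' → d v = d v' → v = v')
    (hd : ∀ v, G.Adj w v → c s(v, u v) ≠ d v)
    (hbad : ∀ v v', G.Adj w v → G.Adj w v' → v ≠ v' → d v = c s(v', u v') →
      d v' = c s(v, u v) → ¬ (CG (del G w) c (d v) (d v')).Reachable v v') : Col k G := by
  suffices hh : ∃ c', AEC G c' ∧ (∀ x, c' s(w, x) = d x) ∧
      ∀ x y, x ≠ w → y ≠ w → c' s(x, y) = c s(x, y) from ⟨hh.choose, hh.choose_spec.1⟩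
  refine ext_col G w c hc d hinj ?_ ?_
  · intro v x hv hvx hx
    rcases h.h3 v hv x hvx with rfl | rfl
    · exact absurd rfl hx
    · exact hd v hv
  · intro v v' hv hv' hne hr
    have key : ∀ v v', G.Adj w v → G.Adj w v' → v ≠ v' →
        (CG (del G w) c (d v) (d v')).Reachable v v' → d v' = c s(v, u v) := by
      intro v v' hv hv' hne hr
      by_contra hcon
      refine iso_not_reach ?_ hne hr
      rintro y ⟨hy, hcy⟩
      rw [h.leaf hv hy] at hcy
      rcases hcy with e | e
      · exact hd v hv e
      · exact hcon e.symm
    refine hbad v v' hv hv' hne ?_ (key v v' hv hv' hne hr) hr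
    refine key v' v hv' hv hne.symm ?_
    rw [CG_comm]; exact hr.symm

theorem exists_inj {α β : Type*} [DecidableEq α] [DecidableEq β] [Nonempty β] (s : Finset α)
    (t : Finset β)
    (h : s.card ≤ t.card) : ∃ e : α → β, (∀ a ∈ s, e a ∈ t) ∧ Set.InjOn e s := by
  obtain ⟨f, hf, hinj⟩ := Set.Finite.exists_injOn_of_encard_le (s := (s : Set α))
    (t := (t : Set β)) s.finite_toSet (by simpa using h)
  exact ⟨f, fun a ha => by have := hf ha; simpa using this, hinj⟩

theorem nb_color [Finite V] {k : ℕ} {G : SimpleGraph V} {w : V} {u : V → V} (h : NbSmall G w u)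
    (hk : edeg G w ≤ k) (hb : Big G w)
    (c : Sym2 V → Fin k) (hc : AEC (del G w) c)
    (hnm : ∃ v1 v2, G.Adj w v1 ∧ G.Adj w v2 ∧ c s(v1, u v1) ≠ c s(v2, u v2)) : Col k G := by
  classical
  have := Fintype.ofFinite V
  let N : Finset V := Finset.univ.filter (fun v => G.Adj w v)
  have hN : ∀ v, v ∈ N ↔ G.Adj w v := by intro v; simp [N]
  have hNk : N.card ≤ k := by
    have : {u | G.Adj w u} = (N : Set V) := by ext; simp [N]
    unfold edeg at hk
    rw [this, Set.ncard_coe_finset] at hk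
    exact hk
  let col : V → Fin k := fun v => c s(v, u v)
  let C : Finset (Fin k) := N.image col
  obtain ⟨v1, v2, hv1, hv2, h12⟩ := hnm
  have hC1 : col v1 ∈ C := Finset.mem_image_of_mem _ ((hN _).2 hv1)
  have hC2 : col v2 ∈ C := Finset.mem_image_of_mem _ ((hN _).2 hv2)
  have hCcard : 2 ≤ C.card := Finset.one_lt_card.2 ⟨_, hC1, _, hC2, h12⟩
  -- representatives
  have hleafy : ∀ γ γ' v, G.Adj w v → ∀ y y', (CG (del G w) c γ γ').Adj v y →
      (CG (del G w) c γ γ').Adj v y' → y = y' := by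
    intro γ γ' v hv y y' hy hy'
    rw [h.leaf hv hy.1, h.leaf hv hy'.1]
  have hreps : ∃ r : Fin k → V, (∀ γ ∈ C, G.Adj w (r γ) ∧ col (r γ) = γ) ∧
      (C.card = 2 → ∀ γ ∈ C, ∀ γ' ∈ C, γ ≠ γ' → ¬ (CG (del G w) c γ γ').Reachable (r γ) (r γ')) := by
    by_cases hm : C.card = 2
    · have hCeq : ∀ γ ∈ C, γ = col v1 ∨ γ = col v2 := by
        have : C = {col v1, col v2} := by
          symm
          apply Finset.eq_of_subset_of_card_le
          · intro x; simp only [Finset.mem_insert, Finset.mem_singleton]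
            rintro (rfl | rfl) <;> assumption
          · rw [hm, Finset.card_pair h12]
        intro γ hγ
        rw [this] at hγ
        simpa using hγ
      obtain ⟨v3, hv3, h31, h32⟩ := hb v1 v2
      have hC3 := hCeq (col v3) (Finset.mem_image_of_mem _ ((hN _).2 hv3))
      have hdeg := CG_deg2 hc (col v1) (col v2)
      have h12' : v1 ≠ v2 := by rintro rfl; exact h12 rfl
      have hex : ∃ a1 a2, G.Adj w a1 ∧ G.Adj w a2 ∧ col a1 = col v1 ∧ col a2 = col v2 ∧
          ¬ (CG (del G w) c (col v1) (col v2)).Reachable a1 a2 := by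
        by_contra hcon
        push Not at hcon
        have r0 := hcon v1 v2 hv1 hv2 rfl rfl
        refine three_leaves hdeg h12' h31.symm h32.symm ?_ r0 ?_
        · rintro x hx
          refine hleafy _ _ x ?_
          rcases hx with rfl | rfl | rfl <;> assumption
        · rcases hC3 with e | e
          · exact r0.trans (hcon v3 v2 hv3 hv2 e rfl).symm
          · exact hcon v1 v3 hv1 hv3 rfl e
      obtain ⟨a1, a2, ha1, ha2, hc1, hc2, hnr⟩ := hex
      refine ⟨fun γ => if γ = col v1 then a1 else a2, ?_, ?_⟩
      · intro γ hγ
        rcases hCeq γ hγ with rfl | rfl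
        · simp [ha1, hc1]
        · have h21 : col v2 ≠ col v1 := fun e => h12 e.symm
          simp [h21, ha2, hc2]
      · intro _ γ hγ γ' hγ' hne
        have h21 : col v2 ≠ col v1 := fun e => h12 e.symm
        rcases hCeq γ hγ with rfl | rfl <;> rcases hCeq γ' hγ' with rfl | rfl
        · exact absurd rfl hne
        · simpa [h21] using hnr
        · simp only [h21, if_false, if_true]
          intro hr
          rw [CG_comm] at hr
          exact hnr hr.symm
        · exact absurd rfl hne
    · have : ∀ γ, ∃ v, γ ∈ C → G.Adj w v ∧ col v = γ := by
        intro γ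
        by_cases hγ : γ ∈ C
        · obtain ⟨v, hv, e⟩ := Finset.mem_image.1 hγ
          exact ⟨v, fun _ => ⟨(hN v).1 hv, e⟩⟩
        · exact ⟨v1, fun h => absurd h hγ⟩
      choose r hr using this
      exact ⟨r, hr, fun e => absurd e hm⟩
  obtain ⟨r, hr, hr2⟩ := hreps
  obtain ⟨f, hfC, -, hfne, hf2⟩ := cyc_perm C hCcard
  have hrinj : Set.InjOn r C := by
    intro γ hγ γ' hγ' e
    rw [← (hr γ hγ).2, ← (hr γ' hγ').2, e]
  have hsub : C.image r ⊆ N := by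
    intro v hv
    obtain ⟨γ, hγ, rfl⟩ := Finset.mem_image.1 hv
    exact (hN _).2 (hr γ hγ).1
  have : Nonempty (Fin k) := ⟨col v1⟩
  obtain ⟨e, heC, heinj⟩ := exists_inj (N \ C.image r) Cᶜ (by
    rw [Finset.card_sdiff_of_subset hsub, Finset.card_image_of_injOn hrinj, Finset.card_compl,
      Fintype.card_fin]
    omega)
  have hcolC : ∀ v, G.Adj w v → col v ∈ C := fun v hv => Finset.mem_image_of_mem _ ((hN _).2 hv)
  let d : V → Fin k := fun v => if r (col v) = v then f (col v) else e v
  have hd1 : ∀ v, r (col v) = v → d v = f (col v) := fun v hv => by simp [d, hv]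
  have hd2 : ∀ v, r (col v) ≠ v → d v = e v := fun v hv => by simp [d, hv]
  have hmem : ∀ v, G.Adj w v → r (col v) ≠ v → v ∈ N \ C.image r := by
    intro v hv hne
    rw [Finset.mem_sdiff]
    refine ⟨(hN v).2 hv, ?_⟩
    intro hi
    obtain ⟨γ, hγ, rfl⟩ := Finset.mem_image.1 hi
    rw [(hr γ hγ).2] at hne
    exact hne rfl
  have hdC : ∀ v, G.Adj w v → d v ∈ C → r (col v) = v := by
    intro v hv hdv
    by_contra hne
    rw [hd2 v hne] at hdv
    have := heC v (hmem v hv hne)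
    simp at this
    exact this hdv
  have hdC' : ∀ v, G.Adj w v → r (col v) = v → d v ∈ C := by
    intro v hv e
    rw [hd1 v e]; exact hfC _ (hcolC v hv)
  refine nb_ext h c hc d ?_ ?_ ?_
  · intro v v' hv hv' he
    by_cases h1 : r (col v) = v
    · have h2 := hdC v' hv' (he ▸ hdC' v hv h1)
      rw [hd1 v h1, hd1 v' h2] at he
      have := f.injective he
      rw [← h1, ← h2, this]
    · have h2 : r (col v') ≠ v' := fun h2 => h1 (hdC v hv (he ▸ hdC' v' hv' h2))
      rw [hd2 v h1, hd2 v' h2] at he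
      exact heinj (hmem v hv h1) (hmem v' hv' h2) he
  · intro v hv he
    have he' : col v = d v := he
    have h1 := hdC v hv (he' ▸ hcolC v hv)
    rw [hd1 v h1] at he'
    exact hfne _ (hcolC v hv) he'.symm
  · intro v v' hv hv' hne e1 e2
    have e1' : d v = col v' := e1
    have e2' : d v' = col v := e2
    have h1 := hdC v hv (e1' ▸ hcolC v' hv')
    have h2 := hdC v' hv' (e2' ▸ hcolC v hv)
    have f1 := hd1 v h1
    have f2 := hd1 v' h2
    have hff : f (f (col v)) = col v := by rw [← f1, e1', ← f2, e2']
    have hm : C.card = 2 := by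
      by_contra hm
      exact hf2 (by omega) _ (hcolC v hv) hff
    have hne' : col v ≠ col v' := by
      intro e; apply hne; rw [← h1, ← h2, e]
    have := hr2 hm _ (hcolC v hv) _ (hcolC v' hv') hne'
    rw [h1, h2] at this
    rw [e1', e2', CG_comm]
    exact this


theorem case_star [Finite V] {k : ℕ} {G : SimpleGraph V} (hG : Good k G)
    (ih : IHyp k G)
    (hleaf : ∀ v a, G.Adj v a → ∃ b, G.Adj v b ∧ b ≠ a)
    (hns : ¬ ∃ w v, G.Adj w v ∧ ¬ Big G w ∧ ¬ Big G v)
    {w : V} (hw : Big G w) (hN : ∀ v, G.Adj w v → ¬ Big G v) : Col k G := by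
  classical
  have hu : ∀ v, ∃ y, G.Adj w v → G.Adj v y ∧ y ≠ w ∧ ∀ a, G.Adj v a → a = w ∨ a = y := by
    intro v
    by_cases hv : G.Adj w v
    · obtain ⟨y, hy⟩ := small_nbr hleaf (hN v hv) hv.symm
      exact ⟨y, fun _ => hy⟩
    · exact ⟨v, fun h => absurd h hv⟩
  choose u hu using hu
  have h : NbSmall G w u := ⟨fun v hv => (hu v hv).1, fun v hv => (hu v hv).2.1,
    fun v hv => (hu v hv).2.2⟩
  have huN : ∀ v, G.Adj w v → ¬ G.Adj w (u v) := by
    intro v hv huv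
    exact hns ⟨v, u v, h.h1 v hv, hN v hv, hN _ huv⟩
  obtain ⟨v1, hv1, -⟩ := hw w w
  obtain ⟨v2, hv2, h21, -⟩ := hw v1 v1
  suffices hs : ∃ c : Sym2 V → Fin k, AEC (del G w) c ∧ c s(v1, u v1) ≠ c s(v2, u v2) by
    obtain ⟨c, hc, hne⟩ := hs
    exact nb_color h (hG.2 w) hw c hc ⟨v1, v2, hv1, hv2, hne⟩
  have dlt : (del G w).edgeSet.ncard < G.edgeSet.ncard :=
    card_lt (del_le G w) hv1 (fun h => h.2.1 rfl)
  by_cases huu : u v1 = u v2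
  · obtain ⟨c, hc⟩ := ih (del G w) dlt (hG.mono (del_le G w))
    refine ⟨c, hc, ?_⟩
    rw [huu, Sym2.eq_swap (a := v1), Sym2.eq_swap (a := v2)]
    refine hc.1 _ _ _ ⟨?_, h.h2 v2 hv2, hv1.ne.symm⟩ ⟨(h.h1 v2 hv2).symm, h.h2 v2 hv2, hv2.ne.symm⟩
      h21.symm
    rw [← huu]; exact (h.h1 v1 hv1).symm
  · have hu1v2 : u v1 ≠ v2 := fun e => huN v1 hv1 (e ▸ hv2)
    have hu2v1 : u v2 ≠ v1 := fun e => huN v2 hv2 (e ▸ hv1)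
    let H : SimpleGraph V :=
      { Adj := fun x y => G.Adj x y ∧ (x = w → y = v1 ∨ y = v2) ∧ (y = w → x = v1 ∨ x = v2)
        symm := ⟨fun x y h => ⟨h.1.symm, h.2.2, h.2.1⟩⟩
        loopless := ⟨fun x h => G.loopless.irrefl x h.1⟩ }
    have hHG : H ≤ G := fun x y h => h.1
    have hdH : del G w ≤ H := fun x y h =>
      ⟨h.1, fun e => absurd e h.2.1, fun e => absurd e h.2.2⟩
    have s1 : SuppHyp H w v1 v2 (u v2) := by
      refine ⟨⟨hv1, ?_, ?_⟩, ⟨hv2, ?_, ?_⟩, h21.symm, ?_, ?_⟩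
      · intro _; exact Or.inl rfl
      · intro e; exact absurd e hv1.ne.symm
      · intro _; exact Or.inr rfl
      · intro e; exact absurd e hv2.ne.symm
      · intro y hy; exact hy.2.1 rfl
      · intro y hy; exact h.h3 v2 hv2 y hy.1
    let F := supp H w v1 v2
    have hdF : del G w ≤ F := fun x y h => Or.inl ⟨hdH h, h.2.1, h.2.2⟩
    have s2 : SuppHyp F v2 (u v2) v1 (u v1) := by
      refine ⟨hdF ⟨h.h1 v2 hv2, hv2.ne.symm, h.h2 v2 hv2⟩, (supp_new H w h21.symm).symm, hu2v1,
        ?_, ?_⟩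
      · rintro y (hy | ⟨_, hy | hy⟩)
        · rcases h.h3 v2 hv2 y hy.1.1 with e | e
          · exact absurd e hy.2.2
          · exact Or.inl e
        · exact absurd hy.1 h21
        · exact Or.inr hy.2
      · rintro y (hy | ⟨_, hy | hy⟩)
        · rcases h.h3 v1 hv1 y hy.1.1 with e | e
          · exact absurd e hy.2.2
          · exact Or.inr e
        · exact Or.inl hy.2
        · exact absurd hy.1 h21.symm
    obtain ⟨c, hc⟩ := ih (supp F v2 (u v2) v1)
      ((supp_card s2).trans ((supp_card s1).trans_le (card_le hHG)))
      (supp_good s2 (supp_good s1 (hG.mono hHG)))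
    have hle : del (del G w) v2 ≤ supp F v2 (u v2) v1 := fun x y h =>
      Or.inl ⟨hdF h.1, h.2.1, h.2.2⟩
    have hnew := supp_new F v2 hu2v1
    have hone : ∀ y, (del G w).Adj v2 y → y = u v2 := fun y hy => h.leaf hv2 hy
    obtain ⟨c', hc', hw', ho'⟩ := ext_col (del G w) v2 c (hc.mono hle)
      (fun _ => c s(u v2, v1))
      (fun v v' h h' _ => by rw [hone v h, hone v' h'])
      (fun v x hv hvx hx => by
        obtain rfl := hone v hv
        refine hc.1 _ _ _ (hle ⟨hvx, hv.ne.symm, hx⟩) hnew ?_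
        rintro rfl
        rcases h.h3 x hv1 _ hvx.1.symm with e | e
        · exact h.h2 v2 hv2 e
        · exact huu e.symm)
      (fun v v' h h' hne => absurd ((hone v h).trans (hone v' h').symm) hne)
    refine ⟨c', hc', ?_⟩
    rw [hw', ho' _ _ h21.symm hu1v2, Sym2.eq_swap (a := u v2)]
    refine hc.1 _ _ _ (hle ⟨⟨h.h1 v1 hv1, hv1.ne.symm, h.h2 v1 hv1⟩, h21.symm, hu1v2⟩)
      hnew.symm huu

end ChL
namespace ChL
universe u
variable {V : Type u} {K : Type}

theorem cyc_perm2 {α : Type*} [DecidableEq α] [Fintype α] (s : Finset α) (hs : 3 ≤ s.card)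
    (a b : α) (ha : a ∈ s) (hb : b ∈ s) (hab : a ≠ b) :
    ∃ g : Equiv.Perm α, (∀ x, x ∈ s → g x ∈ s) ∧
      (∀ x ∈ s, g x ≠ x) ∧ (∀ x ∈ s, g (g x) ≠ x) ∧ g b = a := by
  obtain ⟨f, h1, -, h3, h4⟩ := cyc_perm s (by omega)
  have h4 := h4 hs
  let σ := Equiv.swap (f b) a
  have hσ : ∀ x, x ∈ s → σ x ∈ s := by
    intro x hx
    simp only [σ, Equiv.swap_apply_def]
    split_ifs
    · exact ha
    · exact h1 _ hb
    · exact hx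
  have hσσ : ∀ x, σ (σ x) = x := fun x => by simp [σ]
  refine ⟨σ * f * σ, ?_, ?_, ?_, ?_⟩
  · intro x hx; exact hσ _ (h1 _ (hσ _ hx))
  · intro x hx e
    have e : σ (f (σ x)) = x := e
    apply h3 _ (hσ _ hx)
    rw [← hσσ (f (σ x)), e]
  · intro x hx e
    have e : σ (f (σ (σ (f (σ x))))) = x := e
    rw [hσσ] at e
    apply h4 _ (hσ _ hx)
    rw [← hσσ (f (f (σ x))), e]
  · have : σ b = b := Equiv.swap_apply_of_ne_of_ne (h3 b hb).symm hab.symm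
    change σ (f (σ b)) = a
    rw [this]; exact Equiv.swap_apply_left _ _

structure Fan (G : SimpleGraph V) (w z t : V) : Prop where
  hwz : G.Adj w z
  hb : Big G w
  htz : t ≠ z
  htw : t ≠ w
  hN : ∀ v, G.Adj w v → v ≠ z → G.Adj v t ∧ ∀ y, G.Adj v y → y = w ∨ y = t

theorem Fan.leaf {G : SimpleGraph V} {w z t : V} (h : Fan G w z t) {v y : V} (hv : G.Adj w v)
    (hvz : v ≠ z) (hy : (del G w).Adj v y) : y = t := by
  rcases (h.hN v hv hvz).2 y hy.1 with e | e
  · exact absurd e hy.2.2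
  · exact e

theorem fan_ext {k : ℕ} {G : SimpleGraph V} {w z t : V} (h : Fan G w z t)
    (c : Sym2 V → Fin k) (hc : AEC (del G w) c) (ζ : Fin k)
    (hz : ∀ x, G.Adj z x → x ≠ w → c s(z, x) ≠ ζ) (d : V → Fin k)
    (hinj : ∀ v v', G.Adj w v → G.Adj w v' → v ≠ z → v' ≠ z → d v = d v' → v = v')
    (hdz : ∀ v, G.Adj w v → v ≠ z → d v ≠ ζ)
    (hd : ∀ v, G.Adj w v → v ≠ z → c s(v, t) ≠ d v)
    (hsw : ∀ v v', G.Adj w v → G.Adj w v' → v ≠ z → v' ≠ z → v ≠ v' → d v = c s(v', t) →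
      d v' = c s(v, t) → False)
    (hζ : ∀ v, G.Adj w v → v ≠ z → c s(v, t) = ζ →
      ∃ v', G.Adj w v' ∧ v' ≠ z ∧ c s(v', t) = d v) : Col k G := by
  classical
  let e : V → Fin k := fun x => if x = z then ζ else d x
  have ez : e z = ζ := by simp [e]
  have en : ∀ v, v ≠ z → e v = d v := fun v hv => by simp [e, hv]
  have hzz : ∀ v, G.Adj w v → v ≠ z → ¬ (CG (del G w) c (d v) ζ).Reachable v z := by
    intro v hv hvz hr
    by_cases hcz : c s(v, t) = ζ
    · obtain ⟨v', hv', hvz', e'⟩ := hζ v hv hvz hcz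
      have hvt : (del G w).Adj t v := ⟨((h.hN v hv hvz).1).symm, h.htw, hv.ne.symm⟩
      have hvt' : (del G w).Adj t v' := ⟨((h.hN v' hv' hvz').1).symm, h.htw, hv'.ne.symm⟩
      have := reach_closed {v, t, v'} (fun a b ha hab => by
        simp only [Set.mem_insert_iff, Set.mem_singleton_iff] at ha ⊢
        rcases ha with rfl | rfl | rfl
        · right; left; exact h.leaf hv hvz hab.1
        · rcases hab.2 with e1 | e1
          · right; right
            by_contra hne
            apply hc.1 _ _ _ hab.1 hvt' hne
            rw [e1, Sym2.eq_swap, e']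
          · left
            by_contra hne
            apply hc.1 _ _ _ hab.1 hvt hne
            rw [e1, Sym2.eq_swap, hcz]
        · right; left; exact h.leaf hv' hvz' hab.1) hr (by simp)
      simp only [Set.mem_insert_iff, Set.mem_singleton_iff] at this
      rcases this with e1 | e1 | e1
      · exact hvz e1.symm
      · exact h.htz e1.symm
      · exact hvz' e1.symm
    · refine iso_not_reach ?_ hvz hr
      rintro y ⟨hy, hcy⟩
      rw [h.leaf hv hvz hy] at hcy
      rcases hcy with e1 | e1
      · exact hd v hv hvz e1
      · exact hcz e1
  suffices hh : ∃ c', AEC G c' ∧ (∀ x, c' s(w, x) = e x) ∧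
      ∀ x y, x ≠ w → y ≠ w → c' s(x, y) = c s(x, y) from ⟨hh.choose, hh.choose_spec.1⟩
  refine ext_col G w c hc e ?_ ?_ ?_
  · intro v v' hv hv' he
    by_cases h1 : v = z <;> by_cases h2 : v' = z
    · rw [h1, h2]
    · rw [h1, ez, en v' h2] at he; exact absurd he.symm (hdz v' hv' h2)
    · rw [h2, ez, en v h1] at he; exact absurd he (hdz v hv h1)
    · rw [en v h1, en v' h2] at he; exact hinj v v' hv hv' h1 h2 he
  · intro v x hv hvx hx
    by_cases h1 : v = z
    · subst h1; rw [ez]; exact hz x hvx hx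
    · rw [en v h1]
      rcases (h.hN v hv h1).2 x hvx with e1 | rfl
      · exact absurd e1 hx
      · exact hd v hv h1
  · intro v v' hv hv' hne hr
    by_cases h1 : v = z <;> by_cases h2 : v' = z
    · exact hne (h1.trans h2.symm)
    · rw [h1, ez, en v' h2, CG_comm] at hr; exact hzz v' hv' h2 hr.symm
    · rw [h2, ez, en v h1] at hr; exact hzz v hv h1 hr
    · rw [en v h1, en v' h2] at hr
      have key : ∀ v v', G.Adj w v → G.Adj w v' → v ≠ z → v ≠ v' →
          (CG (del G w) c (d v) (d v')).Reachable v v' → d v' = c s(v, t) := by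
        intro v v' hv hv' h1 hne hr
        by_contra hcon
        refine iso_not_reach ?_ hne hr
        rintro y ⟨hy, hcy⟩
        rw [h.leaf hv h1 hy] at hcy
        rcases hcy with e | e
        · exact hd v hv h1 e
        · exact hcon e.symm
      refine hsw v v' hv hv' h1 h2 hne ?_ (key v v' hv hv' h1 hne hr)
      refine key v' v hv' hv h2 hne.symm ?_
      rw [CG_comm]; exact hr.symm

/-- keep only the edge `wz` at `w` -/
def keep (G : SimpleGraph V) (w z : V) : SimpleGraph V where
  Adj x y := G.Adj x y ∧ (x = w → y = z) ∧ (y = w → x = z)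
  symm := ⟨fun _ _ h => ⟨h.1.symm, h.2.2, h.2.1⟩⟩
  loopless := ⟨fun x h => G.loopless.irrefl x h.1⟩

theorem keep_le (G : SimpleGraph V) (w z : V) : keep G w z ≤ G := fun _ _ h => h.1

theorem del_le_keep (G : SimpleGraph V) (w z : V) : del G w ≤ keep G w z := fun _ _ h =>
  ⟨h.1, fun e => absurd e h.2.1, fun e => absurd e h.2.2⟩

theorem fan_keep [Finite V] {k : ℕ} {G : SimpleGraph V} (hG : Good k G) (ih : IHyp k G)
    {w z t : V} (h : Fan G w z t) : ∃ c : Sym2 V → Fin k, AEC (keep G w z) c ∧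
      ∀ x, G.Adj z x → x ≠ w → c s(z, x) ≠ c s(z, w) := by
  obtain ⟨v, hv, hvz, -⟩ := h.hb z z
  obtain ⟨c, hc⟩ := ih (keep G w z) (card_lt (keep_le G w z) hv (fun e => hvz (e.2.1 rfl)))
    (hG.mono (keep_le G w z))
  refine ⟨c, hc, fun x hx hxw => hc.1 z x w ?_ ?_ hxw⟩
  · exact ⟨hx, fun e => absurd e h.hwz.ne.symm, fun e => absurd e hxw⟩
  · exact ⟨h.hwz.symm, fun e => absurd e h.hwz.ne.symm, fun _ => rfl⟩

theorem fan4 [Finite V] {k : ℕ} (hk : 4 ≤ k) {G : SimpleGraph V} (hG : Good k G) (ih : IHyp k G)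
    {w z t : V} (h : Fan G w z t) : Col k G := by
  classical
  have := Fintype.ofFinite V
  obtain ⟨c, hc, hz⟩ := fan_keep hG ih h
  have hc := hc.mono (del_le_keep G w z)
  set ζ := c s(z, w) with hζdef
  let s : Finset (Fin k) := Finset.univ.erase ζ
  have hs : 3 ≤ s.card := by
    simp [s]; omega
  have hms : ∀ x, x ∈ s ↔ x ≠ ζ := by intro x; simp [s]
  have hcinj : ∀ v v', G.Adj w v → G.Adj w v' → v ≠ z → v' ≠ z → c s(v, t) = c s(v', t) →
      v = v' := by
    intro v v' hv hv' h1 h2 e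
    by_contra hne
    refine hc.1 t v v' ⟨(h.hN v hv h1).1.symm, h.htw, hv.ne.symm⟩
      ⟨(h.hN v' hv' h2).1.symm, h.htw, hv'.ne.symm⟩ hne ?_
    rw [Sym2.eq_swap, e, Sym2.eq_swap]
  by_cases hcase : ∃ v1, G.Adj w v1 ∧ v1 ≠ z ∧ c s(v1, t) = ζ
  · obtain ⟨v1, hv1, h1z, h1ζ⟩ := hcase
    obtain ⟨v2, hv2, h2z, h21⟩ := h.hb z v1
    have haζ : c s(v2, t) ≠ ζ := by
      intro e; exact h21 (hcinj v2 v1 hv2 hv1 h2z h1z (e.trans h1ζ.symm))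
    have hb : ∃ b, b ≠ ζ ∧ ∀ v, G.Adj w v → v ≠ z → c s(v, t) ≠ b := by
      let N : Finset V := Finset.univ.filter (fun v => G.Adj w v)
      have hNk : N.card ≤ k := by
        have e1 : {u | G.Adj w u} = (N : Set V) := by ext; simp [N]
        have := hG.2 w
        unfold edeg at this
        rw [e1, Set.ncard_coe_finset] at this
        exact this
      have hzN : z ∈ N := by simp [N, h.hwz]
      have hlt : ((N.erase z).image (fun v => c s(v, t))).card
          < (Finset.univ : Finset (Fin k)).card := by
        refine lt_of_le_of_lt Finset.card_image_le ?_
        rw [Finset.card_erase_of_mem hzN, Finset.card_univ, Fintype.card_fin]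
        omega
      obtain ⟨b, _, hb⟩ := Finset.exists_mem_notMem_of_card_lt_card hlt
      have hb' : ∀ v, G.Adj w v → v ≠ z → c s(v, t) ≠ b := by
        intro v hv hvz e
        apply hb
        rw [Finset.mem_image]
        exact ⟨v, by simp [N, hv, hvz], e⟩
      refine ⟨b, ?_, hb'⟩
      rintro rfl
      exact hb' v1 hv1 h1z h1ζ
    obtain ⟨b, hbζ, hb⟩ := hb
    obtain ⟨g, g1, g2, g3, g4⟩ := cyc_perm2 s hs (c s(v2, t)) b ((hms _).2 haζ) ((hms _).2 hbζ)
      (hb v2 hv2 h2z)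
    have hcs : ∀ v, G.Adj w v → v ≠ z → v ≠ v1 → c s(v, t) ∈ s := by
      intro v hv hvz hne
      rw [hms]
      intro e; exact hne (hcinj v v1 hv hv1 hvz h1z (e.trans h1ζ.symm))
    let d : V → Fin k := fun v => if v = v1 then c s(v2, t) else g (c s(v, t))
    have d1 : d v1 = c s(v2, t) := by simp [d]
    have dn : ∀ v, v ≠ v1 → d v = g (c s(v, t)) := fun v hv => by simp [d, hv]
    have dζ : ∀ v, G.Adj w v → v ≠ z → d v ≠ ζ := by
      intro v hv hvz
      by_cases e1 : v = v1
      · rw [e1, d1]; exact haζ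
      · rw [dn v e1, ← hms]; exact g1 _ (hcs v hv hvz e1)
    have da : ∀ v, G.Adj w v → v ≠ z → v ≠ v1 → d v ≠ d v1 := by
      intro v hv hvz hne e
      rw [dn v hne, d1, ← g4] at e
      exact hb v hv hvz (g.injective e)
    refine fan_ext h c hc ζ hz d ?_ dζ ?_ ?_ ?_
    · intro v v' hv hv' h1 h2 e
      by_cases e1 : v = v1 <;> by_cases e2 : v' = v1
      · rw [e1, e2]
      · rw [e1] at e; exact absurd e.symm (da v' hv' h2 e2)
      · rw [e2] at e; exact absurd e (da v hv h1 e1)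
      · rw [dn v e1, dn v' e2] at e
        exact hcinj v v' hv hv' h1 h2 (g.injective e)
    · intro v hv hvz
      by_cases e1 : v = v1
      · rw [e1, d1, h1ζ]; exact haζ.symm
      · rw [dn v e1]; exact (g2 _ (hcs v hv hvz e1)).symm
    · intro v v' hv hv' h1 h2 hne e e'
      by_cases e1 : v = v1
      · rw [e1, h1ζ] at e'; exact dζ v' hv' h2 e'
      by_cases e2 : v' = v1
      · rw [e2, h1ζ] at e; exact dζ v hv h1 e
      rw [dn v e1] at e
      rw [dn v' e2, ← e] at e'
      exact g3 _ (hcs v hv h1 e1) e'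
    · intro v hv hvz e
      have : v = v1 := hcinj v v1 hv hv1 hvz h1z (e.trans h1ζ.symm)
      rw [this, d1]
      exact ⟨v2, hv2, h2z, rfl⟩
  · push Not at hcase
    obtain ⟨g, g1, -, g2, g3⟩ := cyc_perm s (by omega)
    have g3 := g3 hs
    have hcs : ∀ v, G.Adj w v → v ≠ z → c s(v, t) ∈ s := by
      intro v hv hvz
      rw [hms]
      exact hcase v hv hvz
    refine fan_ext h c hc ζ hz (fun v => g (c s(v, t))) ?_ ?_ ?_ ?_ ?_
    · intro v v' hv hv' h1 h2 e
      exact hcinj v v' hv hv' h1 h2 (g.injective e)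
    · intro v hv hvz
      rw [← hms]; exact g1 _ (hcs v hv hvz)
    · intro v hv hvz
      exact (g2 _ (hcs v hv hvz)).symm
    · intro v v' hv hv' h1 h2 hne e e'
      change g _ = _ at e
      change g _ = _ at e'
      rw [← e] at e'
      exact g3 _ (hcs v hv h1) e'
    · intro v hv hvz e
      exact absurd e (hcase v hv hvz)

theorem fan3_fin {k : ℕ} (hk : 3 ≤ k) {G : SimpleGraph V} {w z t v1 v2 : V} (h : Fan G w z t)
    (hv1 : G.Adj w v1) (hv2 : G.Adj w v2) (h1z : v1 ≠ z) (h2z : v2 ≠ z) (h12 : v1 ≠ v2)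
    (hw : ∀ y, G.Adj w y → y = z ∨ y = v1 ∨ y = v2)
    (ht : ∀ s s', G.Adj t s → G.Adj t s' → s ≠ v1 → s ≠ v2 → s' ≠ v1 → s' ≠ v2 → s = s')
    (c : Sym2 V → Fin k) (hc : AEC (del (del G w) t) c) (ζ σ : Fin k) (hζσ : ζ ≠ σ)
    (hz : ∀ x, (del (del G w) t).Adj z x → c s(z, x) ≠ ζ)
    (hs : ∀ s, G.Adj t s → s ≠ v1 → s ≠ v2 → ∀ x, (del (del G w) t).Adj s x → c s(s, x) ≠ σ) :
    Col k G := by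
  classical
  obtain ⟨τ, hτζ, hτσ⟩ := avoid_two hk ζ σ
  let d : V → Fin k := fun x => if x = v1 then τ else if x = v2 then ζ else σ
  have d1 : d v1 = τ := by simp [d]
  have d2 : d v2 = ζ := by simp [d, h12.symm]
  have d3 : ∀ s, s ≠ v1 → s ≠ v2 → d s = σ := fun s h1 h2 => by simp [d, h1, h2]
  have hiso : ∀ v, v = v1 ∨ v = v2 → ∀ y, ¬ (del (del G w) t).Adj v y := by
    intro v hv y hy
    have : y = t := by
      rcases hv with rfl | rfl
      · exact h.leaf hv1 h1z hy.1
      · exact h.leaf hv2 h2z hy.1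
    exact hy.2.2 this
  obtain ⟨c', hc', ht', ho'⟩ : ∃ c', AEC (del G w) c' ∧ (∀ x, c' s(t, x) = d x) ∧
      ∀ x y, x ≠ t → y ≠ t → c' s(x, y) = c s(x, y) := by
    refine ext_col (del G w) t c hc d ?_ ?_ ?_
    · intro v v' hv hv' e
      by_cases e1 : v = v1
      · by_cases e2 : v' = v1
        · rw [e1, e2]
        · by_cases e3 : v' = v2
          · rw [e1, e3, d1, d2] at e; exact absurd e hτζ
          · rw [e1, d1, d3 v' e2 e3] at e; exact absurd e hτσ
      · by_cases e1' : v = v2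
        · by_cases e2 : v' = v1
          · rw [e1', e2, d1, d2] at e; exact absurd e.symm hτζ
          · by_cases e3 : v' = v2
            · rw [e1', e3]
            · rw [e1', d2, d3 v' e2 e3] at e; exact absurd e hζσ
        · by_cases e2 : v' = v1
          · rw [e2, d1, d3 v e1 e1'] at e; exact absurd e.symm hτσ
          · by_cases e3 : v' = v2
            · rw [e3, d2, d3 v e1 e1'] at e; exact absurd e.symm hζσ
            · exact ht v v' hv.1 hv'.1 e1 e1' e2 e3
    · intro v x hv hvx hx
      have hD : (del (del G w) t).Adj v x := ⟨hvx, hv.ne.symm, hx⟩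
      by_cases e1 : v = v1
      · exact absurd hD (hiso v (Or.inl e1) x)
      by_cases e2 : v = v2
      · exact absurd hD (hiso v (Or.inr e2) x)
      rw [d3 v e1 e2]
      exact hs v hv.1 e1 e2 x hD
    · intro v v' hv hv' hne hr
      by_cases e1 : v = v1 ∨ v = v2
      · exact iso_not_reach (fun y (hy : (CG (del (del G w) t) c (d v) (d v')).Adj v y) => hiso v e1 y hy.1) hne hr
      by_cases e2 : v' = v1 ∨ v' = v2
      · exact iso_not_reach (fun y (hy : (CG (del (del G w) t) c (d v) (d v')).Adj v' y) => hiso v' e2 y hy.1) hne.symm hr.symm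
      push Not at e1 e2
      exact hne (ht v v' hv.1 hv'.1 e1.1 e1.2 e2.1 e2.2)
  have c1 : c' s(v1, t) = τ := by rw [Sym2.eq_swap, ht', d1]
  have c2 : c' s(v2, t) = ζ := by rw [Sym2.eq_swap, ht', d2]
  have hw' : ∀ y, G.Adj w y → y ≠ z → y = v1 ∨ y = v2 := fun y hy hyz =>
    (hw y hy).resolve_left hyz
  let e : V → Fin k := fun x => if x = v1 then σ else τ
  have e1 : e v1 = σ := by simp [e]
  have e2 : e v2 = τ := by simp [e, h12.symm]
  refine fan_ext h c' hc' ζ ?_ e ?_ ?_ ?_ ?_ ?_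
  · intro x hx hxw
    by_cases hxt : x = t
    · subst hxt
      rw [Sym2.eq_swap, ht', d3 z h1z.symm h2z.symm]; exact hζσ.symm
    · rw [ho' z x h.htz.symm hxt]
      exact hz x ⟨⟨hx, h.hwz.ne.symm, hxw⟩, h.htz.symm, hxt⟩
  · intro v v' hv hv' h1 h2 he
    rcases hw' v hv h1 with rfl | rfl <;> rcases hw' v' hv' h2 with rfl | rfl
    · rfl
    · rw [e1, e2] at he; exact absurd he.symm hτσ
    · rw [e1, e2] at he; exact absurd he hτσ
    · rfl
  · intro v hv hvz
    rcases hw' v hv hvz with rfl | rfl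
    · rw [e1]; exact hζσ.symm
    · rw [e2]; exact hτζ
  · intro v hv hvz
    rcases hw' v hv hvz with rfl | rfl
    · rw [e1, c1]; exact hτσ
    · rw [e2, c2]; exact hτζ.symm
  · intro v v' hv hv' h1 h2 hne he he'
    rcases hw' v hv h1 with rfl | rfl <;> rcases hw' v' hv' h2 with rfl | rfl
    · exact hne rfl
    · rw [e1, c2] at he; exact hζσ he.symm
    · rw [e1, c2] at he'; exact hζσ he'.symm
    · exact hne rfl
  · intro v hv hvz he
    rcases hw' v hv hvz with rfl | rfl
    · rw [c1] at he; exact absurd he hτζ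
    · rw [e2]; exact ⟨v1, hv1, h1z, c1⟩

theorem deg3_nbrs [Finite V] {G : SimpleGraph V} {w a b c : V} (hd : edeg G w ≤ 3)
    (ha : G.Adj w a) (hb : G.Adj w b) (hc : G.Adj w c) (hab : a ≠ b) (hac : a ≠ c) (hbc : b ≠ c)
    (y : V) (hy : G.Adj w y) : y = a ∨ y = b ∨ y = c := by
  have h1 : ({a, b, c} : Set V) ⊆ {u | G.Adj w u} := by
    intro x; simp only [Set.mem_insert_iff, Set.mem_singleton_iff]
    rintro (rfl | rfl | rfl) <;> assumption
  have h2 : ({a, b, c} : Set V).ncard = 3 := Set.ncard_eq_three.2 ⟨a, b, c, hab, hac, hbc, rfl⟩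
  have h3 := Set.eq_of_subset_of_ncard_le h1 (by rw [h2]; exact hd) (Set.toFinite _)
  have : y ∈ ({a, b, c} : Set V) := by rw [h3]; exact hy
  simpa using this

theorem fan3 [Finite V] {G : SimpleGraph V} (hG : Good 3 G) (ih : IHyp 3 G)
    {w z t : V} (h : Fan G w z t) : Col 3 G := by
  classical
  obtain ⟨v1, hv1, h1z, -⟩ := h.hb z z
  obtain ⟨v2, hv2, h2z, h21⟩ := h.hb z v1
  have hw : ∀ y, G.Adj w y → y = z ∨ y = v1 ∨ y = v2 :=
    deg3_nbrs (hG.2 w) h.hwz hv1 hv2 h1z.symm h2z.symm h21.symm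
  have ht1 := (h.hN v1 hv1 h1z).1.symm
  have ht2 := (h.hN v2 hv2 h2z).1.symm
  have hwt : ¬ G.Adj w t := fun e => G.irrefl (h.hN t e h.htz).1
  have ht : ∀ s s', G.Adj t s → G.Adj t s' → s ≠ v1 → s ≠ v2 → s' ≠ v1 → s' ≠ v2 → s = s' := by
    intro s s' hs hs' a1 a2 b1 b2
    rcases deg3_nbrs (hG.2 t) ht1 ht2 hs h21.symm a1.symm a2.symm s' hs' with e | e | e
    · exact absurd e b1
    · exact absurd e b2
    · exact e.symm
  by_cases hsz : ∃ s, G.Adj t s ∧ s ≠ v1 ∧ s ≠ v2 ∧ s ≠ z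
  · obtain ⟨s, hts, hs1, hs2, hsz⟩ := hsz
    have hsw : s ≠ w := by rintro rfl; exact hwt hts.symm
    have htN : ∀ y, G.Adj t y → y = v1 ∨ y = v2 ∨ y = s := fun y hy => by
      by_contra hcon
      push Not at hcon
      exact hcon.2.2 (ht y s hy hts hcon.1 hcon.2.1 hs1 hs2)
    have s1 : SuppHyp (del G v2) v1 w t s := by
      refine ⟨⟨hv1.symm, h21.symm, hv2.ne⟩, ⟨ht1.symm, h21.symm, ht2.ne⟩, h.htw.symm, ?_, ?_⟩
      · intro y hy; exact (h.hN v1 hv1 h1z).2 y hy.1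
      · intro y hy
        rcases htN y hy.1 with e | e | e
        · exact Or.inl e
        · exact absurd e hy.2.2
        · exact Or.inr e
    let F := supp (del G v2) v1 w t
    have s2 : SuppHyp F t s w z := by
      refine ⟨Or.inl ⟨⟨hts, ht2.ne, hs2⟩, ht1.ne, hs1⟩, (supp_new _ _ h.htw.symm).symm, hsw, ?_, ?_⟩
      · rintro y (hy | ⟨_, hy | hy⟩)
        · rcases htN y hy.1.1 with e | e | e
          · exact absurd e hy.2.2
          · exact absurd e hy.1.2.2
          · exact Or.inl e
        · exact absurd hy.1 h.htw
        · exact Or.inr hy.2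
      · rintro y (hy | ⟨_, hy | hy⟩)
        · rcases hw y hy.1.1 with e | e | e
          · exact Or.inr e
          · exact absurd e hy.2.2
          · exact absurd e hy.1.2.2
        · exact Or.inl hy.2
        · exact absurd hy.1 h.htw.symm
    obtain ⟨c, hc⟩ := ih (supp F t s w)
      ((supp_card s2).trans ((supp_card s1).trans_le (card_le (del_le G v2))))
      (supp_good s2 (supp_good s1 (hG.mono (del_le G v2))))
    have hlift : ∀ x y, G.Adj x y → x ≠ v2 → y ≠ v2 → x ≠ v1 → y ≠ v1 → x ≠ t → y ≠ t →
        (supp F t s w).Adj x y := fun x y h a1 a2 a3 a4 a5 a6 =>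
      Or.inl ⟨Or.inl ⟨⟨h, a1, a2⟩, a3, a4⟩, a5, a6⟩
    have hnv : ∀ x y, (del (del G w) t).Adj x y → x ≠ v1 ∧ x ≠ v2 := by
      intro x y hxy
      constructor
      · rintro rfl; exact hxy.2.2 (h.leaf hv1 h1z hxy.1)
      · rintro rfl; exact hxy.2.2 (h.leaf hv2 h2z hxy.1)
    have hle : del (del G w) t ≤ supp F t s w := by
      intro x y hxy
      have a := hnv x y hxy
      have b := hnv y x hxy.symm
      exact hlift x y hxy.1.1 a.2 b.2 a.1 b.1 hxy.2.1 hxy.2.2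
    have hzw : (supp F t s w).Adj z w := hlift z w h.hwz.symm h2z.symm hv2.ne h1z.symm hv1.ne
      h.htz.symm h.htw.symm
    have hsw' : (supp F t s w).Adj s w := supp_new F t hsw
    refine fan3_fin le_rfl h hv1 hv2 h1z h2z h21.symm hw ht c (hc.mono hle) (c s(z, w)) (c s(s, w))
      ?_ ?_ ?_
    · rw [Sym2.eq_swap, Sym2.eq_swap (a := s)]
      exact hc.1 _ _ _ hzw.symm hsw'.symm hsz.symm
    · intro x hx
      exact hc.1 _ _ _ (hle hx) hzw hx.1.2.2
    · intro s' hs' b1 b2 x hx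
      obtain rfl := ht s s' hts hs' hs1 hs2 b1 b2
      exact hc.1 _ _ _ (hle hx) hsw' hx.1.2.2
  · push Not at hsz
    obtain ⟨c, hc, hz⟩ := fan_keep hG ih h
    have hle : del (del G w) t ≤ keep G w z := (del_le _ _).trans (del_le_keep G w z)
    by_cases htz : G.Adj t z
    · refine fan3_fin le_rfl h hv1 hv2 h1z h2z h21.symm hw ht c (hc.mono hle) (c s(z, w))
        (c s(z, t)) ?_ ?_ ?_
      · exact (hz t htz.symm h.htw).symm
      · intro x hx; exact hz x hx.1.1 hx.1.2.2
      · intro s hs b1 b2 x hx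
        obtain rfl := hsz s hs b1 b2
        refine hc.1 _ _ _ (hle hx) ?_ hx.2.2
        exact del_le_keep G w s ⟨htz.symm, h.hwz.ne.symm, h.htw⟩
    · obtain ⟨σ, hσ, -⟩ := avoid_two le_rfl (c s(z, w)) (c s(z, w))
      refine fan3_fin le_rfl h hv1 hv2 h1z h2z h21.symm hw ht c (hc.mono hle) (c s(z, w))
        σ hσ.symm ?_ ?_
      · intro x hx; exact hz x hx.1.1 hx.1.2.2
      · intro s hs b1 b2 x hx
        obtain rfl := hsz s hs b1 b2
        exact absurd hs htz

theorem main_col [Finite V] {k : ℕ} (hk : 3 ≤ k) (n : ℕ) : ∀ G : SimpleGraph V,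
    G.edgeSet.ncard = n → Good k G → Col k G := by
  induction n using Nat.strong_induction_on with
  | _ n ihn =>
  intro G hn hG
  have ih : IHyp k G := fun H hH hg => ihn _ (hn ▸ hH) H rfl hg
  by_cases hne : ∃ x y, G.Adj x y
  swap
  · push Not at hne
    refine ⟨fun _ => ⟨0, by omega⟩, fun x y _ h => absurd h (hne x y), fun α β => ?_⟩
    have : CG G (fun _ => (⟨0, by omega⟩ : Fin k)) α β = ⊥ := by
      ext x y; simp [CG, hne]
    rw [this]
    exact isAcyclic_bot
  by_cases hleaf : ∀ v a, G.Adj v a → ∃ b, G.Adj v b ∧ b ≠ a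
  swap
  · push Not at hleaf
    obtain ⟨v, a, hva, h⟩ := hleaf
    exact case_leaf hG ih hva h
  by_cases hns : NonSep G
  swap
  · exact case_cut hG ih hns
  by_cases hsm : ∃ w v, G.Adj w v ∧ ¬ Big G w ∧ ¬ Big G v
  · obtain ⟨w, v, h1, h2, h3⟩ := hsm
    exact case_small hk hG ih hleaf h1 h2 h3
  rcases structure_thm hG.1 hns hleaf hne with h | ⟨w, h1, h2⟩ | ⟨w, z, t, h1, h2, h3, h4, h5⟩
  · exact absurd h hsm
  · exact case_star hG ih hleaf hsm h1 h2
  · have hF : Fan G w z t := ⟨h1, h2, h3, h4, h5⟩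
    by_cases hk4 : 4 ≤ k
    · exact fan4 hk4 hG ih hF
    · obtain rfl : k = 3 := by omega
      exact fan3 hG ih hF

end ChL
namespace ChL
universe u
variable {V : Type u} {K : Type}

theorem empty_col {k : ℕ} (hk : 1 ≤ k) {G : SimpleGraph V} (hne : ∀ x y, ¬ G.Adj x y) :
    Col k G := by
  refine ⟨fun _ => ⟨0, by omega⟩, fun x y _ h => absurd h (hne x y), fun α β => ?_⟩
  have : CG G (fun _ => (⟨0, by omega⟩ : Fin k)) α β = ⊥ := by
    ext x y; simp [CG, hne]
  rw [this]
  exact isAcyclic_bot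

theorem forest_col [Finite V] {k : ℕ} (hk : 1 ≤ k) (n : ℕ) : ∀ G : SimpleGraph V,
    G.edgeSet.ncard = n → G.IsAcyclic → (∀ v, edeg G v ≤ k) → Col k G := by
  induction n using Nat.strong_induction_on with
  | _ n ihn =>
  intro G hn hac hdeg
  have ih : ∀ H : SimpleGraph V, H ≤ G → H.edgeSet.ncard < G.edgeSet.ncard → Col k H :=
    fun H hle hH => ihn _ (hn ▸ hH) H rfl (IsAcyclic.anti hle hac) (fun v => le_trans
      (Set.ncard_le_ncard (fun _ hx => hle hx) (Set.toFinite _)) (hdeg v))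
  by_cases hne : ∃ x y, G.Adj x y
  swap
  · push Not at hne
    exact empty_col hk hne
  obtain ⟨x, y, hxy⟩ := hne
  have hbr := isBridge_iff.1 (isAcyclic_iff_forall_isBridge.1 hac (e := s(x, y)) hxy)
  let H := G.deleteEdges {s(x, y)}
  have hH : ∀ a b, H.Adj a b ↔ G.Adj a b ∧ ¬ (s(a, b) = s(x, y)) := by
    intro a b; simp [H, deleteEdges_adj]
  let S : Set V := {a | H.Reachable y a}
  have hyS : y ∈ S := Reachable.refl _
  have hxS : x ∉ S := fun h => hbr (Reachable.symm h)
  have hcl : ∀ a ∈ S, ∀ b, G.Adj a b → b ∈ S ∨ b = x := by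
    intro a ha b hab
    by_cases he : s(a, b) = s(x, y)
    · rw [Sym2.eq_iff] at he
      rcases he with ⟨rfl, rfl⟩ | ⟨rfl, rfl⟩
      · exact absurd ha hxS
      · exact Or.inr rfl
    · left
      exact Reachable.trans ha (Adj.reachable ((hH a b).2 ⟨hab, he⟩))
  by_cases h2 : ∃ a b, G.Adj a b ∧ a ∉ S ∧ b ∉ S
  · obtain ⟨a, b, hab, ha, hb⟩ := h2
    have h1 : G1 G S ≤ G := fun _ _ h => h.1
    have h2 : G2 G S ≤ G := fun _ _ h => h.1
    obtain ⟨c₁, hc₁⟩ := ih (G1 G S) h1 (card_lt h1 hab (fun h => by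
      rcases h.2 with h | h
      · exact ha h
      · exact hb h))
    obtain ⟨c₂, hc₂⟩ := ih (G2 G S) h2 (card_lt h2 hxy (fun h => h.2.2 hyS))
    exact glue_col G S x hxS hcl (hdeg x) c₁ c₂ hc₁ hc₂
  · push Not at h2
    refine leaf_ext hdeg hxy ?_ (ih (del G x) (del_le G x)
      (card_lt (del_le G x) hxy (fun h => h.2.1 rfl)))
    intro b hb
    by_contra hby
    have hbS := h2 x b hb hxS
    apply hxS
    refine Reachable.trans hbS (Adj.reachable ((hH b x).2 ⟨hb.symm, ?_⟩))
    rw [Sym2.eq_iff]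
    rintro (⟨rfl, _⟩ | ⟨h, _⟩)
    · exact hxS hbS
    · exact hby h

theorem nat_col {k : ℕ} {G : SimpleGraph V} (h : Col k G) :
    ∃ c : Sym2 V → ℕ, IsAcyclicEdgeColoring G c ∧ ∀ e ∈ G.edgeSet, c e < k := by
  classical
  obtain ⟨c, hc⟩ := h
  refine ⟨fun e => (c e).val, ⟨?_, ?_⟩, fun e _ => (c e).isLt⟩
  · rintro e₁ h1 e₂ h2 hne ⟨v, ⟨a, rfl⟩, ⟨b, rfl⟩⟩ he
    refine hc.1 v a b h1 h2 ?_ (Fin.ext he)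
    rintro rfl; exact hne rfl
  · rintro v w hw ⟨α, β, hαβ⟩
    let a : Fin k := if h : α < k then ⟨α, h⟩ else c s(v, v)
    let b : Fin k := if h : β < k then ⟨β, h⟩ else c s(v, v)
    have hE : ∀ e ∈ w.edges, e ∈ (CG G c a b).edgeSet := by
      intro e he
      have h1 := hαβ e he
      have h2 := w.edges_subset_edgeSet he
      induction e using Sym2.ind with
      | _ x y =>
      refine ⟨h2, ?_⟩
      rcases h1 with h1 | h1
      · left
        have hlt : α < k := h1 ▸ (c s(x, y)).isLt
        simp only [a, hlt, dif_pos]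
        exact Fin.ext h1
      · right
        have hlt : β < k := h1 ▸ (c s(x, y)).isLt
        simp only [b, hlt, dif_pos]
        exact Fin.ext h1
    exact hc.2 a b (w.transfer _ hE) (hw.transfer hE)

theorem cycle_of_deg2 [Finite V] {G : SimpleGraph V} (hconn : G.Connected)
    (hdeg : ∀ v, edeg G v ≤ 2) (hac : ¬ G.IsAcyclic) :
    ∃ n : ℕ, 3 ≤ n ∧ Nonempty (G ≃g SimpleGraph.cycleGraph n) := by
  rw [isAcyclic_iff_free_cycleGraph] at hac
  push Not at hac
  obtain ⟨n, hn, hnf⟩ := hac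
  obtain ⟨φ⟩ := hnf
  refine ⟨n, hn, ?_⟩
  obtain ⟨m, rfl⟩ : ∃ m, n = m + 3 := ⟨n - 3, by omega⟩
  let f := φ.toHom
  have hinj : Function.Injective f := φ.injective'
  have hnb : ∀ i x, G.Adj (f i) x → ∃ j, (cycleGraph (m + 3)).Adj i j ∧ f j = x := by
    intro i x hx
    have h1 : f '' ((cycleGraph (m + 3)).neighborSet i) ⊆ {u | G.Adj (f i) u} := by
      rintro _ ⟨j, hj, rfl⟩
      exact f.map_adj hj
    have h2 : (f '' ((cycleGraph (m + 3)).neighborSet i)).ncard = 2 := by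
      rw [Set.ncard_image_of_injective _ hinj]
      have := cycleGraph_degree_three_le (v := i)
      rw [← this, ← card_neighborSet_eq_degree, Set.ncard_eq_toFinset_card', Set.toFinset_card]
    have h3 := Set.eq_of_subset_of_ncard_le h1 (by rw [h2]; exact hdeg (f i)) (Set.toFinite _)
    have : x ∈ f '' ((cycleGraph (m + 3)).neighborSet i) := by rw [h3]; exact hx
    obtain ⟨j, hj, e⟩ := this
    exact ⟨j, hj, e⟩
  have hsurj : Function.Surjective f := by
    intro x
    refine reach_closed (H := G) (a := f 0) (b := x) (Set.range f) ?_ (hconn.preconnected _ _)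
      ⟨0, rfl⟩
    rintro _ b ⟨i, rfl⟩ hab
    obtain ⟨j, _, e⟩ := hnb i b hab
    exact ⟨j, e⟩
  refine ⟨(SimpleGraph.Iso.symm ⟨Equiv.ofBijective f ⟨hinj, hsurj⟩, ?_⟩)⟩
  intro i j
  constructor
  · intro h
    obtain ⟨j', hj', e⟩ := hnb i (f j) h
    rw [← hinj e]; exact hj'
  · intro h; exact f.map_adj h

end ChL

theorem stmt10 {V : Type*} [Fintype V] (G : SimpleGraph V) [DecidableRel G.Adj]
    (hconn : G.Connected) (hch : Chordless G) :
    (¬ (∃ n : ℕ, 3 ≤ n ∧ Nonempty (G ≃g SimpleGraph.cycleGraph n)) →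
      acyclicChromaticIndex G = G.maxDegree) ∧
    ((∃ n : ℕ, 3 ≤ n ∧ Nonempty (G ≃g SimpleGraph.cycleGraph n)) →
      acyclicChromaticIndex G = G.maxDegree + 1 ∧ G.maxDegree + 1 = 3) := by
  classical
  have hcl := ChL.CL_of_chordless hch
  have hedeg : ∀ v, edeg G v = G.degree v := by
    intro v
    unfold edeg
    rw [← card_neighborSet_eq_degree, ← Set.toFinset_card, ← Set.ncard_eq_toFinset_card']
    rfl
  have hdeg : ∀ v, edeg G v ≤ G.maxDegree := fun v => by
    rw [hedeg]; exact G.degree_le_maxDegree v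
  have hcol3 : ∀ k, 3 ≤ k → G.maxDegree ≤ k → ChL.Col k G := fun k hk hd =>
    ChL.main_col hk _ G rfl ⟨hcl, fun v => (hdeg v).trans hd⟩
  constructor
  · intro hnc
    have hmem : ∃ c : Sym2 V → ℕ, IsAcyclicEdgeColoring G c ∧
        ∀ e ∈ G.edgeSet, c e < G.maxDegree := by
      by_cases h3 : 3 ≤ G.maxDegree
      · exact ChL.nat_col (hcol3 _ h3 le_rfl)
      have hac : G.IsAcyclic := by
        by_contra hac
        exact hnc (ChL.cycle_of_deg2 hconn (fun v => (hdeg v).trans (by omega)) hac)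
      by_cases h1 : 1 ≤ G.maxDegree
      · exact ChL.nat_col (ChL.forest_col h1 _ G rfl hac hdeg)
      · have h0 : G = ⊥ := maxDegree_eq_zero_iff.1 (by omega)
        have hE : ∀ e, e ∉ G.edgeSet := by
          intro e he; rw [h0] at he; simp at he
        refine ⟨fun _ => 0, ⟨fun e he => absurd he (hE e), fun v w hw => ?_⟩,
          fun e he => absurd he (hE e)⟩
        exact absurd hw (hac w)
    unfold acyclicChromaticIndex
    apply le_antisymm
    · exact Nat.sInf_le hmem
    · refine le_csInf ⟨_, hmem⟩ ?_
      rintro n ⟨c, hc, hn⟩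
      have := hconn.nonempty
      obtain ⟨v, hv⟩ := G.exists_maximal_degree_vertex
      rw [hv, ← card_neighborFinset_eq_degree, ← Finset.card_range n]
      refine Finset.card_le_card_of_injOn (fun u => c s(v, u)) ?_ ?_
      · intro u hu
        simp only [Finset.coe_range, Set.mem_Iio]
        exact hn _ (by simpa using hu)
      · intro a ha b hb hab
        by_contra hne
        refine hc.1 s(v, a) (by simpa using ha) s(v, b) (by simpa using hb) ?_
          ⟨v, by simp, by simp⟩ hab
        intro e
        exact hne (Sym2.congr_right.1 e)
  · rintro ⟨n, hn, ⟨φ⟩⟩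
    have hmax : G.maxDegree = 2 := by
      obtain ⟨m, rfl⟩ : ∃ m, n = m + 3 := ⟨n - 3, by omega⟩
      rw [φ.maxDegree_eq]
      apply IsRegularOfDegree.maxDegree_eq
      intro v
      exact cycleGraph_degree_three_le
    refine ⟨?_, by rw [hmax]⟩
    rw [hmax]
    have hmem : ∃ c : Sym2 V → ℕ, IsAcyclicEdgeColoring G c ∧ ∀ e ∈ G.edgeSet, c e < 3 :=
      ChL.nat_col (hcol3 3 le_rfl (by omega))
    unfold acyclicChromaticIndex
    apply le_antisymm
    · exact Nat.sInf_le hmem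
    · refine le_csInf ⟨_, hmem⟩ ?_
      rintro k ⟨c, hc, hk⟩
      by_contra hlt
      have hac : ¬ G.IsAcyclic := by
        intro hac
        exact isAcyclic_iff_free_cycleGraph.1 hac n hn ⟨φ.symm.toHom.toCopy φ.symm.injective⟩
      unfold IsAcyclic at hac
      push Not at hac
      obtain ⟨v, w, hw⟩ := hac
      refine hc.2 v w hw ⟨0, 1, fun e he => ?_⟩
      have := hk e (w.edges_subset_edgeSet he)
      omega
end

section
/- Let G be a chordless graph with maximum degree Δ. Then the linear arboricity la(G) = ⌈Δ/2⌉, unless Δ = 2 and G contains a cycle, in which case la(G) = 2. -/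
open SimpleGraph

def IsLinearForest {α : Type*} (H : SimpleGraph α) : Prop :=
  H.IsAcyclic ∧ ∀ v, edeg H v ≤ 2

noncomputable def linearArboricity {V : Type*} (G : SimpleGraph V) : ℕ :=
  sInf {n | ∃ f : Sym2 V → ℕ, (∀ e ∈ G.edgeSet, f e < n) ∧
    ∀ i, IsLinearForest (SimpleGraph.fromEdgeSet {e | e ∈ G.edgeSet ∧ f e = i})}

namespace LA

lemma isPath_append_of {V : Type*} {H : SimpleGraph V} {u v w : V} {p : H.Walk u v} {q : H.Walk v w}
    (hp : p.IsPath) (hq : q.IsPath) (h : ∀ x ∈ p.support, x ∈ q.support → x = v) :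
    (p.append q).IsPath := by
  rw [Walk.isPath_def, Walk.support_append, List.nodup_append']
  refine ⟨hp.support_nodup, hq.support_nodup.tail, ?_⟩
  intro x hx hx'
  have h1 := h x hx (List.mem_of_mem_tail hx')
  have h2 := hq.support_nodup
  rw [← Walk.cons_tail_support] at h2
  subst h1
  exact (List.nodup_cons.mp h2).1 hx'

lemma lastHit {V : Type*} {H : SimpleGraph V} (S : Set V) {u z : V} (R : H.Walk u z) :
    (∃ x ∈ R.support, x ∈ S) →
    ∃ w, ∃ R' : H.Walk w z, w ∈ S ∧ R'.IsPath ∧ (∀ x ∈ R'.support, x ∈ R.support) ∧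
      ∀ x ∈ R'.support, x ∈ S → x = w := by
  classical
  induction R with
  | nil =>
    rintro ⟨x, hx, hS⟩
    simp only [Walk.support_nil, List.mem_singleton] at hx
    subst hx
    exact ⟨x, Walk.nil, hS, Walk.IsPath.nil, fun y hy => hy, fun y hy _ => by simpa using hy⟩
  | @cons u v z h R ih =>
    rintro ⟨x, hx, hS⟩
    by_cases hR : ∃ x ∈ R.support, x ∈ S
    · obtain ⟨w, R', h1, h2, h3, h4⟩ := ih hR
      exact ⟨w, R', h1, h2, fun y hy => by simp [h3 y hy], h4⟩
    · push Not at hR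
      have hxu : x = u := by
        rw [Walk.support_cons, List.mem_cons] at hx
        rcases hx with rfl | hx
        · rfl
        · exact absurd hS (hR x hx)
      subst hxu
      refine ⟨x, (Walk.cons h R).bypass, hS, Walk.bypass_isPath _,
        fun y hy => Walk.support_bypass_subset_support _ hy, fun y hy hyS => ?_⟩
      have := Walk.support_bypass_subset_support _ hy
      rw [Walk.support_cons, List.mem_cons] at this
      rcases this with rfl | hx
      · rfl
      · exact absurd hyS (hR y hx)

lemma menger_step {V : Type*} {H : SimpleGraph V} {b z' z w : V} (p q : H.Walk b z')
    (hp : p.IsPath) (hq : q.IsPath)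
    (hd : ∀ x ∈ p.support, x ∈ q.support → x = b ∨ x = z')
    (hzz : H.Adj z' z) (hzb : z ≠ b) (R : H.Walk w z) (hR : R.IsPath) (hw : w ∈ p.support)
    (hz' : z' ∉ R.support)
    (hRS : ∀ x ∈ R.support, x ∈ p.support ∨ x ∈ q.support → x = w) :
    ∃ p q : H.Walk b z, p.IsPath ∧ q.IsPath ∧
      ∀ x ∈ p.support, x ∈ q.support → x = b ∨ x = z := by
  classical
  have hwz : w ≠ z' := fun h => hz' (h ▸ R.start_mem_support)
  have hzR := R.end_mem_support
  have hsub : ∀ x ∈ (p.takeUntil w hw).support, x ∈ p.support :=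
    fun x hx => p.support_takeUntil_subset_support hw hx
  have hnot : z' ∉ (p.takeUntil w hw).support :=
    Walk.endpoint_notMem_support_takeUntil hp hw hwz.symm
  have hzq : z ∉ q.support := by
    intro hz
    have h1 := hRS z hzR (Or.inr hz)
    rcases hd z (h1 ▸ hw) hz with h | h
    · exact hzb h
    · exact hwz (h1 ▸ h)
  refine ⟨(p.takeUntil w hw).append R, q.concat hzz, ?_, hq.concat hzq hzz, ?_⟩
  · exact isPath_append_of (hp.takeUntil hw) hR (fun x hx hx' => hRS x hx' (Or.inl (hsub x hx)))
  · intro x hx hx'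
    rw [Walk.mem_support_append_iff] at hx
    rw [Walk.support_concat, List.mem_append, List.mem_singleton] at hx'
    rcases hx' with hx' | hx'
    · rcases hx with hx | hx
      · rcases hd x (hsub x hx) hx' with h | h
        · exact Or.inl h
        · exact absurd hx (h ▸ hnot)
      · have := hRS x hx (Or.inr hx')
        subst this
        rcases hd x hw hx' with h | h
        · exact Or.inl h
        · exact absurd h hwz
    · exact Or.inr hx'

lemma menger {V : Type*} {H : SimpleGraph V} {z b : V} (P : H.Walk z b) (hP : P.IsPath)
    (hzb : z ≠ b) (hns : ∀ c, c ≠ b → c ≠ z → ∃ w : H.Walk b z, c ∉ w.support) :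
    ∃ p q : H.Walk b z, p.IsPath ∧ q.IsPath ∧
      ∀ x ∈ p.support, x ∈ q.support → x = b ∨ x = z := by
  classical
  induction P with
  | nil => exact absurd rfl hzb
  | @cons z z' b h P ih =>
    rw [Walk.cons_isPath_iff] at hP
    by_cases hz'b : z' = b
    · subst hz'b
      refine ⟨h.symm.toWalk, h.symm.toWalk, h.symm.isPath_toWalk, h.symm.isPath_toWalk, ?_⟩
      intro x hx _
      simpa using hx
    · obtain ⟨p, q, hp, hq, hd⟩ := ih hP.1 hz'b (by
        intro c hcb hcz'
        by_cases hcz : c = z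
        · subst hcz
          exact ⟨P.reverse, by simpa using hP.2⟩
        · obtain ⟨w, hw⟩ := hns c hcb hcz
          refine ⟨w.concat h, ?_⟩
          rw [Walk.support_concat, List.mem_append, List.mem_singleton]
          tauto)
      obtain ⟨R, hR⟩ := hns z' hz'b h.ne'
      obtain ⟨w, R', h1, h2, h3, h4⟩ := lastHit {x | x ∈ p.support ∨ x ∈ q.support} R
        ⟨b, R.start_mem_support, Or.inl p.start_mem_support⟩
      have hz' : z' ∉ R'.support := fun hh => hR (h3 _ hh)
      rcases h1 with h1 | h1
      · exact menger_step p q hp hq hd h.symm hzb R' h2 h1 hz' h4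
      · exact menger_step q p hq hp (fun x hx hx' => hd x hx' hx) h.symm hzb R' h2 h1 hz'
          (fun x hx hh => h4 x hx hh.symm)

lemma sep {V : Type*} {G : SimpleGraph V} (hch : Chordless G) {b b' : V} (hbb : G.Adj b b') :
    (∃ X : Set V, b ∈ X ∧ b' ∉ X ∧ ∀ a ∈ X, ∀ x ∉ X, G.Adj a x → a = b ∧ x = b') ∨
    (∃ (X : Set V) (c : V), b ∈ X ∧ b' ∉ X ∧ c ∉ X ∧ c ≠ b' ∧
      ∀ a ∈ X, ∀ x ∉ X, G.Adj a x → x = c ∨ (a = b ∧ x = b')) := by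
  classical
  set H := G.deleteEdges {s(b, b')} with hH
  have hHadj : ∀ a x, G.Adj a x → ¬ (a = b ∧ x = b') → ¬ (a = b' ∧ x = b) → H.Adj a x := by
    intro a x h1 h2 h3
    rw [hH, deleteEdges_adj]
    refine ⟨h1, ?_⟩
    simp only [Set.mem_singleton_iff, Sym2.eq_iff]
    tauto
  have hHn : ¬ H.Adj b b' := by simp [hH]
  by_cases hr : H.Reachable b b'
  · right
    by_cases hns : ∀ c, c ≠ b → c ≠ b' → ∃ w : H.Walk b b', c ∉ w.support
    · exfalso
      obtain ⟨P, hP⟩ := hr.symm.exists_isPath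
      obtain ⟨p, q, hp, hq, hd⟩ := menger P hP hbb.ne' hns
      have hlen : 1 < p.length := by
        by_contra hl
        have : p.length = 0 ∨ p.length = 1 := by omega
        rcases this with h | h
        · exact hbb.ne (Walk.eq_of_length_eq_zero h)
        · exact hHn (Walk.adj_of_length_eq_one h)
      refine hch b b' hbb ⟨b, p.append q.reverse, ?_, ?_, ?_⟩
      · refine hp.isCycle_append hq.reverse ?_ (Or.inl hlen)
        intro x hx hx'
        have hxp := List.mem_of_mem_tail hx
        have hxq := List.mem_of_mem_tail hx'
        rw [Walk.support_reverse, List.mem_reverse] at hxq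
        have n1 := hp.support_nodup
        rw [← Walk.cons_tail_support] at n1
        have n2 := hq.reverse.support_nodup
        rw [← Walk.cons_tail_support] at n2
        rcases hd x hxp hxq with rfl | rfl
        · exact (List.nodup_cons.mp n1).1 hx
        · exact (List.nodup_cons.mp n2).1 hx'
      · simp
      · simp
    · push Not at hns
      obtain ⟨c, hcb, hcb', hc⟩ := hns
      refine ⟨{x | ∃ w : H.Walk b x, c ∉ w.support}, c, ⟨Walk.nil, by simpa using hcb⟩, ?_, ?_, hcb', ?_⟩
      · rintro ⟨w, hw⟩; exact hw (hc w)
      · rintro ⟨w, hw⟩; exact hw w.end_mem_support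
      · rintro a ⟨w, hw⟩ x hx hax
        by_contra hcon
        push Not at hcon
        by_cases h2 : a = b' ∧ x = b
        · obtain ⟨rfl, rfl⟩ := h2; exact hw (hc w)
        refine hx ⟨w.concat (hHadj a x hax (by tauto) h2), ?_⟩
        rw [Walk.support_concat, List.mem_append, List.mem_singleton]
        have := hcon.1
        tauto
  · left
    refine ⟨{x | H.Reachable b x}, Reachable.refl _, hr, ?_⟩
    intro a ha x hx hax
    by_contra hcon
    by_cases h2 : a = b' ∧ x = b
    · obtain ⟨rfl, rfl⟩ := h2; exact hr ha
    · exact hx (ha.trans (hHadj a x hax hcon h2).reachable)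

def Bdy {V : Type*} (G : SimpleGraph V) (A : Set V) (p y c : V) : Prop :=
  y ∉ A ∧ c ∉ A ∧ (∀ a ∈ A, ∀ x ∉ A, G.Adj a x → x = c ∨ (a = p ∧ x = y)) ∧
    (∀ S : Set V, y ∈ S → c ∉ S → (∀ s ∈ S, s ∉ A) →
      ∃ s ∈ S, ∃ t, t ∉ S ∧ t ∉ A ∧ G.Adj s t)

lemma chord4 {V : Type*} {G : SimpleGraph V} (hch : Chordless G) {p c v v' : V}
    (hpc : G.Adj p c) (h1 : G.Adj p v) (h2 : G.Adj p v') (h3 : G.Adj c v) (h4 : G.Adj c v')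
    (hvv : v ≠ v') : False := by
  set H := G.deleteEdges {s(p, c)} with hH
  have k1 : H.Adj p v := by
    simp only [hH, deleteEdges_adj, Set.mem_singleton_iff, Sym2.eq_iff]
    exact ⟨h1, by grind [h3.ne]⟩
  have k2 : H.Adj v c := by
    simp only [hH, deleteEdges_adj, Set.mem_singleton_iff, Sym2.eq_iff]
    exact ⟨h3.symm, by grind [h1.ne]⟩
  have k3 : H.Adj c v' := by
    simp only [hH, deleteEdges_adj, Set.mem_singleton_iff, Sym2.eq_iff]
    exact ⟨h4, by grind [h2.ne]⟩
  have k4 : H.Adj v' p := by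
    simp only [hH, deleteEdges_adj, Set.mem_singleton_iff, Sym2.eq_iff]
    exact ⟨h2.symm, by grind [h4.ne]⟩
  refine hch p c hpc ⟨p, Walk.cons k1 (Walk.cons k2 (Walk.cons k3 (Walk.cons k4 Walk.nil))), ?_, ?_, ?_⟩
  · rw [Walk.cons_isCycle_iff]
    constructor
    · simp [Walk.isPath_def]
      grind [h1.ne, h2.ne, h3.ne, h4.ne, hpc.ne]
    · simp
      grind [h1.ne, h2.ne, h3.ne, h4.ne, hpc.ne]
  · simp
  · simp

set_option maxHeartbeats 1000000 in
lemma struct {V : Type*} [Finite V] {G : SimpleGraph V} (hch : Chordless G) (B : Set V)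
    (hne : B.Nonempty)
    (h1 : ∀ b ∈ B, ∃ x y, x ≠ y ∧ x ∈ B ∧ y ∈ B ∧ G.Adj b x ∧ G.Adj b y)
    (h2 : ∀ v ∉ B, ∀ a, G.Adj v a → a ∈ B ∧ ∃ a', a' ≠ a ∧ G.Adj v a')
    (h3 : ∀ b ∈ B, (∃ x y, x ≠ y ∧ x ∉ B ∧ y ∉ B ∧ G.Adj b x ∧ G.Adj b y) ∨
      (∃ x y z, x ≠ y ∧ x ≠ z ∧ y ≠ z ∧ x ∈ B ∧ y ∈ B ∧ z ∈ B ∧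
        G.Adj b x ∧ G.Adj b y ∧ G.Adj b z)) : False := by
  classical
  have main : ∀ n : ℕ, ∀ A : Set V, A.ncard = n → ∀ p y c, Bdy G A p y c → ∀ b0 ∈ A, b0 ∈ B → False := by
    intro n
    induction n using Nat.strong_induction_on with
    | _ n ih =>
    intro A hA p y c hbd b0 hb0A hb0B
    obtain ⟨hyA, hcA, hbdy, hconn⟩ := hbd
    -- find an edge inside
    have hedge : ∃ b b', b ∈ A ∧ b' ∈ A ∧ b ∈ B ∧ b' ∈ B ∧ G.Adj b b' := by
      by_contra hno
      push Not at hno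
      have hp : ∀ b ∈ A, b ∈ B → b = p ∧ y ∈ B ∧ c ∈ B ∧ G.Adj b y ∧ G.Adj b c ∧ y ≠ c := by
        intro b hbA hbB
        obtain ⟨x, x', hne, hx, hx', hax, hax'⟩ := h1 b hbB
        have e1 : x ∉ A := fun h => hno b x hbA h hbB hx hax
        have e2 : x' ∉ A := fun h => hno b x' hbA h hbB hx' hax'
        have f1 := hbdy b hbA x e1 hax
        have f2 := hbdy b hbA x' e2 hax'
        grind
      obtain ⟨rfl, hyB, hcB, hpy, hpc, hyc⟩ := hp b0 hb0A hb0B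
      have hD : ∀ v, v ∉ B → G.Adj b0 v → G.Adj c v := by
        intro v hv hbv
        have hvA : v ∈ A := by
          by_contra hvA
          rcases hbdy b0 hb0A v hvA hbv with h | h
          · exact hv (h ▸ hcB)
          · exact hv (h.2 ▸ hyB)
        obtain ⟨-, a', ha', hva'⟩ := h2 v hv b0 hbv.symm
        have ha'B := (h2 v hv a' hva').1
        have ha'A : a' ∉ A := fun h => ha' (hp a' h ha'B).1
        rcases hbdy v hvA a' ha'A hva' with h | h
        · exact h ▸ hva'.symm
        · exact absurd h.1 hbv.ne'
      rcases h3 b0 hb0B with ⟨v, v', hvv, hv, hv', hbv, hbv'⟩ | ⟨x, x', x'', n1, n2, n3, m1, m2, m3, a1, a2, a3⟩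
      · exact chord4 hch hpc hbv hbv' (hD v hv hbv) (hD v' hv' hbv') hvv
      · have g1 := hbdy b0 hb0A x (fun h => hno b0 x hb0A h hb0B m1 a1) a1
        have g2 := hbdy b0 hb0A x' (fun h => hno b0 x' hb0A h hb0B m2 a2) a2
        have g3 := hbdy b0 hb0A x'' (fun h => hno b0 x'' hb0A h hb0B m3 a3) a3
        grind
    obtain ⟨b, b', hbA, hb'A, hbB, hb'B, hbb⟩ := hedge
    have hlt : ∀ A' : Set V, A' ⊆ A → ∀ x ∈ A, x ∉ A' → A'.ncard < n := by
      intro A' hs x hx hx'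
      rw [← hA]
      exact Set.ncard_lt_ncard ⟨hs, fun h => hx' (h hx)⟩ (Set.toFinite _)
    -- bridge step
    have hbr : ∀ b b' : V, b ∈ A → b' ∈ A → b ∈ B → G.Adj b b' → ∀ X : Set V, b ∈ X → b' ∉ X →
        y ∉ X → c ∉ X → (∀ a ∈ X, ∀ x ∉ X, G.Adj a x → a = b ∧ x = b') → False := by
      intro b b' hbA hb'A hbB hbb X hbX hb'X hyX hcX hX
      refine ih _ (hlt (X ∩ A) Set.inter_subset_right b' hb'A (fun h => hb'X h.1)) (X ∩ A) rfl
        b b' b' ⟨fun h => hb'X h.1, fun h => hb'X h.1, ?_, ?_⟩ b ⟨hbX, hbA⟩ hbB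
      · rintro a ⟨haX, haA⟩ x hx hax
        by_cases hxX : x ∈ X
        · have hxA : x ∉ A := fun h => hx ⟨hxX, h⟩
          rcases hbdy a haA x hxA hax with h | h
          · exact absurd (h ▸ hxX) hcX
          · exact absurd (h.2 ▸ hxX) hyX
        · exact Or.inl (hX a haX x hxX hax).2
      · intro S hS hS'; exact absurd hS hS'
    have hnobr : ∀ b b' : V, b ∈ A → b' ∈ A → b ∈ B → b' ∈ B → G.Adj b b' → ∀ X : Set V, b ∈ X → b' ∉ X →
        (∀ a ∈ X, ∀ x ∉ X, G.Adj a x → a = b ∧ x = b') → False := by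
      intro b b' hbA hb'A hbB hb'B hbb X hbX hb'X hX
      by_cases hyX : y ∈ X <;> by_cases hcX : c ∈ X
      · refine hbr b' b hb'A hbA hb'B hbb.symm Xᶜ hb'X (by simpa using hbX) (by simpa using hyX)
          (by simpa using hcX) ?_
        intro a ha x hx hax
        exact (hX x (by simpa using hx) a ha hax.symm).symm
      · obtain ⟨s, hs, t, ht, htA, hst⟩ := hconn (X \ A) ⟨hyX, hyA⟩ (fun h => hcX h.1) (fun s hs => hs.2)
        have : t ∉ X := fun h => ht ⟨h, htA⟩
        exact hs.2 ((hX s hs.1 t this hst).1 ▸ hbA)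
      · obtain ⟨s, hs, t, ht, htA, hst⟩ := hconn (Xᶜ \ A) ⟨hyX, hyA⟩ (fun h => h.1 hcX) (fun s hs => hs.2)
        have : t ∈ X := by by_contra h; exact ht ⟨h, htA⟩
        exact htA ((hX t this s hs.1 hst.symm).1 ▸ hbA)
      · exact hbr b b' hbA hb'A hbB hbb X hbX hb'X hyX hcX hX
    have hfin : ∀ b b' : V, b ∈ A → b' ∈ A → b ∈ B → b' ∈ B → G.Adj b b' → ∀ (A' : Set V) (c' : V),
        A' ⊆ A → b ∈ A' → b' ∉ A' → c' ∉ A' →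
        (∀ a ∈ A', ∀ x ∉ A', G.Adj a x → x = c' ∨ (a = b ∧ x = b')) → False := by
      intro b b' hbA hb'A hbB hb'B hbb A' c' hs hb hb' hc' hA'
      refine ih _ (hlt A' hs b' hb'A hb') A' rfl b b' c' ⟨hb', hc', hA', ?_⟩ b hb hbB
      intro S hS hcS hSA
      by_contra hno
      push Not at hno
      refine hnobr b' b hb'A hbA hb'B hbB hbb.symm S hS (fun h => hSA b h hb) ?_
      intro a ha x hx hax
      have hxA' : x ∈ A' := by
        by_contra h
        exact hno a ha x hx h hax
      rcases hA' x hxA' a (hSA a ha) hax.symm with h | h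
      · exact absurd (h ▸ ha) hcS
      · exact h.symm
    have hsep : ∀ b b' : V, b ∈ A → b' ∈ A → b ∈ B → b' ∈ B → G.Adj b b' → ∀ (X Y : Set V) (c' : V),
        b ∈ X → b' ∈ Y → c' ∉ X → c' ∉ Y → (∀ v ∈ X, v ∉ Y) → (∀ v, v ∈ X ∨ v ∈ Y ∨ v = c') →
        (∀ a ∈ X, ∀ x ∈ Y, G.Adj a x → a = b ∧ x = b') →
        ((y ∉ X ∧ c ∉ X) ∨ (c ∈ X ∧ y ∈ Y)) → False := by
      intro b b' hbA hb'A hbB hb'B hbb X Y c' hbX hb'Y hcX' hcY' hXY hcov hed hcase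
      have hb'X : b' ∉ X := fun h => hXY b' h hb'Y
      rcases hcase with ⟨hyX, hcX⟩ | ⟨hcX, hyY⟩
      · refine hfin b b' hbA hb'A hbB hb'B hbb (X ∩ A) c' Set.inter_subset_right ⟨hbX, hbA⟩
          (fun h => hb'X h.1) (fun h => hcX' h.1) ?_
        rintro a ⟨haX, haA⟩ x hx hax
        by_cases hxX : x ∈ X
        · have hxA : x ∉ A := fun h => hx ⟨hxX, h⟩
          rcases hbdy a haA x hxA hax with h | h
          · exact absurd (h ▸ hxX) hcX
          · exact absurd (h.2 ▸ hxX) hyX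
        · rcases hcov x with h | h | h
          · exact absurd h hxX
          · exact Or.inr (hed a haX x h hax)
          · exact Or.inl h
      · have hcA' : c' ∉ A := by
          intro hc'A
          obtain ⟨s, hs, t, ht, htA, hst⟩ := hconn (Y \ A) ⟨hyY, hyA⟩ (fun h => hXY c hcX h.1) (fun s hs => hs.2)
          rcases hcov t with h | h | h
          · exact hs.2 ((hed t h s hs.1 hst.symm).2 ▸ hb'A)
          · exact ht ⟨h, htA⟩
          · exact htA (h ▸ hc'A)
        refine hfin b b' hbA hb'A hbB hb'B hbb (X ∩ A) c Set.inter_subset_right ⟨hbX, hbA⟩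
          (fun h => hb'X h.1) (fun h => hcA h.2) ?_
        rintro a ⟨haX, haA⟩ x hx hax
        by_cases hxA : x ∈ A
        · rcases hcov x with h | h | h
          · exact absurd ⟨h, hxA⟩ hx
          · exact Or.inr (hed a haX x h hax)
          · exact absurd (h ▸ hxA) hcA'
        · rcases hbdy a haA x hxA hax with h | h
          · exact Or.inl h
          · have := hed a haX x (h.2 ▸ hyY) hax
            exact absurd (this.2 ▸ hb'A) hxA
    rcases sep hch hbb with ⟨X, hbX, hb'X, hX⟩ | ⟨X, c', hbX, hb'X, hcX', hcb', hX⟩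
    · exact hnobr b b' hbA hb'A hbB hb'B hbb X hbX hb'X hX
    · set Y : Set V := {v | v ∉ X ∧ v ≠ c'} with hY
      have e1 : ∀ v ∈ X, v ∉ Y := fun v hv h => h.1 hv
      have e2 : ∀ v, v ∈ X ∨ v ∈ Y ∨ v = c' := by
        intro v
        by_cases hv : v ∈ X
        · exact Or.inl hv
        · by_cases hv' : v = c'
          · exact Or.inr (Or.inr hv')
          · exact Or.inr (Or.inl ⟨hv, hv'⟩)
      have e3 : ∀ a ∈ X, ∀ x ∈ Y, G.Adj a x → a = b ∧ x = b' := by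
        intro a ha x hx hax
        rcases hX a ha x hx.1 hax with h | h
        · exact absurd h hx.2
        · exact h
      have hcY' : c' ∉ Y := fun h => h.2 rfl
      have hb'Y : b' ∈ Y := ⟨hb'X, hcb'.symm⟩
      have L := hsep b b' hbA hb'A hbB hb'B hbb X Y c' hbX hb'Y hcX' hcY' e1 e2 e3
      have R := hsep b' b hb'A hbA hb'B hbB hbb.symm Y X c' hb'Y hbX hcY' hcX'
        (fun v hv h => e1 v h hv) (fun v => by have := e2 v; tauto)
        (fun a ha x hx hax => (e3 x hx a ha hax.symm).symm)
      by_cases u1 : y ∉ X ∧ c ∉ X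
      · exact L (Or.inl u1)
      by_cases u2 : y ∉ Y ∧ c ∉ Y
      · exact R (Or.inl u2)
      by_cases hyX : y ∈ X
      · have hcY : c ∈ Y := by
          by_contra h
          exact u2 ⟨e1 y hyX, h⟩
        exact R (Or.inr ⟨hcY, hyX⟩)
      · have hcX : c ∈ X := by
          by_contra h
          exact u1 ⟨hyX, h⟩
        have hyY : y ∈ Y := by
          by_contra h
          exact u2 ⟨h, e1 c hcX⟩
        exact L (Or.inr ⟨hcX, hyY⟩)
  obtain ⟨b, hb⟩ := hne
  obtain ⟨x, -, -, hx, -, hbx, -⟩ := h1 b hb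
  refine main _ {b}ᶜ rfl b b b ⟨by simp, by simp, ?_, ?_⟩ x (by simpa using hbx.ne') hx
  · intro a _ z hz _
    left; simpa using hz
  · intro S hS hS'; exact absurd hS hS'

def cls {V : Type*} (G : SimpleGraph V) (f : Sym2 V → ℕ) (i : ℕ) : SimpleGraph V :=
  SimpleGraph.fromEdgeSet {e | e ∈ G.edgeSet ∧ f e = i}

def Col {V : Type*} (k : ℕ) (G : SimpleGraph V) (f : Sym2 V → ℕ) : Prop :=
  (∀ e ∈ G.edgeSet, f e < k) ∧ ∀ i, IsLinearForest (cls G f i)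

lemma cls_adj {V : Type*} {G : SimpleGraph V} {f : Sym2 V → ℕ} {i : ℕ} {u v : V} :
    (cls G f i).Adj u v ↔ G.Adj u v ∧ f s(u, v) = i := by
  simp only [cls, fromEdgeSet_adj, Set.mem_ofPred_eq, mem_edgeSet]
  constructor
  · exact fun h => h.1
  · exact fun h => ⟨h, h.1.ne⟩

lemma cls_le {V : Type*} (G : SimpleGraph V) (f : Sym2 V → ℕ) (i : ℕ) : cls G f i ≤ G :=
  fun _ _ h => (cls_adj.mp h).1

lemma edeg_mono {V : Type*} [Finite V] {H H' : SimpleGraph V} (h : H ≤ H') (v : V) :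
    edeg H v ≤ edeg H' v :=
  Set.ncard_le_ncard (fun _ hu => h hu) (Set.toFinite _)

lemma LF_mono {V : Type*} [Finite V] {H H' : SimpleGraph V} (h : H ≤ H') (hf : IsLinearForest H') :
    IsLinearForest H :=
  ⟨hf.1.anti h, fun v => (edeg_mono h v).trans (hf.2 v)⟩

lemma cls_mono {V : Type*} {G G' : SimpleGraph V} (h : G' ≤ G) (f : Sym2 V → ℕ) (i : ℕ) :
    cls G' f i ≤ cls G f i := by
  intro u v huv
  rw [cls_adj] at huv ⊢
  exact ⟨h huv.1, huv.2⟩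

lemma Col.mono {V : Type*} [Finite V] {k : ℕ} {G G' : SimpleGraph V} {f : Sym2 V → ℕ}
    (hf : Col k G f) (h : G' ≤ G) : Col k G' f :=
  ⟨fun e he => hf.1 e (edgeSet_subset_edgeSet.mpr h he), fun i => LF_mono (cls_mono h f i) (hf.2 i)⟩

lemma edeg_sup_edge_left {V : Type*} [Finite V] (H : SimpleGraph V) (u v : V) :
    edeg (H ⊔ edge u v) u ≤ edeg H u + 1 := by
  refine (Set.ncard_le_ncard (t := insert v {x | H.Adj u x}) ?_ (Set.toFinite _)).trans
    (Set.ncard_insert_le _ _)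
  intro x hx
  simp only [Set.mem_ofPred_eq, sup_adj, edge_adj, Set.mem_insert_iff] at hx ⊢
  grind

lemma edeg_sup_edge_right {V : Type*} [Finite V] (H : SimpleGraph V) (u v : V) :
    edeg (H ⊔ edge u v) v ≤ edeg H v + 1 := by
  rw [edge_comm]; exact edeg_sup_edge_left H v u

lemma edeg_sup_edge_ne {V : Type*} (H : SimpleGraph V) {u v x : V} (h1 : x ≠ u)
    (h2 : x ≠ v) : edeg (H ⊔ edge u v) x = edeg H x := by
  unfold edeg
  congr 1
  ext y
  simp only [Set.mem_ofPred_eq, sup_adj, edge_adj]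
  grind

lemma cls_add_self {V : Type*} [DecidableEq V] {G0 : SimpleGraph V} {f : Sym2 V → ℕ} {u v : V} (hne : u ≠ v)
    (hna : ¬ G0.Adj u v) (i : ℕ) :
    cls (G0 ⊔ edge u v) (Function.update f s(u, v) i) i = cls G0 f i ⊔ edge u v := by
  ext x y
  simp only [cls_adj, sup_adj, edge_adj]
  by_cases h : s(x, y) = s(u, v)
  · rw [h, Function.update_self]
    rw [Sym2.eq_iff] at h
    grind
  · rw [Function.update_of_ne h]
    rw [Sym2.eq_iff] at h
    grind

lemma cls_add_ne {V : Type*} [DecidableEq V] {G0 : SimpleGraph V} {f : Sym2 V → ℕ} {u v : V}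
    (hna : ¬ G0.Adj u v) {i j : ℕ} (hij : j ≠ i) :
    cls (G0 ⊔ edge u v) (Function.update f s(u, v) i) j = cls G0 f j := by
  ext x y
  simp only [cls_adj, sup_adj, edge_adj]
  by_cases h : s(x, y) = s(u, v)
  · rw [h, Function.update_self]
    rw [Sym2.eq_iff] at h
    have := G0.adj_comm u v
    grind
  · rw [Function.update_of_ne h]
    rw [Sym2.eq_iff] at h
    grind

lemma Col.add {V : Type*} [Finite V] [DecidableEq V] {k : ℕ} {G0 : SimpleGraph V} {f : Sym2 V → ℕ}
    (hf : Col k G0 f) {u v : V} (hne : u ≠ v) (hna : ¬ G0.Adj u v) {i : ℕ} (hi : i < k)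
    (hu : edeg (cls G0 f i) u ≤ 1) (hv : edeg (cls G0 f i) v ≤ 1)
    (hr : ¬ (cls G0 f i).Reachable u v) :
    Col k (G0 ⊔ edge u v) (Function.update f s(u, v) i) := by
  constructor
  · intro e he
    by_cases h : e = s(u, v)
    · rw [h, Function.update_self]; exact hi
    · rw [Function.update_of_ne h]
      refine hf.1 e ?_
      induction e with
      | _ x y =>
        simp only [mem_edgeSet, sup_adj, edge_adj] at he ⊢
        rw [Sym2.eq_iff] at h
        grind
  · intro j
    by_cases hij : j = i
    · subst hij
      rw [cls_add_self hne hna]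
      refine ⟨(hf.2 j).1.sup_edge_of_not_reachable hr, fun x => ?_⟩
      by_cases h1 : x = u
      · subst h1; exact (edeg_sup_edge_left _ _ _).trans (by omega)
      by_cases h2 : x = v
      · subst h2; exact (edeg_sup_edge_right _ _ _).trans (by omega)
      rw [edeg_sup_edge_ne _ h1 h2]
      exact (hf.2 j).2 x
    · rw [cls_add_ne hna hij]
      exact hf.2 j

lemma edeg_sum {V : Type*} [Finite V] {k : ℕ} {G : SimpleGraph V} {f : Sym2 V → ℕ}
    (hf : ∀ e ∈ G.edgeSet, f e < k) (a : V) :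
    edeg G a = ∑ i ∈ Finset.range k, edeg (cls G f i) a := by
  classical
  have := Fintype.ofFinite V
  have e1 : ∀ H : SimpleGraph V, edeg H a = (Finset.univ.filter (fun u => H.Adj a u)).card := by
    intro H
    unfold edeg
    rw [Set.ncard_eq_toFinset_card']
    congr 1
    ext; simp
  rw [e1, Finset.card_eq_sum_card_fiberwise (f := fun u => f s(a, u)) (t := Finset.range k)]
  · refine Finset.sum_congr rfl fun i _ => ?_
    rw [e1]
    congr 1
    ext u
    simp [cls_adj]
  · intro u hu
    simp only [Finset.coe_filter, Finset.mem_univ, true_and, Set.mem_ofPred_eq] at hu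
    simpa using hf _ hu

lemma Col.le {V : Type*} [Finite V] {k : ℕ} {G : SimpleGraph V} {f : Sym2 V → ℕ}
    (hf : Col k G f) (a : V) : edeg G a ≤ 2 * k := by
  rw [edeg_sum hf.1 a]
  refine (Finset.sum_le_card_nsmul _ _ 2 (fun i _ => (hf.2 i).2 a)).trans ?_
  simp [mul_comm]

lemma Col.slack {V : Type*} [Finite V] {k : ℕ} {G : SimpleGraph V} {f : Sym2 V → ℕ}
    (hf : Col k G f) (a : V) (ha : edeg G a < 2 * k) : ∃ i < k, edeg (cls G f i) a ≤ 1 := by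
  by_contra hno
  push Not at hno
  rw [edeg_sum hf.1 a] at ha
  have := Finset.card_nsmul_le_sum (Finset.range k) (fun i => edeg (cls G f i) a) 2
    (fun i hi => hno i (by simpa using hi))
  simp at this
  omega

lemma Col.tight {V : Type*} [Finite V] {k : ℕ} {G : SimpleGraph V} {f : Sym2 V → ℕ}
    (hf : Col k G f) (a : V) (i : ℕ) (h1 : 1 ≤ edeg (cls G f i) a)
    (h2 : ∀ j < k, j ≠ i → 2 ≤ edeg (cls G f j) a) (hi : i < k) : 2 * k ≤ edeg G a + 1 := by
  rw [edeg_sum hf.1 a]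
  rw [← Finset.add_sum_erase _ _ (Finset.mem_range.mpr hi)]
  have := Finset.card_nsmul_le_sum ((Finset.range k).erase i) (fun i => edeg (cls G f i) a) 2
    (fun j hj => by
      rw [Finset.mem_erase, Finset.mem_range] at hj
      exact h2 j hj.2 hj.1)
  rw [Finset.card_erase_of_mem (Finset.mem_range.mpr hi)] at this
  simp at this
  omega

lemma not_reach_of_isolated {V : Type*} {H : SimpleGraph V} {v b : V} (hv : ∀ x, ¬ H.Adj v x)
    (hb : v ≠ b) : ¬ H.Reachable v b := by
  rintro ⟨w⟩
  cases w with
  | nil => exact hb rfl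
  | cons h _ => exact hv _ h

lemma edeg_isolated {V : Type*} {H : SimpleGraph V} {v : V} (hv : ∀ x, ¬ H.Adj v x) :
    edeg H v = 0 := by
  unfold edeg
  have : {u | H.Adj v u} = ∅ := by ext x; simp [hv x]
  rw [this, Set.ncard_empty]

lemma reach_contract {V : Type*} {H : SimpleGraph V} {v a : V} (hv : ∀ x, ¬ H.Adj v x)
    {x b : V} (w : (H ⊔ edge v a).Walk x b) (hb : b ≠ v) :
    (x = v → H.Reachable a b) ∧ (x ≠ v → H.Reachable x b) := by
  induction w with
  | nil => exact ⟨fun h => absurd h hb, fun _ => Reachable.refl _⟩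
  | @cons x y b h w ih =>
    have ih := ih hb
    simp only [sup_adj, edge_adj] at h
    rcases h with h | ⟨⟨rfl, rfl⟩ | ⟨rfl, rfl⟩, hne⟩
    · have hx : x ≠ v := fun e => hv y (e ▸ h)
      have hy : y ≠ v := fun e => hv x (e ▸ h.symm)
      exact ⟨fun e => absurd e hx, fun _ => h.reachable.trans (ih.2 hy)⟩
    · exact ⟨fun _ => ih.2 hne.symm, fun e => absurd rfl e⟩
    · exact ⟨fun e => absurd e hne, fun _ => ih.1 rfl⟩

lemma three_leaves_aux {V : Type*} [Finite V] {H : SimpleGraph V} (h2 : ∀ v, edeg H v ≤ 2)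
    {a b v : V} (p : H.Walk a b) (hb : edeg H b ≤ 1) (hv : edeg H v ≤ 1) :
    ∀ (x : V) (q : H.Walk a v), H.Adj x a → p.IsPath → x ∉ p.support → q.IsPath → x ∉ q.support →
      b = v := by
  have two : ∀ {a x y z : V}, H.Adj a x → H.Adj a y → H.Adj a z → x ≠ y → x ≠ z → y = z := by
    intro a x y z hx hy hz hxy hxz
    by_contra hyz
    have : ({x, y, z} : Set V).ncard ≤ edeg H a :=
      Set.ncard_le_ncard (by rintro t (rfl | rfl | rfl) <;> assumption) (Set.toFinite _)
    rw [Set.ncard_eq_three.mpr ⟨x, y, z, hxy, hxz, hyz, rfl⟩] at this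
    have := h2 a
    omega
  have one : ∀ {a x y : V}, edeg H a ≤ 1 → H.Adj a x → H.Adj a y → x = y := by
    intro a x y ha hx hy
    by_contra hxy
    have : ({x, y} : Set V).ncard ≤ edeg H a :=
      Set.ncard_le_ncard (by rintro t (rfl | rfl) <;> assumption) (Set.toFinite _)
    rw [Set.ncard_pair hxy] at this
    omega
  induction p with
  | nil =>
    intro x q hxa _ _ hq hxq
    cases q with
    | nil => rfl
    | cons h q =>
      exfalso
      have := one hb hxa.symm h
      subst this
      simp at hxq
  | @cons a c b h p ih =>
    intro x q hxa hp hxp hq hxq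
    cases q with
    | nil =>
      exfalso
      have := one hv hxa.symm h
      subst this
      simp at hxp
    | @cons _ d _ h' q =>
      rw [Walk.cons_isPath_iff] at hp hq
      simp only [Walk.support_cons, List.mem_cons, not_or] at hxp hxq
      have hc : x ≠ c := fun e => hxp.2 (e ▸ p.start_mem_support)
      have hd : x ≠ d := fun e => hxq.2 (e ▸ q.start_mem_support)
      have := two hxa.symm h h' hc hd
      subst this
      exact ih hb a q h hp.1 hp.2 hq.1 hq.2

lemma three_leaves {V : Type*} [Finite V] {H : SimpleGraph V} (h2 : ∀ v, edeg H v ≤ 2)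
    {a b v : V} (ha : edeg H a ≤ 1) (hb : edeg H b ≤ 1) (hv : edeg H v ≤ 1)
    (hab : a ≠ b) (hav : a ≠ v) (hbv : b ≠ v) (r1 : H.Reachable a b) (r2 : H.Reachable a v) :
    False := by
  obtain ⟨p, hp⟩ := r1.exists_isPath
  obtain ⟨q, hq⟩ := r2.exists_isPath
  cases p with
  | nil => exact hab rfl
  | @cons _ c _ h p =>
    cases q with
    | nil => exact hav rfl
    | @cons _ d _ h' q =>
      rw [Walk.cons_isPath_iff] at hp hq
      have : c = d := by
        by_contra hcd
        have : ({c, d} : Set V).ncard ≤ edeg H a :=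
          Set.ncard_le_ncard (by rintro t (rfl | rfl) <;> assumption) (Set.toFinite _)
        rw [Set.ncard_pair hcd] at this
        omega
      subst this
      exact hbv (three_leaves_aux h2 p hb hv a q h hp.1 hp.2 hq.1 hq.2)

lemma caseA {V : Type*} [Finite V] {k : ℕ} {G0 : SimpleGraph V} {f : Sym2 V → ℕ}
    (hf : Col k G0 f) {v a b : V} (hv : ∀ x, ¬ G0.Adj v x) (hva : v ≠ a) (hvb : v ≠ b)
    (hab : a ≠ b) {i j : ℕ} (hi : i < k) (hj : j < k)
    (ha : edeg (cls G0 f i) a ≤ 1) (hb : edeg (cls G0 f j) b ≤ 1)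
    (hij : i ≠ j ∨ ¬ (cls G0 f i).Reachable a b) :
    ∃ f', Col k (G0 ⊔ edge v a ⊔ edge v b) f' := by
  classical
  have hvi : ∀ i x, ¬ (cls G0 f i).Adj v x := fun i x h => hv x (cls_le _ _ _ h)
  have hva' := hv a
  have f1 := hf.add hva (hv a) hi (by rw [edeg_isolated (hvi i)]; omega) ha
    (not_reach_of_isolated (hvi i) hva)
  refine ⟨_, f1.add hvb ?_ hj ?_ ?_ ?_⟩
  · simp only [sup_adj, edge_adj]
    have := hv b
    grind
  · by_cases h : j = i
    · subst h
      rw [cls_add_self hva hva']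
      exact (edeg_sup_edge_left _ _ _).trans (by rw [edeg_isolated (hvi j)])
    · rw [cls_add_ne hva' h, edeg_isolated (hvi j)]; omega
  · by_cases h : j = i
    · subst h
      rw [cls_add_self hva hva', edeg_sup_edge_ne _ hvb.symm hab.symm]
      exact hb
    · rw [cls_add_ne hva' h]; exact hb
  · by_cases h : j = i
    · subst h
      rw [cls_add_self hva hva']
      rintro ⟨w⟩
      have := (reach_contract (hvi j) w hvb.symm).1 rfl
      tauto
    · rw [cls_add_ne hva' h]
      exact not_reach_of_isolated (hvi j) hvb

lemma edeg_lt {V : Type*} [Finite V] {H H' : SimpleGraph V} (h : H ≤ H') {x y : V}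
    (h1 : H'.Adj x y) (h2 : ¬ H.Adj x y) : edeg H x < edeg H' x := by
  refine Set.ncard_lt_ncard ⟨fun _ hu => h hu, fun hh => h2 (hh h1)⟩ (Set.toFinite _)

lemma del_sup {V : Type*} {G : SimpleGraph V} {u v : V} (h : G.Adj u v) :
    G.deleteEdges {s(u, v)} ⊔ edge u v = G := by
  ext x y
  simp only [sup_adj, deleteEdges_adj, edge_adj, Set.mem_singleton_iff, Sym2.eq_iff]
  have := h.ne
  have := h.symm
  grind

lemma red1 {V : Type*} [Finite V] {k : ℕ} {G : SimpleGraph V} {v a : V} {f : Sym2 V → ℕ}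
    (hN : ∀ x, G.Adj v x ↔ x = a) (hdeg : edeg G a ≤ 2 * k)
    (hf : Col k (G.deleteEdges {s(v, a)}) f) : ∃ f, Col k G f := by
  classical
  have hva : G.Adj v a := (hN a).mpr rfl
  have hiso : ∀ x, ¬ (G.deleteEdges {s(v, a)}).Adj v x := by
    intro x hx
    rw [deleteEdges_adj, hN] at hx
    simp [hx.1] at hx
  have hlt : edeg (G.deleteEdges {s(v, a)}) a < edeg G a :=
    edeg_lt (deleteEdges_le _) hva.symm (fun h => hiso a h.symm)
  obtain ⟨i, hi, hs⟩ := hf.slack a (by omega)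
  have hci : ∀ x, ¬ (cls (G.deleteEdges {s(v, a)}) f i).Adj v x := fun x h => hiso x (cls_le _ _ _ h)
  have := hf.add hva.ne (hiso a) hi (by rw [edeg_isolated hci]; omega) hs
    (not_reach_of_isolated hci hva.ne)
  rw [del_sup hva] at this
  exact ⟨_, this⟩

lemma red2 {V : Type*} [Finite V] {k : ℕ} (hk : 2 ≤ k) {G : SimpleGraph V} {v a b : V} {f : Sym2 V → ℕ}
    (hab : a ≠ b) (hN : ∀ x, G.Adj v x ↔ x = a ∨ x = b) (hdeg : ∀ x, edeg G x ≤ 2 * k)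
    (hf : Col k (G.deleteEdges {s(v, a), s(v, b)}) f) (hno : ¬ ∃ f, Col k G f) :
    2 * k ≤ edeg G a ∧ 2 * k ≤ edeg G b ∧
    ∀ u₁ u₂, u₁ ≠ u₂ → u₁ ≠ v → u₂ ≠ v → G.Adj a u₁ → G.Adj a u₂ → edeg G u₁ ≤ 2 →
      edeg G u₂ ≤ 2 → False := by
  classical
  set G0 := G.deleteEdges {s(v, a), s(v, b)} with hG0
  have hle : G0 ≤ G := deleteEdges_le _
  have hva : G.Adj v a := (hN a).mpr (Or.inl rfl)
  have hvb : G.Adj v b := (hN b).mpr (Or.inr rfl)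
  have hiso : ∀ x, ¬ G0.Adj v x := by
    intro x hx
    rw [hG0, deleteEdges_adj, hN] at hx
    rcases hx with ⟨rfl | rfl, h⟩ <;> simp at h
  have hadj0 : ∀ x y, G.Adj x y → x ≠ v → y ≠ v → G0.Adj x y := by
    intro x y h h1 h2
    rw [hG0, deleteEdges_adj]
    refine ⟨h, ?_⟩
    simp only [Set.mem_insert_iff, Set.mem_singleton_iff, Sym2.eq_iff]
    grind
  have hG : G0 ⊔ edge v a ⊔ edge v b = G := by
    ext x y
    simp only [sup_adj, edge_adj]
    constructor
    · rintro ((h | h) | h)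
      · exact hle h
      · have := hva.symm; grind
      · have := hvb.symm; grind
    · intro h
      by_cases hx : x = v
      · subst hx
        have := (hN y).mp h
        have := h.ne
        grind
      by_cases hy : y = v
      · subst hy
        have := (hN x).mp h.symm
        have := h.ne
        grind
      exact Or.inl (Or.inl (hadj0 x y h hx hy))
  have hla : edeg G0 a < edeg G a := edeg_lt hle hva.symm (fun h => hiso a h.symm)
  have hlb : edeg G0 b < edeg G b := edeg_lt hle hvb.symm (fun h => hiso b h.symm)
  have da := hdeg a
  have db := hdeg b
  have key : ∀ f, Col k G0 f → ∀ i j, i < k → j < k → edeg (cls G0 f i) a ≤ 1 →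
      edeg (cls G0 f j) b ≤ 1 → i = j ∧ (cls G0 f i).Reachable a b := by
    intro f hf i j hi hj h1 h2
    by_contra hcon
    obtain ⟨f', hf'⟩ := caseA hf hiso hva.ne hvb.ne hab hi hj h1 h2 (by tauto)
    rw [hG] at hf'
    exact hno ⟨f', hf'⟩
  obtain ⟨i, hi, hsa⟩ := hf.slack a (by omega)
  obtain ⟨j, hj, hsb⟩ := hf.slack b (by omega)
  obtain ⟨rfl, hr⟩ := key f hf i j hi hj hsa hsb
  have pos : ∀ {H : SimpleGraph V} {x y : V}, x ≠ y → H.Reachable x y → 1 ≤ edeg H x := by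
    intro H x y hxy hr
    by_contra h
    have h0 : edeg H x = 0 := by omega
    refine not_reach_of_isolated (fun z hz => ?_) hxy hr
    rw [edeg, Set.ncard_eq_zero (Set.toFinite _)] at h0
    exact (Set.ext_iff.mp h0 z).mp hz
  have ta : 2 * k ≤ edeg G0 a + 1 := hf.tight a i (pos hab hr) (by
    intro j hj hji
    by_contra h
    exact hji (key f hf j i hj hi (by omega) hsb).1) hi
  have tb : 2 * k ≤ edeg G0 b + 1 := hf.tight b i (pos hab.symm hr.symm) (by
    intro j hj hji
    by_contra h
    exact hji (key f hf i j hi hj hsa (by omega)).1.symm) hi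
  refine ⟨by omega, by omega, ?_⟩
  have hu : ∀ u, u ≠ v → G.Adj a u → edeg G u ≤ 2 → f s(a, u) = i := by
    intro u huv hau hdu
    by_contra hc
    set c := f s(a, u) with hcdef
    have hau0 : G0.Adj a u := hadj0 a u hau hva.ne' huv
    have hub : b ≠ u := by rintro rfl; omega
    set G1 := G0.deleteEdges {s(a, u)} with hG1
    have hG10 : G1 ≤ G0 := deleteEdges_le _
    have hnau : ¬ G1.Adj a u := by simp [hG1]
    have hd1u : edeg G1 u < edeg G u := edeg_lt (hG10.trans hle) hau.symm (fun h => hnau h.symm)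
    have hHG1 : cls G0 f i ≤ G1 := by
      intro x y hxy
      rw [cls_adj] at hxy
      rw [hG1, deleteEdges_adj]
      refine ⟨hxy.1, ?_⟩
      rw [Set.mem_singleton_iff]
      intro h
      rw [h] at hxy
      exact hc hxy.2
    have f1 := (hf.mono hG10).add hau.ne hnau hi ((edeg_mono (cls_mono hG10 f i) a).trans hsa)
      ((edeg_mono (cls_le _ _ _) u).trans (by omega)) (by
        intro hr'
        exact three_leaves (hf.2 i).2 hsa hsb ((edeg_mono hHG1 u).trans (by omega)) hab hau.ne hub hr
          (hr'.mono (cls_mono hG10 f i)))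
    have hG0' : G1 ⊔ edge a u = G0 := del_sup hau0
    have hck : c < k := hf.1 _ hau0
    have e1 : edeg (cls G0 (Function.update f s(a, u) i) c) a ≤ 1 := by
      have : edeg (cls G1 f c) a < edeg (cls G0 f c) a :=
        edeg_lt (cls_mono hG10 f c) (cls_adj.mpr ⟨hau0, rfl⟩) (fun h => hnau (cls_le _ _ _ h))
      have h2 := (hf.2 c).2 a
      rw [← hG0', cls_add_ne hnau hc]
      omega
    have e2 : edeg (cls G0 (Function.update f s(a, u) i) i) b ≤ 1 := by
      rw [← hG0', cls_add_self hau.ne hnau, edeg_sup_edge_ne _ hab.symm hub]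
      exact (edeg_mono (cls_mono hG10 f i) b).trans hsb
    rw [hG0'] at f1
    exact hc (key _ f1 c i hck hi e1 e2).1
  intro u₁ u₂ hne h1 h2 ha1 ha2 hd1 hd2
  have g1 := hu u₁ h1 ha1 hd1
  have g2 := hu u₂ h2 ha2 hd2
  have : ({u₁, u₂} : Set V).ncard ≤ edeg (cls G0 f i) a := by
    refine Set.ncard_le_ncard ?_ (Set.toFinite _)
    rintro t (rfl | rfl)
    · exact cls_adj.mpr ⟨hadj0 _ _ ha1 hva.ne' h1, g1⟩
    · exact cls_adj.mpr ⟨hadj0 _ _ ha2 hva.ne' h2, g2⟩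
  rw [Set.ncard_pair hne] at this
  omega

lemma chordless_anti {V : Type*} {G G' : SimpleGraph V} (hch : Chordless G) (h : G' ≤ G) :
    Chordless G' := by
  rintro u v huv ⟨x, w, hw, hu, hv⟩
  have hle : G'.deleteEdges {s(u, v)} ≤ G.deleteEdges {s(u, v)} := deleteEdges_mono h
  exact hch u v (h huv) ⟨x, w.mapLe hle, (Walk.isCycle_mapLe hle).mpr hw, by simpa using hu, by simpa using hv⟩

lemma main {V : Type*} [Finite V] {k : ℕ} (hk : 2 ≤ k) : ∀ (n : ℕ) (G : SimpleGraph V),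
    G.edgeSet.ncard = n → Chordless G → (∀ x, edeg G x ≤ 2 * k) → ∃ f, Col k G f := by
  intro n
  induction n using Nat.strong_induction_on with
  | _ n ih =>
  intro G hn hch hdeg
  by_contra hno
  have sub : ∀ (s : Set (Sym2 V)) (e : Sym2 V), e ∈ s → e ∈ G.edgeSet → ∃ f, Col k (G.deleteEdges s) f := by
    intro s e hes he
    have hle : G.deleteEdges s ≤ G := deleteEdges_le _
    refine ih _ ?_ (G.deleteEdges s) rfl (chordless_anti hch hle) (fun x => (edeg_mono hle x).trans (hdeg x))
    rw [← hn]
    refine Set.ncard_lt_ncard ⟨edgeSet_subset_edgeSet.mpr hle, fun h => ?_⟩ (Set.toFinite _)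
    have := h he
    rw [edgeSet_deleteEdges] at this
    exact this.2 hes
  have no1 : ∀ v, edeg G v ≠ 1 := by
    intro v hv
    obtain ⟨a, ha⟩ := Set.ncard_eq_one.mp hv
    have hN : ∀ x, G.Adj v x ↔ x = a := fun x => Set.ext_iff.mp ha x
    obtain ⟨f, hf⟩ := sub {s(v, a)} s(v, a) rfl ((hN a).mpr rfl)
    exact hno (red1 hN (hdeg a) hf)
  have two : ∀ v a, G.Adj v a → edeg G v ≤ 2 → 2 * k ≤ edeg G a ∧ (∃ a', a' ≠ a ∧ G.Adj v a') ∧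
      ∀ u₁ u₂, u₁ ≠ u₂ → u₁ ≠ v → u₂ ≠ v → G.Adj a u₁ → G.Adj a u₂ → edeg G u₁ ≤ 2 →
      edeg G u₂ ≤ 2 → False := by
    intro v a hva hv
    have h1 := no1 v
    have h0 : edeg G v ≠ 0 := by
      intro h
      rw [edeg, Set.ncard_eq_zero (Set.toFinite _)] at h
      exact (Set.ext_iff.mp h a).mp hva
    have h2 : edeg G v = 2 := by omega
    obtain ⟨x, y, hxy, he⟩ := Set.ncard_eq_two.mp h2
    have hN : ∀ z, G.Adj v z ↔ z = x ∨ z = y := fun z => Set.ext_iff.mp he z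
    obtain ⟨b, hab, hN⟩ : ∃ b, a ≠ b ∧ ∀ z, G.Adj v z ↔ z = a ∨ z = b := by
      rcases (hN a).mp hva with rfl | rfl
      · exact ⟨y, hxy, hN⟩
      · exact ⟨x, hxy.symm, fun z => (hN z).trans or_comm⟩
    obtain ⟨f, hf⟩ := sub {s(v, a), s(v, b)} s(v, a) (Or.inl rfl) hva
    obtain ⟨r1, -, r3⟩ := red2 hk hab hN hdeg hf hno
    exact ⟨r1, ⟨b, hab.symm, (hN b).mpr (Or.inr rfl)⟩, r3⟩
  by_cases hE : ∃ u v, G.Adj u v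
  swap
  · push Not at hE
    refine hno ⟨fun _ => 0, ?_, ?_⟩
    · intro e he
      induction e with
      | _ x y => exact absurd he (hE x y)
    · intro i
      have : cls G (fun _ => 0) i = ⊥ := by
        ext x y
        simp [cls_adj, hE x y]
      rw [this]
      exact ⟨isAcyclic_bot, fun v => by rw [edeg_isolated (by simp)]; omega⟩
  obtain ⟨u, v, huv⟩ := hE
  set B : Set V := {x | 3 ≤ edeg G x} with hB
  have counts : ∀ b ∈ B, ∃ m l, m = ({x | G.Adj b x} ∩ B).ncard ∧ l = ({x | G.Adj b x} \ B).ncard ∧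
      2 ≤ m ∧ (2 ≤ l ∨ 3 ≤ m) := by
    intro b hb
    refine ⟨_, _, rfl, rfl, ?_⟩
    have hsum : ({x | G.Adj b x} ∩ B).ncard + ({x | G.Adj b x} \ B).ncard = edeg G b :=
      Set.ncard_inter_add_ncard_sdiff_eq_ncard _ _ (Set.toFinite _)
    have hb3 : 3 ≤ edeg G b := hb
    have c1 : ({x | G.Adj b x} \ B).ncard ≤ 2 := by
      by_contra h
      push Not at h
      obtain ⟨x, hx, y, hy, z, hz, hxy, hxz, hyz⟩ := (Set.two_lt_ncard (Set.toFinite _)).mp h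
      have d : ∀ t, t ∉ B → edeg G t ≤ 2 := fun t ht => by
        have : ¬ 3 ≤ edeg G t := ht
        omega
      exact (two x b (SimpleGraph.Adj.symm hx.1) (d x hx.2)).2.2 y z hyz hxy.symm hxz.symm hy.1 hz.1 (d y hy.2) (d z hz.2)
    have c2 : 0 < ({x | G.Adj b x} \ B).ncard → 4 ≤ edeg G b := by
      intro h
      obtain ⟨x, hx⟩ := (Set.ncard_pos (Set.toFinite _)).mp h
      have : ¬ 3 ≤ edeg G x := hx.2
      have := (two x b (SimpleGraph.Adj.symm hx.1) (by omega)).1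
      omega
    omega
  refine struct hch B ?_ ?_ ?_ ?_
  · by_cases h : u ∈ B
    · exact ⟨u, h⟩
    · have h' : ¬ 3 ≤ edeg G u := h
      have := (two u v huv (by omega)).1
      exact ⟨v, show 3 ≤ edeg G v by omega⟩
  · intro b hb
    obtain ⟨m, l, rfl, rfl, hm, -⟩ := counts b hb
    obtain ⟨x, hx, y, hy, hxy⟩ := (Set.one_lt_ncard (Set.toFinite _)).mp hm
    exact ⟨x, y, hxy, hx.2, hy.2, hx.1, hy.1⟩
  · intro v hv a hva
    have h' : ¬ 3 ≤ edeg G v := hv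
    obtain ⟨r1, r2, -⟩ := two v a hva (by omega)
    exact ⟨show 3 ≤ edeg G a by omega, r2⟩
  · intro b hb
    obtain ⟨m, l, rfl, rfl, -, hm | hm⟩ := counts b hb
    · left
      obtain ⟨x, hx, y, hy, hxy⟩ := (Set.one_lt_ncard (Set.toFinite _)).mp hm
      exact ⟨x, y, hxy, hx.2, hy.2, hx.1, hy.1⟩
    · right
      obtain ⟨x, hx, y, hy, z, hz, hxy, hxz, hyz⟩ := (Set.two_lt_ncard (Set.toFinite _)).mp hm
      exact ⟨x, y, z, hxy, hxz, hyz, hx.2, hy.2, hz.2, hx.1, hy.1, hz.1⟩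

lemma edeg_eq {V : Type*} [Fintype V] (G : SimpleGraph V) [DecidableRel G.Adj] (v : V) :
    edeg G v = G.degree v := by
  unfold edeg
  rw [← card_neighborFinset_eq_degree, Set.ncard_eq_toFinset_card']
  congr 1

lemma la_eq {V : Type*} {G : SimpleGraph V} {n : ℕ} (h1 : ∃ f, Col n G f)
    (h2 : ∀ m f, Col m G f → n ≤ m) : linearArboricity G = n := by
  apply le_antisymm
  · exact Nat.sInf_le h1
  · refine le_csInf ⟨n, h1⟩ ?_
    rintro m ⟨f, hf⟩
    exact h2 m f hf

lemma col_zero {V : Type*} [Finite V] {G : SimpleGraph V} {k : ℕ} (hk : 0 < k) (hG : IsLinearForest G) :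
    Col k G (fun _ => 0) :=
  ⟨fun _ _ => hk, fun i => LF_mono (cls_le G _ i) hG⟩

end LA

theorem stmt11 {V : Type*} [Fintype V] (G : SimpleGraph V) [DecidableRel G.Adj]
    (hch : Chordless G) :
    (¬ (G.maxDegree = 2 ∧ ¬ G.IsAcyclic) →
      linearArboricity G = (G.maxDegree + 1) / 2) ∧
    ((G.maxDegree = 2 ∧ ¬ G.IsAcyclic) → linearArboricity G = 2) := by
  classical
  have hle : ∀ v, edeg G v ≤ G.maxDegree := fun v => by
    rw [LA.edeg_eq]; exact G.degree_le_maxDegree v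
  have hlow : ∀ m f, LA.Col m G f → G.maxDegree ≤ 2 * m := fun m f hf =>
    G.maxDegree_le_of_forall_degree_le _ (fun v => by rw [← LA.edeg_eq]; exact hf.le v)
  constructor
  · intro hcase
    apply LA.la_eq
    · by_cases h3 : 3 ≤ G.maxDegree
      · exact LA.main (by omega) _ G rfl hch (fun x => (hle x).trans (by omega))
      by_cases h0 : G.maxDegree = 0
      · have hE : ∀ x y, ¬ G.Adj x y := by
          intro x y h
          have h1 := hle x
          rw [LA.edeg_eq] at h1
          have : 0 < G.degree x := (G.degree_pos_iff_exists_adj x).mpr ⟨y, h⟩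
          omega
        refine ⟨fun _ => 0, ?_, fun i => ?_⟩
        · intro e he
          induction e with
          | _ x y => exact absurd he (hE x y)
        · refine LA.LF_mono (H' := ⊥) ?_ ⟨isAcyclic_bot, fun v => by rw [LA.edeg_isolated (by simp)]; omega⟩
          intro x y h
          exact absurd (LA.cls_le _ _ _ h) (hE x y)
      · refine ⟨_, LA.col_zero (by omega) ⟨?_, fun v => (hle v).trans (by omega)⟩⟩
        by_cases h2 : G.maxDegree = 2
        · tauto
        · intro v w hw
          have h1 := hle v
          have hs : G.Adj v w.snd := w.adj_snd hw.not_nil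
          have hp : G.Adj v w.penultimate := (w.adj_penultimate hw.not_nil).symm
          have : ({w.snd, w.penultimate} : Set V).ncard ≤ edeg G v :=
            Set.ncard_le_ncard (by rintro t (rfl | rfl) <;> assumption) (Set.toFinite _)
          rw [Set.ncard_pair hw.snd_ne_penultimate] at this
          omega
    · intro m f hf
      have := hlow m f hf
      omega
  · rintro ⟨h2, hac⟩
    apply LA.la_eq
    · exact LA.main le_rfl _ G rfl hch (fun x => (hle x).trans (by omega))
    · intro m f hf
      have := hlow m f hf
      by_contra hm
      have hm1 : m = 1 := by omega
      subst hm1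
      refine hac ((hf.2 0).1.anti ?_)
      intro x y h
      have := hf.1 s(x, y) h
      exact LA.cls_adj.mpr ⟨h, by omega⟩
end
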